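/- Every triple derivation on a von Neumann algebra is an inner triple derivation: if M is a von Neumann algebra on a complex Hilbert space H and δ : M → M is a bounded linear map satisfying δ({a b c}) = {δ(a) b c} + {a δ(b) c} + {a b δ(c)} for all a, b, c ∈ M, where {a b c} = (a b* c + c b* a)/2, then there exist finitely many aᵢ, bᵢ ∈ M such that δ(x) = Σᵢ ({aᵢ bᵢ x} − {bᵢ aᵢ x}) for all x ∈ M. -/

import Mathlib

/-- The Jordan triple product `{a b c} = (a b* c + c b* a)/2` on a complex *-algebra. -/
noncomputable def tripleProd {A : Type*} [NonUnitalRing A] [Module ℂ A] [Star A]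
    (a b c : A) : A :=
  (2⁻¹ : ℂ) • (a * star b * c + c * star b * a)

section JordanDerivation

variable {R : Type*} [Ring R]

/-- In a 2-torsion free semiprime ring, `a z b + b z a = 0` for all `z` forces `a z b = 0`. -/
theorem mul_mul_eq_zero_of_symm (h2 : ∀ a : R, a + a = 0 → a = 0)
    (hsp : ∀ a : R, (∀ z, a * z * a = 0) → a = 0) {a b : R}
    (h : ∀ z, a * z * b + b * z * a = 0) (z : R) : a * z * b = 0 := by
  apply hsp
  intro w
  apply h2
  have e1 : a * z * b = -(b * z * a) := eq_neg_of_add_eq_zero_left (h z)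
  have e2 : b * (z * a * w) * a = -(a * (z * a * w) * b) :=
    eq_neg_of_add_eq_zero_right (h (z * a * w))
  have e4 : b * w * a = -(a * w * b) := eq_neg_of_add_eq_zero_right (h w)
  have l : a * z * b * w * (a * z * b) = a * z * a * w * b * z * b := by
    calc a * z * b * w * (a * z * b) = -(b * z * a) * w * (a * z * b) := by rw [← e1]
      _ = -(b * (z * a * w) * a) * z * b := by noncomm_ring
      _ = a * z * a * w * b * z * b := by rw [e2]; noncomm_ring
  have r : a * z * b * w * (a * z * b) = -(a * z * a * w * b * z * b) := by
    calc a * z * b * w * (a * z * b) = a * z * (b * w * a) * z * b := by noncomm_ring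
      _ = -(a * z * a * w * b * z * b) := by rw [e4]; noncomm_ring
  nth_rewrite 1 [l]
  rw [r]; simp

/-- Brešar: an additive Jordan derivation on a 2-torsion free semiprime ring is a derivation. -/
theorem jordan_derivation_leibniz (h2 : ∀ a : R, a + a = 0 → a = 0)
    (hsp : ∀ a : R, (∀ z, a * z * a = 0) → a = 0) (D : R →+ R)
    (hD : ∀ x, D (x * x) = D x * x + x * D x) (x y : R) :
    D (x * y) = D x * y + x * D y := by
  have half : ∀ {a b : R}, a + a = b + b → a = b := fun {a b} hab => by
    have := h2 (a - b) (by rw [← sub_eq_zero] at hab; rw [← hab]; abel)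
    exact sub_eq_zero.1 this
  have j1 : ∀ x y, D (x * y + y * x) = D x * y + x * D y + (D y * x + y * D x) := by
    intro x y
    have h := hD (x + y)
    have e : (x + y) * (x + y) = x * x + (x * y + y * x) + y * y := by noncomm_ring
    rw [e, map_add, map_add, hD, hD, map_add D x y] at h
    have : D (x * y + y * x) = (D x * x + x * D x + D (x * y + y * x) + (D y * y + y * D y))
      - (D x * x + x * D x) - (D y * y + y * D y) := by abel
    rw [this, h]; noncomm_ring
  have j2 : ∀ x y, D (x * y * x) = D x * y * x + x * D y * x + x * y * D x := by
    intro x y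
    apply half
    have h := j1 x (x * y + y * x)
    rw [j1 x y] at h
    have e : x * (x * y + y * x) + (x * y + y * x) * x
      = (x * y * x + x * y * x) + ((x * x) * y + y * (x * x)) := by noncomm_ring
    rw [e, map_add, map_add, j1, hD] at h
    rw [eq_sub_of_add_eq h]
    noncomm_ring
  have j3 : ∀ x y z, D (x * y * z + z * y * x) =
      D x * y * z + x * D y * z + x * y * D z + (D z * y * x + z * D y * x + z * y * D x) := by
    intro x y z
    have h := j2 (x + z) y
    have e : (x + z) * y * (x + z) = x * y * x + (x * y * z + z * y * x) + z * y * z := by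
      noncomm_ring
    rw [e, map_add, map_add, j2, j2, map_add D x z] at h
    have : D (x * y * z + z * y * x) = (D x * y * x + x * D y * x + x * y * D x +
      D (x * y * z + z * y * x) + (D z * y * z + z * D y * z + z * y * D z))
      - (D x * y * x + x * D y * x + x * y * D x) - (D z * y * z + z * D y * z + z * y * D z) := by
      abel
    rw [this, h]; noncomm_ring
  let B : R → R → R := fun x y => D (x * y) - D x * y - x * D y
  have hBanti : ∀ x y, B y x = - B x y := by
    intro x y
    have := j1 x y
    rw [map_add] at this
    simp only [B]
    rw [eq_sub_of_add_eq' this]; abel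
  have hBaddl : ∀ x u y, B (x + u) y = B x y + B u y := by
    intro x u y; simp only [B, add_mul, map_add]; abel
  have hBaddr : ∀ x y v, B x (y + v) = B x y + B x v := by
    intro x u y; simp only [B, mul_add, map_add]; abel
  have j4 : ∀ x y z, B x y * z * (x * y - y * x) + (x * y - y * x) * z * B x y = 0 := by
    intro x y z
    have ha := j3 (x * y) z (y * x)
    have e : x * y * z * (y * x) + y * x * z * (x * y) =
        x * (y * z * y) * x + y * (x * z * x) * y := by
      noncomm_ring
    rw [e, map_add, j2, j2, j2, j2] at ha
    have hb := hBanti x y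
    have hyx : D (y * x) = D y * x + y * D x - B x y := by
      have : D (y * x) = B y x + D y * x + y * D x := by simp only [B]; abel
      rw [this, hb]; abel
    have hxy : D (x * y) = D x * y + x * D y + B x y := by simp only [B]; abel
    rw [hyx, hxy] at ha
    rw [← sub_eq_zero] at ha
    rw [← ha]
    noncomm_ring
  have j5 : ∀ x y z, B x y * z * (x * y - y * x) = 0 := fun x y z =>
    mul_mul_eq_zero_of_symm h2 hsp (j4 x y) z
  have j5' : ∀ x y z, (x * y - y * x) * z * B x y = 0 := fun x y z => by
    have := j4 x y z; rwa [j5, zero_add] at this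
  have j6 : ∀ x u y z, B x y * z * (u * y - y * u) = 0 := by
    intro x u y z
    apply hsp
    intro w
    have hl : ∀ z, B x y * z * (u * y - y * u) = - (B u y * z * (x * y - y * x)) := by
      intro z
      have h := j5 (x + u) y z
      have h1 := j5 x y z
      have h2 := j5 u y z
      rw [hBaddl] at h
      have e : (B x y + B u y) * z * ((x + u) * y - y * (x + u)) = B x y * z * (x * y - y * x)
        + B u y * z * (u * y - y * u) + (B x y * z * (u * y - y * u)
          + B u y * z * (x * y - y * x)) := by noncomm_ring
      rw [e, h1, h2, zero_add, zero_add] at h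
      exact eq_neg_of_add_eq_zero_left h
    calc B x y * z * (u * y - y * u) * w * (B x y * z * (u * y - y * u))
        = B x y * z * (u * y - y * u) * w * (- (B u y * z * (x * y - y * x))) := by rw [hl z]
      _ = - (B x y * z * ((u * y - y * u) * w * B u y) * z * (x * y - y * x)) := by noncomm_ring
      _ = 0 := by rw [j5']; simp
  have j6' : ∀ x u y z, (u * y - y * u) * z * B x y = 0 := by
    intro x u y z
    apply hsp
    intro w
    calc (u * y - y * u) * z * B x y * w * ((u * y - y * u) * z * B x y)
        = (u * y - y * u) * z * (B x y * w * (u * y - y * u)) * z * B x y := by noncomm_ring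
      _ = 0 := by rw [j6]; simp
  have j7 : ∀ x y u v z, B x y * z * (u * v - v * u) = 0 := by
    intro x y u v z
    apply hsp
    intro w
    have hl : B x y * z * (u * v - v * u) = - (B x v * z * (u * y - y * u)) := by
      have h := j6 x u (y + v) z
      have h1 := j6 x u y z
      have h2 := j6 x u v z
      rw [hBaddr] at h
      have e : (B x y + B x v) * z * (u * (y + v) - (y + v) * u) = B x y * z * (u * y - y * u)
        + B x v * z * (u * v - v * u) + (B x y * z * (u * v - v * u)
          + B x v * z * (u * y - y * u)) := by noncomm_ring
      rw [e, h1, h2, zero_add, zero_add] at h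
      exact eq_neg_of_add_eq_zero_left h
    calc B x y * z * (u * v - v * u) * w * (B x y * z * (u * v - v * u))
        = B x y * z * (u * v - v * u) * w * (- (B x v * z * (u * y - y * u))) := by
          nth_rewrite 2 [hl]; rfl
      _ = - (B x y * z * ((u * v - v * u) * w * B x v) * z * (u * y - y * u)) := by noncomm_ring
      _ = 0 := by rw [j6']; simp
  set b := B x y with hb
  have hcomm : ∀ r, b * r = r * b := by
    intro r
    rw [← sub_eq_zero]
    apply hsp
    intro z
    have e : (b * r - r * b) * z * (b * r - r * b) =
      b * (r * z) * (b * r - r * b) - r * (b * z * (b * r - r * b)) := by noncomm_ring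
    rw [e, hb, j7, j7]; simp
  have hbc : ∀ u v z, b * z * (u * v - v * u) = 0 := fun u v z => j7 x y u v z
  have hb1 : b * (x * y - y * x) = 0 := by simpa using hbc x y 1
  have hb1' : (x * y - y * x) * b = 0 := by rw [← hcomm, hb1]
  have h8 := j1 b (x * y - y * x)
  rw [hb1, hb1', add_zero, map_zero] at h8
  have h9 : b * b * D (x * y - y * x) = 0 := by
    apply h2
    have h10 : b * (D b * (x * y - y * x) + b * D (x * y - y * x) +
        (D (x * y - y * x) * b + (x * y - y * x) * D b)) = 0 := by rw [← h8, mul_zero]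
    have e : b * (D b * (x * y - y * x) + b * D (x * y - y * x) +
        (D (x * y - y * x) * b + (x * y - y * x) * D b)) = b * D b * (x * y - y * x) +
        b * b * D (x * y - y * x) + b * (D (x * y - y * x) * b)
          + b * (x * y - y * x) * D b := by noncomm_ring
    rw [e, hbc, hb1, ← hcomm (D (x * y - y * x))] at h10
    rw [← h10]; noncomm_ring
  have h10 : b + b = D (x * y - y * x) - (D x * y - y * D x) - (x * D y - D y * x) := by
    have : b + b = B x y - B y x := by rw [hBanti x y, hb]; abel
    rw [this, map_sub]; simp only [B]; abel
  have h11 : b * b * b = 0 := by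
    apply h2
    have e : b * b * b + b * b * b = b * b * (b + b) := by noncomm_ring
    rw [e, h10]
    have e1 : b * b * (D x * y - y * D x) = 0 := hbc _ _ b
    have e2 : b * b * (x * D y - D y * x) = 0 := hbc _ _ b
    rw [mul_sub, mul_sub, h9, e1, e2]; simp
  have h12 : b * b = 0 := by
    apply hsp
    intro z
    have e : b * b * z * (b * b) = b * b * (z * b) * b := by noncomm_ring
    rw [e, ← hcomm z]
    have : b * b * (b * z) * b = b * b * b * z * b := by noncomm_ring
    rw [this, h11]; simp
  have h13 : b = 0 := by
    apply hsp
    intro z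
    rw [hcomm z, mul_assoc, h12, mul_zero]
  have : D (x * y) = b + D x * y + x * D y := by rw [hb]; simp only [B]; abel
  rw [this, h13, zero_add]

end JordanDerivation

universe u

open Complex in
theorem exists_entire_kernel {η : ℝ} (hη : 0 < η) :
    ∃ k : ℂ → ℂ, Differentiable ℂ k ∧
      (∃ C, 0 ≤ C ∧ ∀ z, ‖k z‖ ≤ C * Real.exp (2 * η * |z.im|) * (1 + z.re ^ 2)⁻¹) ∧
      (∫ x : ℝ, k x) ≠ 0 := by
  set S : ℂ → ℂ := dslope Complex.sin 0 with hS
  have hSd : Differentiable ℂ S := by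
    rw [← differentiableOn_univ]
    exact (Complex.differentiableOn_dslope (Filter.univ_mem)).2
      Complex.differentiable_sin.differentiableOn
  have hS0 : ∀ z, z ≠ 0 → S z = Complex.sin z / z := by
    intro z hz
    rw [hS, dslope_of_ne _ hz, slope_def_field]; simp
  have hsin : ∀ z : ℂ, ‖Complex.sin z‖ ≤ Real.exp |z.im| := by
    intro z
    rw [Complex.sin]
    have h1 : ‖cexp (-z * I)‖ ≤ Real.exp |z.im| := by
      rw [Complex.norm_exp]; apply Real.exp_le_exp.2; simp [le_abs_self]
    have h2 : ‖cexp (z * I)‖ ≤ Real.exp |z.im| := by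
      rw [Complex.norm_exp]; apply Real.exp_le_exp.2; simp [neg_le_abs]
    rw [norm_div, norm_mul]
    have := norm_sub_le (cexp (-z * I)) (cexp (z * I))
    simp only [norm_I, mul_one, Complex.norm_ofNat]
    linarith
  obtain ⟨M, hM⟩ := (isCompact_closedBall (0 : ℂ) 1).exists_bound_of_continuousOn
    hSd.continuous.continuousOn
  have hbd : ∀ w, ‖S w‖ ^ 2 ≤ 2 * (1 + M ^ 2) * Real.exp (2 * |w.im|) * (1 + w.re ^ 2)⁻¹ := by
    intro w
    have hre : w.re ^ 2 ≤ ‖w‖ ^ 2 := by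
      rw [Complex.sq_norm, Complex.normSq_apply]; nlinarith [sq_nonneg w.im]
    have hpos : 0 < 1 + w.re ^ 2 := by positivity
    rw [← div_eq_mul_inv, le_div_iff₀ hpos]
    have hexp1 : 1 ≤ Real.exp (2 * |w.im|) := Real.one_le_exp (by positivity)
    rcases le_or_gt ‖w‖ 1 with h | h
    · have h1 := hM w (by simpa using h)
      have h2 : ‖S w‖ ^ 2 ≤ M ^ 2 := by gcongr
      have h3 : w.re ^ 2 ≤ 1 := hre.trans (by nlinarith [norm_nonneg w])
      calc ‖S w‖ ^ 2 * (1 + w.re ^ 2) ≤ M ^ 2 * 2 := by gcongr; linarith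
        _ ≤ 2 * (1 + M ^ 2) * 1 := by linarith
        _ ≤ _ := by gcongr
    · have hw : w ≠ 0 := by rintro rfl; simp at h; linarith
      rw [hS0 w hw, norm_div, div_pow, div_mul_eq_mul_div, div_le_iff₀ (by positivity)]
      have h1 : ‖Complex.sin w‖ ^ 2 ≤ Real.exp (2 * |w.im|) := by
        calc _ ≤ (Real.exp |w.im|) ^ 2 := by gcongr; exact hsin w
          _ = _ := by rw [← Real.exp_nat_mul]; norm_num
      have h2 : 1 + w.re ^ 2 ≤ 2 * ‖w‖ ^ 2 := by nlinarith
      calc _ ≤ Real.exp (2 * |w.im|) * (2 * ‖w‖ ^ 2) := by gcongr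
        _ = 2 * (1 + 0) * Real.exp (2 * |w.im|) * ‖w‖ ^ 2 := by ring
        _ ≤ _ := by gcongr; positivity
  have hb2 : ∀ z : ℂ, ‖S (η * z) ^ 2‖ ≤
      2 * (1 + M ^ 2) * (1 + (η ^ 2)⁻¹) * Real.exp (2 * η * |z.im|) * (1 + z.re ^ 2)⁻¹ := by
    intro z
    rw [norm_pow]
    refine (hbd _).trans ?_
    have e1 : ((η : ℂ) * z).im = η * z.im := by simp
    have e2 : ((η : ℂ) * z).re = η * z.re := by simp
    rw [e1, e2, abs_mul, abs_of_pos hη]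
    have h3 : (1 + (η * z.re) ^ 2)⁻¹ ≤ (1 + (η ^ 2)⁻¹) * (1 + z.re ^ 2)⁻¹ := by
      rw [← div_eq_mul_inv, inv_eq_one_div, div_le_div_iff₀ (by positivity) (by positivity)]
      have : (1 + (η ^ 2)⁻¹) * (1 + (η * z.re) ^ 2) =
          1 + (η * z.re) ^ 2 + (η ^ 2)⁻¹ + z.re ^ 2 := by
        field_simp; ring
      rw [this]
      have : 0 < (η ^ 2)⁻¹ := by positivity
      nlinarith [sq_nonneg (η * z.re)]
    calc _ ≤ 2 * (1 + M ^ 2) * Real.exp (2 * (η * |z.im|)) *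
          ((1 + (η ^ 2)⁻¹) * (1 + z.re ^ 2)⁻¹) := by gcongr
      _ = _ := by ring_nf
  refine ⟨fun z => S (η * z) ^ 2, by fun_prop, ⟨_, by positivity, hb2⟩, ?_⟩
  have hsinc : ∀ x : ℝ, S (η * x) ^ 2 = ((Real.sinc (η * x) ^ 2 : ℝ) : ℂ) := by
    intro x
    rcases eq_or_ne (η * x) 0 with h | h
    · have : (η : ℂ) * x = 0 := by exact_mod_cast h
      rw [this, h, hS]; simp
    · have h' : (η : ℂ) * x ≠ 0 := by exact_mod_cast h
      rw [hS0 _ h', Real.sinc_of_ne_zero h]; push_cast; rfl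
  have h_int : MeasureTheory.Integrable (fun x : ℝ => Real.sinc (η * x) ^ 2) := by
    refine (integrable_inv_one_add_sq.const_mul (2 * (1 + M ^ 2) * (1 + (η ^ 2)⁻¹))).mono'
      (by fun_prop) (Filter.Eventually.of_forall fun x => ?_)
    have := hb2 x
    rw [hsinc] at this
    simpa using this
  simp only [hsinc]
  rw [integral_complex_ofReal]
  refine Complex.ofReal_ne_zero.2 (ne_of_gt ?_)
  rw [MeasureTheory.integral_pos_iff_support_of_nonneg (fun x => by positivity) h_int]
  refine IsOpen.measure_pos _ (Continuous.isOpen_support (by fun_prop)) ⟨0, by simp⟩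

open Complex Filter Topology MeasureTheory in
theorem integral_eq_integral_add_mul_I {E : Type*} [NormedAddCommGroup E] [NormedSpace ℂ E]
    [CompleteSpace E] {g : ℂ → E} (hg : Differentiable ℂ g) {B t : ℝ}
    (hb : ∀ z : ℂ, |z.im| ≤ |t| → ‖g z‖ ≤ B * (1 + z.re ^ 2)⁻¹) :
    ∫ x : ℝ, g x = ∫ x : ℝ, g (x + t * I) := by
  have hi : ∀ s : ℝ, |s| ≤ |t| → Integrable (fun x : ℝ => g (x + s * I)) := by
    intro s hs
    refine (integrable_inv_one_add_sq.const_mul B).mono' ?_ (Eventually.of_forall fun x => ?_)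
    · exact (hg.continuous.comp (by fun_prop)).aestronglyMeasurable
    · have := hb (x + s * I) (by simpa using hs)
      simpa using this
  have h0 := hi 0 (by simp)
  have ht := hi t le_rfl
  simp only [ofReal_zero, zero_mul, add_zero] at h0
  have l0 := intervalIntegral_tendsto_integral h0 tendsto_neg_atTop_atBot tendsto_id
  have lt := intervalIntegral_tendsto_integral ht tendsto_neg_atTop_atBot tendsto_id
  have hedge : ∀ σ : ℝ, σ ^ 2 = 1 →
      Tendsto (fun T : ℝ => I • ∫ y in (0 : ℝ)..t, g ((σ * T : ℝ) + y * I)) atTop (𝓝 0) := by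
    intro σ hσ
    have hT : Tendsto (fun T : ℝ => B * (1 + T ^ 2)⁻¹ * |t - 0|) atTop (𝓝 0) := by
      have : Tendsto (fun T : ℝ => (1 + T ^ 2)⁻¹) atTop (𝓝 0) :=
        (tendsto_atTop_add_const_left _ _ (tendsto_pow_atTop two_ne_zero)).inv_tendsto_atTop
      simpa using (this.const_mul B).mul_const |t - 0|
    refine squeeze_zero_norm (fun T => ?_) hT
    rw [norm_smul, norm_I, one_mul]
    refine intervalIntegral.norm_integral_le_of_norm_le_const fun y hy => ?_
    have hy' : |y| ≤ |t| := by
      rw [Set.uIoc, Set.mem_Ioc] at hy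
      rcases le_total 0 t with h | h
      · simp only [h, min_eq_left, max_eq_right] at hy
        rw [abs_of_pos hy.1, abs_of_nonneg h]; exact hy.2
      · simp only [h, min_eq_right, max_eq_left] at hy
        rw [abs_of_nonpos hy.2, abs_of_nonpos h]; linarith
    have := hb ((σ * T : ℝ) + y * I) (by simpa using hy')
    have e : (((σ * T : ℝ) : ℂ) + y * I).re ^ 2 = T ^ 2 := by
      simp [mul_pow, hσ]
    rwa [e] at this
  have key : ∀ T : ℝ, (∫ x in (-T)..T, g x) - (∫ x in (-T)..T, g (x + t * I)) +
      (I • ∫ y in (0 : ℝ)..t, g ((1 * T : ℝ) + y * I)) -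
      (I • ∫ y in (0 : ℝ)..t, g (((-1) * T : ℝ) + y * I)) = 0 := by
    intro T
    have := Complex.integral_boundary_rect_eq_zero_of_differentiableOn g (-T : ℂ) (T + t * I)
      hg.differentiableOn
    simpa using this
  have lim := ((l0.sub lt).add (hedge 1 (by norm_num))).sub (hedge (-1) (by norm_num))
  simp only [id, key, add_zero, sub_zero] at lim
  exact (sub_eq_zero.1 (tendsto_nhds_unique lim tendsto_const_nhds))

open NormedSpace in
theorem norm_exp_smul_le {𝔅 : Type*} [NormedRing 𝔅] [NormedAlgebra ℂ 𝔅] [CompleteSpace 𝔅]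
    {K : 𝔅} {C r : ℝ} (h : ∀ n : ℕ, ‖K ^ n‖ ≤ C * r ^ n) (z : ℂ) :
    ‖exp (z • K)‖ ≤ C * Real.exp (r * ‖z‖) := by
  rw [exp_eq_tsum ℂ (𝔸 := 𝔅)]
  have hs : HasSum (fun n : ℕ => C * ((r * ‖z‖) ^ n / n.factorial)) (C * Real.exp (r * ‖z‖)) := by
    rw [Real.exp_eq_exp_ℝ]
    exact (expSeries_div_hasSum_exp (r * ‖z‖)).mul_left C
  refine tsum_of_norm_bounded hs fun n => ?_
  rw [smul_pow, norm_smul, norm_smul, norm_inv, norm_pow, RCLike.norm_natCast]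
  calc _ ≤ ((n.factorial : ℝ))⁻¹ * (‖z‖ ^ n * (C * r ^ n)) := by gcongr; exact h n
    _ = _ := by rw [mul_pow]; ring

open NormedSpace in
theorem exists_norm_exp_smul_le {𝔅 : Type*} [NormedRing 𝔅] [NormedAlgebra ℂ 𝔅] [CompleteSpace 𝔅]
    (K : 𝔅) : ∃ C, 0 ≤ C ∧ ∀ z : ℂ, ‖exp (z • K)‖ ≤ C * Real.exp (‖K‖ * ‖z‖) := by
  refine ⟨‖(1 : 𝔅)‖ + 1, by positivity, norm_exp_smul_le fun n => ?_⟩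
  rcases n with _ | n
  · simp
  · refine (norm_pow_le' K n.succ_pos).trans ?_
    exact le_mul_of_one_le_left (by positivity) (by linarith [norm_nonneg (1 : 𝔅)])

open Complex Filter Topology MeasureTheory NormedSpace in
theorem exists_spectral_cutoff {𝔅 : Type*} [NormedRing 𝔅] [NormedAlgebra ℂ 𝔅] [CompleteSpace 𝔅]
    {η : ℝ} (hη : 0 < η) (L : 𝔅) (hL : ∀ s : ℝ, ‖exp ((s * I : ℂ) • L)‖ ≤ 1) :
    ∃ F : 𝔅, (∃ C, ∀ t : ℝ, ‖exp ((t : ℂ) • L) * F‖ ≤ C * Real.exp (2 * η * |t|)) ∧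
      ∀ φ : 𝔅 →ₐ[ℂ] ℂ, Continuous φ → φ L = 0 → φ F ≠ 0 := by
  let _ : NormedAlgebra ℚ 𝔅 := NormedAlgebra.restrictScalars ℚ ℂ 𝔅
  obtain ⟨C₁, hC₁, hE⟩ := exists_norm_exp_smul_le L
  obtain ⟨k, hk, ⟨C, hC, hkb⟩, hki⟩ := exists_entire_kernel hη
  have hexp : Differentiable ℂ fun z : ℂ => exp (z • L) :=
    fun z => (hasDerivAt_exp_smul_const L z).differentiableAt
  have hadd : ∀ z w : ℂ, exp ((z + w) • L) = exp (z • L) * exp (w • L) := by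
    intro z w
    rw [add_smul, exp_add_of_commute ((Commute.refl L).smul_left z |>.smul_right w)]
  have hkx : Integrable fun x : ℝ => k x := by
    refine (integrable_inv_one_add_sq.const_mul C).mono'
      ((hk.continuous.comp (by fun_prop)).aestronglyMeasurable) (Eventually.of_forall fun x => ?_)
    simpa using hkb x
  have hF : Integrable fun x : ℝ => k x • exp ((x * I : ℂ) • L) := by
    refine (integrable_inv_one_add_sq.const_mul C).mono' ?_ (Eventually.of_forall fun x => ?_)
    · exact ((hk.continuous.comp (by fun_prop)).smul
        (hexp.continuous.comp (by fun_prop :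
            Continuous fun x : ℝ => (x * I : ℂ)))).aestronglyMeasurable
    · rw [norm_smul]
      calc _ ≤ C * (1 + x ^ 2)⁻¹ * 1 := by
            gcongr
            · simpa using hkb x
            · exact hL x
        _ = _ := mul_one _
  refine ⟨∫ x : ℝ, k x • exp ((x * I : ℂ) • L), ⟨C * Real.pi, fun t => ?_⟩, fun φ hφ hφL => ?_⟩
  · have e1 : exp ((t : ℂ) • L) * ∫ x : ℝ, k x • exp ((x * I : ℂ) • L) =
        ∫ x : ℝ, k x • exp (((x : ℂ) * I + t) • L) := by
      have := (ContinuousLinearMap.mul ℂ 𝔅 (exp ((t : ℂ) • L))).integral_comp_comm hF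
      simp only [ContinuousLinearMap.mul_apply'] at this
      rw [← this]
      congr 1; ext x
      rw [mul_smul_comm, ← hadd, add_comm]
    have hg : Differentiable ℂ fun z : ℂ => k z • exp ((z * I + t) • L) :=
      hk.smul (hexp.comp (by fun_prop : Differentiable ℂ fun z : ℂ => z * I + t))
    rw [e1, integral_eq_integral_add_mul_I (g := fun z : ℂ => k z • exp ((z * I + t) • L)) hg
      (B := C * Real.exp (2 * η * |t|) * (C₁ * Real.exp (‖L‖ * (2 * |t|)))) (t := t) ?_]
    · have hb : ∀ x : ℝ, ‖k (x + t * I) • exp ((((x : ℂ) + t * I) * I + t) • L)‖ ≤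
          C * Real.exp (2 * η * |t|) * (1 + x ^ 2)⁻¹ := by
        intro x
        have e2 : ((x : ℂ) + t * I) * I + t = x * I := by
          ring_nf; simp
        rw [e2, norm_smul]
        calc _ ≤ C * Real.exp (2 * η * |t|) * (1 + x ^ 2)⁻¹ * 1 := by
              gcongr
              · simpa using hkb (x + t * I)
              · exact hL x
          _ = _ := mul_one _
      refine (norm_integral_le_of_norm_le
        (integrable_inv_one_add_sq.const_mul (C * Real.exp (2 * η * |t|)))
        (Eventually.of_forall hb)).trans ?_
      rw [integral_const_mul, integral_univ_inv_one_add_sq]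
      linarith
    · intro z hz
      have e3 : z * I + t = ((z.re : ℂ) * I) + ((t - z.im : ℝ) : ℂ) := by
        conv_lhs => rw [← Complex.re_add_im z]
        push_cast; ring_nf; simp; ring
      rw [norm_smul, e3, hadd]
      have h1 : ‖exp (((t - z.im : ℝ) : ℂ) • L)‖ ≤ (C₁ * Real.exp (‖L‖ * (2 * |t|))) := by
        refine (hE _).trans ?_
        rw [norm_real, Real.norm_eq_abs]
        gcongr
        linarith [abs_sub t z.im]
      have h2 : ‖exp ((z.re * I : ℂ) • L) * exp (((t - z.im : ℝ) : ℂ) • L)‖ ≤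
          1 * (C₁ * Real.exp (‖L‖ * (2 * |t|))) := (norm_mul_le _ _).trans (by gcongr; exact hL _)
      have h3 := hkb z
      calc _ ≤ (C * Real.exp (2 * η * |t|) * (1 + z.re ^ 2)⁻¹) *
            (1 * (C₁ * Real.exp (‖L‖ * (2 * |t|)))) := by gcongr; exact h3.trans (by gcongr)
        _ = _ := by ring
  · have h1 : φ (∫ x : ℝ, k x • exp ((x * I : ℂ) • L)) = ∫ x : ℝ, k x := by
      let φ' : 𝔅 →L[ℂ] ℂ := ⟨φ.toLinearMap, hφ⟩
      have := φ'.integral_comp_comm hF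
      change _ = φ _ at this
      rw [← this]
      congr 1; ext x
      change φ _ = _
      rw [map_smul, map_exp φ hφ, map_smul, hφL]; simp
    rw [h1]; exact hki

open Filter Topology NNReal ENNReal in
theorem exists_norm_pow_le_of_spectralRadius_lt {𝔅 : Type*} [NormedRing 𝔅] [NormedAlgebra ℂ 𝔅]
    [CompleteSpace 𝔅] {K : 𝔅} {r : ℝ} (hr : 0 < r)
    (h : spectralRadius ℂ K < ENNReal.ofReal r) : ∃ C, ∀ n : ℕ, ‖K ^ n‖ ≤ C * r ^ n := by
  have h1 := (spectrum.pow_nnnorm_pow_one_div_tendsto_nhds_spectralRadius K).eventually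
    (gt_mem_nhds h)
  obtain ⟨N, hN⟩ := (h1.and (eventually_gt_atTop 0)).exists_forall_of_atTop
  have h2 : ∀ n ≥ N, ‖K ^ n‖ ≤ r ^ n := by
    intro n hn
    obtain ⟨h3, h4⟩ := hN n hn
    have h5 : (‖K ^ n‖₊ : ℝ≥0∞) < ENNReal.ofReal r ^ (n : ℝ) := by
      rw [one_div] at h3
      exact (ENNReal.rpow_inv_lt_iff (by exact_mod_cast h4)).1 h3
    rw [ENNReal.rpow_natCast, ← ENNReal.ofReal_pow hr.le, ENNReal.lt_ofReal_iff_toReal_lt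
      ENNReal.coe_ne_top] at h5
    exact h5.le
  refine ⟨1 + ∑ n ∈ Finset.range N, ‖K ^ n‖ / r ^ n, fun n => ?_⟩
  have hpos : 0 ≤ ∑ n ∈ Finset.range N, ‖K ^ n‖ / r ^ n :=
      Finset.sum_nonneg fun _ _ => by positivity
  rcases lt_or_ge n N with hn | hn
  · have : ‖K ^ n‖ / r ^ n ≤ ∑ n ∈ Finset.range N, ‖K ^ n‖ / r ^ n :=
      Finset.single_le_sum (f := fun n => ‖K ^ n‖ / r ^ n) (fun _ _ => by positivity)
        (Finset.mem_range.2 hn)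
    rw [← div_le_iff₀ (by positivity)]; linarith
  · refine (h2 n hn).trans (le_mul_of_one_le_left (by positivity) (by linarith))

open Filter Topology NormedSpace Complex in
theorem norm_exp_smul_le_of_re_nonneg {𝔅 : Type*} [NormedRing 𝔅] [NormedAlgebra ℂ 𝔅]
    [CompleteSpace 𝔅] {K : 𝔅} {C r : ℝ} (hr : 0 ≤ r) (hC : ∀ n : ℕ, ‖K ^ n‖ ≤ C * r ^ n)
    (hK : ∀ s : ℝ, ‖exp ((s * I : ℂ) • K)‖ ≤ 1) {z : ℂ} (hz : 0 ≤ z.re) :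
    ‖exp (z • K)‖ ≤ Real.exp (r * z.re) := by
  have hexp : Differentiable ℂ fun z : ℂ => exp (z • K) :=
    fun z => (hasDerivAt_exp_smul_const K z).differentiableAt
  have hf : Differentiable ℂ fun z : ℂ => cexp (-r * z) • exp (z • K) :=
    (by fun_prop : Differentiable ℂ fun z : ℂ => cexp (-r * z)).smul hexp
  have hn : ∀ z : ℂ, ‖cexp (-r * z)‖ = Real.exp (-(r * z.re)) := by
    intro z; rw [Complex.norm_exp]; simp
  have hC0 : 0 ≤ C := by simpa using (norm_nonneg _).trans (hC 0)
  have key := PhragmenLindelof.right_half_plane_of_bounded_on_real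
    (f := fun z : ℂ => cexp (-r * z) • exp (z • K)) (C := 1) (z := z) hf.diffContOnCl
    ⟨1, by norm_num, 2 * r, ?_⟩ ?_ ?_ hz
  · rw [norm_smul, hn, Real.exp_neg] at key
    rwa [inv_mul_le_iff₀ (Real.exp_pos _), mul_one] at key
  · refine Asymptotics.IsBigO.of_bound C (Eventually.of_forall fun z => ?_)
    rw [norm_smul, hn, Real.norm_of_nonneg (Real.exp_pos _).le, Real.rpow_one]
    calc _ ≤ Real.exp (r * ‖z‖) * (C * Real.exp (r * ‖z‖)) := by
          gcongr
          · rw [← mul_neg]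
            exact mul_le_mul_of_nonneg_left ((neg_le_abs _).trans (abs_re_le_norm z)) hr
          · exact norm_exp_smul_le hC z
      _ = _ := by rw [mul_left_comm, ← Real.exp_add]; ring_nf
  · refine ⟨C, eventually_map.2 ((eventually_ge_atTop 0).mono fun x hx => ?_)⟩
    simp only
    rw [norm_smul, hn, Real.exp_neg, inv_mul_le_iff₀ (Real.exp_pos _)]
    refine (norm_exp_smul_le hC _).trans (le_of_eq ?_)
    rw [mul_comm]; simp [abs_of_nonneg hx]
  · intro x
    rw [norm_smul, hn]
    simpa using hK x

open Filter Topology NormedSpace Complex in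
theorem norm_le_of_spectralRadius_lt {𝔅 : Type*} [NormedRing 𝔅] [NormedAlgebra ℂ 𝔅]
    [CompleteSpace 𝔅] {K : 𝔅} {r : ℝ} (hr : 0 < r)
    (h : spectralRadius ℂ K < ENNReal.ofReal r)
    (hK : ∀ s : ℝ, ‖exp ((s * I : ℂ) • K)‖ ≤ 1) : ‖K‖ ≤ 3 * r := by
  obtain ⟨C, hC⟩ := exists_norm_pow_le_of_spectralRadius_lt hr h
  have hexp : Differentiable ℂ fun z : ℂ => exp (z • K) :=
    fun z => (hasDerivAt_exp_smul_const K z).differentiableAt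
  have hb : ∀ z : ℂ, ‖exp (z • K)‖ ≤ Real.exp (r * |z.re|) := by
    intro z
    rcases le_total 0 z.re with hz | hz
    · rw [abs_of_nonneg hz]; exact norm_exp_smul_le_of_re_nonneg hr.le hC hK hz
    · have := norm_exp_smul_le_of_re_nonneg (K := -K) (z := -z) hr.le (C := C) ?_ ?_ (by simpa)
      · rw [abs_of_nonpos hz]; simpa using this
      · intro n
        rw [neg_pow]
        rcases neg_one_pow_eq_or 𝔅 n with h | h <;> simpa [h] using hC n
      · intro s; simpa using hK (-s)
  have hd := norm_deriv_le_of_forall_mem_sphere_norm_le (c := (0 : ℂ)) (R := r⁻¹)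
    (C := Real.exp 1) (f := fun z : ℂ => exp (z • K)) (by positivity) hexp.diffContOnCl ?_
  · rw [(hasDerivAt_exp_smul_const K (0 : ℂ)).deriv] at hd
    simp only [zero_smul, NormedSpace.exp_zero, one_mul, div_inv_eq_mul] at hd
    exact hd.trans (by gcongr; exact Real.exp_one_lt_d9.le.trans (by norm_num))
  · intro z hz
    refine (hb z).trans (Real.exp_le_exp.2 ?_)
    have h1 : ‖z‖ = r⁻¹ := by simpa using hz
    calc r * |z.re| ≤ r * r⁻¹ := by gcongr; rw [← h1]; exact abs_re_le_norm z
      _ = 1 := mul_inv_cancel₀ hr.ne'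

theorem abs_le_of_exp_le {a b C : ℝ} (h : ∀ t : ℝ, Real.exp (a * t) ≤ C * Real.exp (b * |t|)) :
    |a| ≤ b := by
  have key : ∀ a : ℝ, (∀ t : ℝ, 0 ≤ t → Real.exp (a * t) ≤ C * Real.exp (b * t)) → a ≤ b := by
    intro a h
    by_contra! hab
    have hC : 1 ≤ C := by simpa using h 0 le_rfl
    have h1 := h (C / (a - b)) (div_nonneg (by linarith) (by linarith))
    have h2 : Real.exp ((a - b) * (C / (a - b))) ≤ C := by
      rw [sub_mul, Real.exp_sub, div_le_iff₀ (Real.exp_pos _)]; exact h1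
    rw [mul_div_cancel₀ _ (by linarith : a - b ≠ 0)] at h2
    linarith [Real.add_one_le_exp C]
  refine abs_le.2 ⟨?_, key a fun t ht => by simpa [abs_of_nonneg ht] using h t⟩
  have := key (-a) fun t ht => by simpa [abs_of_nonneg ht] using h (-t)
  linarith

open NormedSpace in
theorem im_eq_zero_of_norm_exp_le {𝔅 : Type*} [NormedRing 𝔅] [NormedAlgebra ℂ 𝔅]
    [CompleteSpace 𝔅] {K : 𝔅} (hK : ∀ s : ℝ, ‖exp ((s * Complex.I : ℂ) • K)‖ ≤ 1)
    (φ : 𝔅 →L[ℂ] ℂ) (hexp : ∀ z : ℂ, ∀ K : 𝔅, φ (exp (z • K)) = Complex.exp (z * φ K)) :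
    (φ K).im = 0 := by
  have h : ∀ t : ℝ, Real.exp (-(φ K).im * t) ≤ ‖φ‖ * Real.exp (0 * |t|) := by
    intro t
    have h1 := φ.le_opNorm (exp ((t * Complex.I : ℂ) • K))
    rw [hexp, Complex.norm_exp] at h1
    have h2 : ((t * Complex.I : ℂ) * φ K).re = -(φ K).im * t := by simp; ring
    rw [h2] at h1
    refine h1.trans ?_
    rw [zero_mul, Real.exp_zero]
    gcongr; exact hK t
  have := abs_le_of_exp_le h
  simpa using this

open NormedSpace in
theorem norm_sub_le_of_spectral_transfer_comm {𝔅 : Type*} [NormedCommRing 𝔅] [NormedAlgebra ℂ 𝔅]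
    [CompleteSpace 𝔅] (L A : 𝔅)
    (hL : ∀ s : ℝ, ‖exp ((s * Complex.I : ℂ) • L)‖ ≤ 1)
        (hA : ∀ s : ℝ, ‖exp ((s * Complex.I : ℂ) • A)‖ ≤ 1)
    {η ρ r : ℝ} (hη : 0 < η) (hρ : 0 ≤ ρ) (hr : ρ < r)
    (htr : ∀ (c : ℝ) (F : 𝔅),
      (∃ C, ∀ t : ℝ, ‖exp ((t : ℂ) • (L - (c : ℂ) • 1)) * F‖ ≤ C * Real.exp (2 * η * |t|)) →
      ∃ C, ∀ t : ℝ, ‖exp ((t : ℂ) • (L - A)) * F‖ ≤ C * Real.exp (ρ * |t|)) :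
    ‖L - A‖ ≤ 3 * r := by
  let _ : NormedAlgebra ℚ 𝔅 := NormedAlgebra.restrictScalars ℚ ℂ 𝔅
  have hK : ∀ s : ℝ, ‖exp ((s * Complex.I : ℂ) • (L - A))‖ ≤ 1 := by
    intro s
    have : (s * Complex.I : ℂ) • (L - A) =
        (s * Complex.I : ℂ) • L + (((-s : ℝ) : ℂ) * Complex.I) • A := by
      rw [smul_sub]; push_cast; rw [neg_mul, neg_smul, sub_eq_add_neg]
    rw [this, exp_add_of_commute (Commute.all _ _)]
    exact (norm_mul_le _ _).trans (mul_le_one₀ (hL s) (norm_nonneg _) (hA _))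
  refine norm_le_of_spectralRadius_lt (hρ.trans_lt hr) (lt_of_le_of_lt ?_
    ((ENNReal.ofReal_lt_ofReal_iff (hρ.trans_lt hr)).2 hr)) hK
  refine iSup₂_le fun k hk => ?_
  obtain ⟨φ, rfl⟩ := WeakDual.CharacterSpace.mem_spectrum_iff_exists.1 hk
  let φ' : 𝔅 →L[ℂ] ℂ := WeakDual.CharacterSpace.toCLM φ
  have hφ' : ∀ x, φ' x = φ x := fun _ => rfl
  have hexp : ∀ (z : ℂ) (K : 𝔅), φ (exp (z • K)) = Complex.exp (z * φ K) := by
    intro z K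
    rw [map_exp φ φ'.continuous, map_smul, Complex.exp_eq_exp_ℂ, smul_eq_mul]
  have imL : (φ L).im = 0 := im_eq_zero_of_norm_exp_le hL φ' hexp
  have imK : (φ (L - A)).im = 0 := im_eq_zero_of_norm_exp_le hK φ' hexp
  have reL : φ L = ((φ L).re : ℂ) := by apply Complex.ext <;> simp [imL]
  have reK : φ (L - A) = ((φ (L - A)).re : ℂ) :=
    Complex.ext rfl (by rw [imK, Complex.ofReal_im])
  obtain ⟨F, hF, hF0⟩ := exists_spectral_cutoff hη (L - ((φ L).re : ℂ) • 1) (fun s => by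
    have : (s * Complex.I : ℂ) • (L - ((φ L).re : ℂ) • 1) =
        (s * Complex.I : ℂ) • L + algebraMap ℂ 𝔅 (-((s * (φ L).re : ℝ) : ℂ) * Complex.I) := by
      rw [Algebra.algebraMap_eq_smul_one, smul_sub, smul_smul, sub_eq_add_neg, ← neg_smul]
      congr 2; push_cast; ring
    rw [this, exp_add_of_commute (Commute.all _ _), ← algebraMap_exp_comm,
      Algebra.algebraMap_eq_smul_one, mul_smul_comm, mul_one, norm_smul, ← Complex.exp_eq_exp_ℂ,
      Complex.norm_exp]
    simpa using hL s)
  have hF1 := hF0 (WeakDual.CharacterSpace.toAlgHom φ) φ'.continuous (by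
    change φ _ = 0
    rw [map_sub, map_smul, map_one, smul_eq_mul, mul_one, ← reL, sub_self])
  change φ F ≠ 0 at hF1
  obtain ⟨C, hC⟩ := htr _ F hF
  have hb : ∀ t : ℝ, Real.exp ((φ (L - A)).re * t) ≤ (‖φ'‖ * C / ‖φ F‖) * Real.exp (ρ * |t|) := by
    intro t
    rw [div_mul_eq_mul_div, le_div_iff₀ (norm_pos_iff.2 hF1)]
    have h1 := φ'.le_opNorm (exp ((t : ℂ) • (L - A)) * F)
    rw [hφ', map_mul, hexp, norm_mul, Complex.norm_exp] at h1
    have h2 : ((t : ℂ) * φ (L - A)).re = (φ (L - A)).re * t := by simp; ring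
    rw [h2] at h1
    rw [mul_assoc]
    exact h1.trans (by gcongr; exact hC t)
  have := abs_le_of_exp_le hb
  change ‖φ (L - A)‖ₑ ≤ _
  rw [reK, ← ofReal_norm]
  exact ENNReal.ofReal_le_ofReal (by
    rw [Complex.norm_real]; exact this)

open NormedSpace in
theorem norm_sub_le_of_spectral_transfer {𝔄 : Type*} [NormedRing 𝔄] [NormedAlgebra ℂ 𝔄]
    [CompleteSpace 𝔄] {L A : 𝔄} (hLA : Commute L A)
    (hL : ∀ s : ℝ, ‖exp ((s * Complex.I : ℂ) • L)‖ ≤ 1)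
    (hA : ∀ s : ℝ, ‖exp ((s * Complex.I : ℂ) • A)‖ ≤ 1)
    {η ρ r : ℝ} (hη : 0 < η) (hρ : 0 ≤ ρ) (hr : ρ < r)
    (htr : ∀ (c : ℝ) (F : 𝔄),
      (∃ C, ∀ t : ℝ, ‖exp ((t : ℂ) • (L - (c : ℂ) • 1)) * F‖ ≤ C * Real.exp (2 * η * |t|)) →
      ∃ C, ∀ t : ℝ, ‖exp ((t : ℂ) • (L - A)) * F‖ ≤ C * Real.exp (ρ * |t|)) :
    ‖L - A‖ ≤ 3 * r := by
  let _ : NormedAlgebra ℚ 𝔄 := NormedAlgebra.restrictScalars ℚ ℂ 𝔄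
  let S : Subalgebra ℂ 𝔄 := (Algebra.adjoin ℂ {L, A}).topologicalClosure
  have hSc : ∀ x y : S, x * y = y * x := by
    have : ∀ a ∈ ({L, A} : Set 𝔄), ∀ b ∈ ({L, A} : Set 𝔄), a * b = b * a := by
      rintro a (rfl | rfl) b (rfl | rfl)
      exacts [rfl, hLA, hLA.symm, rfl]
    have hc := (Algebra.isMulCommutative_adjoin ℂ this).is_comm.comm
    exact (Subalgebra.commRingTopologicalClosure (Algebra.adjoin ℂ {L, A}) hc).mul_comm
  let _ : NormedCommRing S := { (inferInstance : NormedRing S) with mul_comm := hSc }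
  have : CompleteSpace S := (Subalgebra.isClosed_topologicalClosure _).completeSpace_coe
  let _ : NormedAlgebra ℚ S := NormedAlgebra.restrictScalars ℚ ℂ S
  have hsub : {L, A} ⊆ (S : Set 𝔄) :=
    Algebra.subset_adjoin.trans (Subalgebra.le_topologicalClosure _)
  have hexp : ∀ x : S, ((exp x : S) : 𝔄) = exp (x : 𝔄) := fun x =>
    map_exp S.val continuous_subtype_val x
  refine norm_sub_le_of_spectral_transfer_comm (⟨L, hsub (by simp)⟩ : S) ⟨A, hsub (by simp)⟩
    (fun s => ?_) (fun s => ?_) hη hρ hr ?_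
  · change ‖((exp _ : S) : 𝔄)‖ ≤ 1
    rw [hexp]; exact hL s
  · change ‖((exp _ : S) : 𝔄)‖ ≤ 1
    rw [hexp]; exact hA s
  · rintro c F ⟨C, hC⟩
    obtain ⟨C', hC'⟩ := htr c F ⟨C, fun t => by
      have := hC t
      change ‖((exp _ : S) : 𝔄) * F‖ ≤ _ at this
      rw [hexp] at this; exact this⟩
    refine ⟨C', fun t => ?_⟩
    change ‖((exp _ : S) : 𝔄) * F‖ ≤ _
    rw [hexp]; exact hC' t

/-- A Hermitian derivation: `i L` is a *-derivation. -/
structure IsHermitianDerivation {A : Type*} [CStarAlgebra A] (L : A →L[ℂ] A) : Prop where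
  leibniz : ∀ x y, L (x * y) = L x * y + x * L y
  map_star : ∀ x, L (star x) = -star (L x)

section ExpApply

open NormedSpace

variable {V : Type*} [NormedAddCommGroup V] [NormedSpace ℂ V] [CompleteSpace V]

theorem hasSum_exp_apply (T : V →L[ℂ] V) (v : V) :
    HasSum (fun n : ℕ => ((n.factorial : ℂ)⁻¹) • ((T ^ n) v)) (exp T v) := by
  have h := exp_series_hasSum_exp' (𝕂 := ℂ) T
  exact h.mapL (ContinuousLinearMap.apply ℂ V v)

theorem exp_apply_of_eigenvector {T : V →L[ℂ] V} {v : V} {μ : ℂ} (h : T v = μ • v) :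
    exp T v = Complex.exp μ • v := by
  have h1 : ∀ n : ℕ, (T ^ n) v = μ ^ n • v := by
    intro n
    induction n with
    | zero => simp
    | succ n ih =>
      rw [pow_succ', mul_apply_eq_comp, ih, map_smul, h, smul_smul, pow_succ]
  have h2 := hasSum_exp_apply T v
  have h3 := (exp_series_hasSum_exp' (𝕂 := ℂ) μ).smul_const v
  rw [Complex.exp_eq_exp_ℂ]
  refine h2.unique ?_
  simpa only [h1, smul_assoc] using h3

theorem hasDerivAt_exp_smul_apply (T : V →L[ℂ] V) (v : V) (z : ℂ) :
    HasDerivAt (fun z : ℂ => exp (z • T) v) (T (exp (z • T) v)) z := by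
  have h := (hasDerivAt_exp_smul_const' T z)
  exact (h.clm_apply (hasDerivAt_const z v)).congr_deriv (by simp)

theorem exp_add_smul_apply (T : V →L[ℂ] V) (v : V) (z w : ℂ) :
    exp ((z + w) • T) v = exp (z • T) (exp (w • T) v) := by
  let _ : NormedAlgebra ℚ (V →L[ℂ] V) := NormedAlgebra.restrictScalars ℚ ℂ _
  rw [add_smul, exp_add_of_commute ((Commute.refl T).smul_left z |>.smul_right w)]
  rfl

theorem exp_neg_smul_apply_exp (T : V →L[ℂ] V) (v : V) (z : ℂ) :
    exp (-z • T) (exp (z • T) v) = v := by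
  rw [← exp_add_smul_apply]; simp

end ExpApply

namespace IsHermitianDerivation

open NormedSpace

variable {A : Type*} [CStarAlgebra A] {L : A →L[ℂ] A}

theorem map_one (hL : IsHermitianDerivation L) : L 1 = 0 := by
  have := hL.leibniz 1 1
  simpa using this

theorem exp_one (hL : IsHermitianDerivation L) (z : ℂ) : exp (z • L) (1 : A) = 1 := by
  have := exp_apply_of_eigenvector (T := z • L) (v := (1 : A)) (μ := 0) (by simp [hL.map_one])
  simpa using this

theorem exp_mul (hL : IsHermitianDerivation L) (z : ℂ) (x y : A) :
    exp (z • L) (x * y) = exp (z • L) x * exp (z • L) y := by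
  have hG : ∀ z : ℂ, HasDerivAt
      (fun z : ℂ => exp ((-z) • L) (exp (z • L) x * exp (z • L) y)) 0 z := by
    intro z
    have h1 := (hasDerivAt_exp_smul_apply L x z).mul (hasDerivAt_exp_smul_apply L y z)
    have h2 := (hasDerivAt_exp_smul_const L (-z)).scomp z (hasDerivAt_neg z)
    have h3 := h2.clm_apply h1
    refine h3.congr_deriv ?_
    simp only [Function.comp, smul_apply, mul_apply_eq_comp]
    simp only [Pi.mul_apply]
    rw [hL.leibniz]; simp only [map_add, neg_smul, one_smul]; abel
  have hc := is_const_of_deriv_eq_zero (fun z => (hG z).differentiableAt)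
      (fun z => (hG z).deriv) z 0
  have h0 : ∀ v : A, exp ((0 : ℂ) • L) v = v := fun v => by
    have := exp_apply_of_eigenvector (T := (0 : ℂ) • L) (v := v) (μ := 0)
      (by rw [smul_apply, zero_smul, zero_smul])
    rwa [Complex.exp_zero, one_smul] at this
  simp only [neg_zero, h0] at hc
  rw [← hc, ← exp_add_smul_apply, add_neg_cancel, h0]

theorem star_exp (hL : IsHermitianDerivation L) (z : ℂ) (x : A) :
    star (exp (z • L) x) = exp ((-(starRingEnd ℂ z)) • L) (star x) := by
  have h1 : ∀ n : ℕ, star (((z • L) ^ n) x) = (((-(starRingEnd ℂ z)) • L) ^ n) (star x) := by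
    intro n
    induction n with
    | zero => simp
    | succ n ih =>
      rw [pow_succ', pow_succ', mul_apply_eq_comp, mul_apply_eq_comp, ← ih]
      simp [hL.map_star]
  have h2 := (hasSum_exp_apply (z • L) x).star
  have h3 := hasSum_exp_apply ((-(starRingEnd ℂ z)) • L) (star x)
  refine h2.unique ?_
  simpa only [h1, star_smul, star_inv₀, star_natCast] using h3

/-- The *-automorphism `exp (i s L)`. -/
noncomputable def expStarAlgHom (hL : IsHermitianDerivation L) (s : ℝ) : A →⋆ₐ[ℂ] A where
  toFun x := exp ((s * Complex.I : ℂ) • L) x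
  map_one' := hL.exp_one _
  map_mul' := hL.exp_mul _
  map_zero' := _root_.map_zero _
  map_add' := _root_.map_add _
  commutes' c := by
    rw [Algebra.algebraMap_eq_smul_one, map_smul, hL.exp_one]
  map_star' x := by
    rw [hL.star_exp]; simp

theorem norm_exp_le (hL : IsHermitianDerivation L) (s : ℝ) :
    ‖exp ((s * Complex.I : ℂ) • L)‖ ≤ 1 := by
  refine ContinuousLinearMap.opNorm_le_bound _ zero_le_one fun x => ?_
  rw [one_mul]
  exact NonUnitalStarAlgHom.norm_apply_le (hL.expStarAlgHom s) x

end IsHermitianDerivation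

/-- Left annihilators of arbitrary subsets are generated by projections. -/
def IsBaerStar (A : Type*) [Ring A] [StarRing A] : Prop :=
  ∀ X : Set A, ∃ P : A, IsStarProjection P ∧ ∀ y, y * P = 0 ↔ ∀ x ∈ X, y * x = 0

/-- The elements whose growth under `exp (s L)`, `s ≥ 0`, has exponent at most `t`. -/
def growthSpace {A : Type*} [CStarAlgebra A] (L : A →L[ℂ] A) (t : ℝ) : Set A :=
  {x | ∃ C, ∀ s : ℝ, 0 ≤ s → ‖NormedSpace.exp ((s : ℂ) • L) x‖ ≤ C * Real.exp (t * s)}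

section Growth

open NormedSpace

variable {A : Type*} [CStarAlgebra A] {L : A →L[ℂ] A}

theorem mul_mem_growthSpace (hL : IsHermitianDerivation L) {s t : ℝ} {x y : A}
    (hx : x ∈ growthSpace L s) (hy : y ∈ growthSpace L t) : x * y ∈ growthSpace L (s + t) := by
  obtain ⟨C, hC⟩ := hx
  obtain ⟨D, hD⟩ := hy
  have hC0 : 0 ≤ C := by simpa using (norm_nonneg _).trans (hC 0 le_rfl)
  refine ⟨C * D, fun r hr => ?_⟩
  rw [hL.exp_mul]
  calc _ ≤ _ := norm_mul_le _ _
    _ ≤ (C * Real.exp (s * r)) * (D * Real.exp (t * r)) :=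
      mul_le_mul (hC r hr) (hD r hr) (norm_nonneg _) (by positivity)
    _ = _ := by rw [add_mul, Real.exp_add]; ring

theorem growthSpace_mono {s t : ℝ} (h : s ≤ t) : growthSpace L s ⊆ growthSpace L t := by
  rintro x ⟨C, hC⟩
  have hC0 : 0 ≤ C := by simpa using (norm_nonneg _).trans (hC 0 le_rfl)
  exact ⟨C, fun r hr => (hC r hr).trans (by gcongr)⟩

theorem exp_apply_mem_growthSpace {t : ℝ} {x : A} (hx : x ∈ growthSpace L t) (z : ℂ) :
    exp (z • L) x ∈ growthSpace L t := by
  obtain ⟨C, hC⟩ := hx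
  refine ⟨‖exp (z • L)‖ * C, fun r hr => ?_⟩
  rw [← exp_add_smul_apply, add_comm, exp_add_smul_apply, mul_assoc]
  exact ((exp (z • L)).le_opNorm _).trans (by gcongr; exact hC r hr)

theorem eq_zero_of_mem_growthSpace {t : ℝ} (ht : t < -‖L‖) {x : A} (hx : x ∈ growthSpace L t) :
    x = 0 := by
  obtain ⟨C, hC⟩ := hx
  obtain ⟨D, hD0, hD⟩ := exists_norm_exp_smul_le L
  have h : ∀ s : ℝ, 0 ≤ s → ‖x‖ ≤ D * C * Real.exp ((‖L‖ + t) * s) := by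
    intro s hs
    calc ‖x‖ = ‖exp (-(s : ℂ) • L) (exp ((s : ℂ) • L) x)‖ := by rw [exp_neg_smul_apply_exp]
      _ ≤ _ := (exp (-(s : ℂ) • L)).le_opNorm _
      _ ≤ (D * Real.exp (‖L‖ * s)) * (C * Real.exp (t * s)) := by
        refine mul_le_mul ?_ (hC s hs) (norm_nonneg _) (by positivity)
        have := hD (-(s : ℂ))
        rwa [norm_neg, Complex.norm_real, Real.norm_of_nonneg hs] at this
      _ = _ := by rw [add_mul, Real.exp_add]; ring
  have hlim : Filter.Tendsto (fun s : ℝ => D * C * Real.exp ((‖L‖ + t) * s)) Filter.atTop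
      (nhds (D * C * 0)) :=
    (Real.tendsto_exp_atBot.comp
      (Filter.tendsto_id.const_mul_atTop_of_neg (by linarith))).const_mul _
  have := ge_of_tendsto hlim ((Filter.eventually_ge_atTop 0).mono fun s hs => h s hs)
  rw [mul_zero] at this
  exact norm_le_zero_iff.1 this

theorem exists_spectral_projections (hB : IsBaerStar A) (hL : IsHermitianDerivation L) :
    ∃ P : ℝ → A, (∀ t, IsStarProjection (P t)) ∧ (∀ t, 0 ≤ t → P t = 1) ∧
      (∀ t, t < -‖L‖ → P t = 0) ∧ (∀ t, L (P t) = 0) ∧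
      (∀ s t w, w ∈ growthSpace L s → P (s + t) * w * P t = w * P t) ∧
      (∀ s t, s ≤ t → P t * P s = P s) := by
  choose P hP hPy using fun t : ℝ => hB (growthSpace L t)
  have hid : ∀ t, P t * P t = P t := fun t => (hP t).isIdempotentElem
  have hPx : ∀ t, ∀ x ∈ growthSpace L t, P t * x = x := by
    intro t x hx
    have := (hPy t (1 - P t)).1 (by rw [sub_mul, one_mul, hid, sub_self]) x hx
    rw [sub_mul, one_mul, sub_eq_zero] at this
    exact this.symm
  have hone : ∀ t, 0 ≤ t → (1 : A) ∈ growthSpace L t := by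
    intro t ht
    refine ⟨‖(1 : A)‖, fun s hs => ?_⟩
    rw [hL.exp_one]
    exact le_mul_of_one_le_right (norm_nonneg _) (Real.one_le_exp (by positivity))
  refine ⟨P, hP, fun t ht => ?_, fun t ht => ?_, fun t => ?_, fun s t w hw => ?_,
    fun s t hst => ?_⟩
  · simpa using hPx t 1 (hone t ht)
  · have := (hPy t 1).2 fun x hx => by rw [eq_zero_of_mem_growthSpace ht hx, mul_zero]
    simpa using this
  · have hinv : ∀ s : ℝ, exp ((s * Complex.I : ℂ) • L) (P t) * P t = P t := by
      intro s
      have h1 : (1 - exp ((s * Complex.I : ℂ) • L) (P t)) * P t = 0 := by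
        refine (hPy t _).2 fun x hx => ?_
        have h2 := hPx t _ (exp_apply_mem_growthSpace hx (-(s * Complex.I : ℂ)))
        have h3 := congrArg ⇑(exp ((s * Complex.I : ℂ) • L)) h2
        rw [hL.exp_mul, ← exp_add_smul_apply] at h3
        have h4 := exp_neg_smul_apply_exp L x (-(s * Complex.I : ℂ))
        rw [← exp_add_smul_apply, neg_neg] at h4
        rw [h4] at h3
        rw [sub_mul, one_mul, h3, sub_self]
      rw [sub_mul, one_mul, sub_eq_zero] at h1
      exact h1.symm
    have hfix : ∀ s : ℝ, exp ((s * Complex.I : ℂ) • L) (P t) = P t := by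
      intro s
      set α := exp ((s * Complex.I : ℂ) • L) (P t) with hα
      have h1 : α * P t = P t := hinv s
      have h2 : P t * α = α := by
        have := congrArg ⇑(exp ((s * Complex.I : ℂ) • L)) (hinv (-s))
        rw [hL.exp_mul, ← exp_add_smul_apply] at this
        simpa [← hα] using this
      have h3 : star α = α := by
        rw [hα, hL.star_exp, (hP t).isSelfAdjoint.star_eq]; simp
      have h4 := congrArg star h1
      rw [star_mul, h3, (hP t).isSelfAdjoint.star_eq] at h4
      rw [← h2, h4]
    have hd : HasDerivAt (fun s : ℝ => exp ((s * Complex.I : ℂ) • L) (P t))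
        (Complex.I • L (exp (((0 : ℝ) * Complex.I : ℂ) • L) (P t))) 0 := by
      have h1 := hasDerivAt_exp_smul_apply L (P t) ((0 : ℝ) * Complex.I)
      have h2 : HasDerivAt (fun s : ℝ => (s * Complex.I : ℂ)) Complex.I 0 := by
        simpa using (Complex.ofRealCLM.hasDerivAt (x := (0 : ℝ))).mul_const Complex.I
      exact h1.scomp (0 : ℝ) h2
    rw [hfix] at hd
    simp only [hfix] at hd
    have := hd.unique (hasDerivAt_const (0 : ℝ) (P t))
    simpa using this
  · have := (hPy t ((1 - P (s + t)) * w)).2 fun x hx => by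
      rw [mul_assoc, sub_mul, one_mul, hPx _ _ (mul_mem_growthSpace hL hw hx), sub_self]
    rw [sub_mul, one_mul, sub_mul, sub_eq_zero] at this
    exact this.symm
  · have := (hPy s (1 - P t)).2 fun x hx => by
      rw [sub_mul, one_mul, hPx t x (growthSpace_mono hst hx), sub_self]
    rw [sub_mul, one_mul, sub_eq_zero] at this
    exact this.symm

end Growth

section ExpDerivation

open NormedSpace

section ExpApply

variable {V : Type*} [NormedAddCommGroup V] [NormedSpace ℂ V] [CompleteSpace V]

theorem exp_smul_sub_apply {S T : V →L[ℂ] V} (h : Commute S T) (z : ℂ) (v : V) :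
    exp (z • (S - T)) v = exp (-z • T) (exp (z • S) v) := by
  let _ : NormedAlgebra ℚ (V →L[ℂ] V) := NormedAlgebra.restrictScalars ℚ ℂ _
  have e : z • (S - T) = -z • T + z • S := by rw [smul_sub, neg_smul, sub_eq_neg_add]
  rw [e, exp_add_of_commute ((h.symm.smul_left _).smul_right _)]
  rfl

theorem exp_smul_apply_eq_smul (S : V →L[ℂ] V) (z c : ℂ) (v : V) :
    exp (z • S) v = Complex.exp (c * z) • exp (z • (S - c • 1)) v := by
  rw [exp_smul_sub_apply ((Commute.one_right S).smul_right c),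
    exp_apply_of_eigenvector (T := -z • c • (1 : V →L[ℂ] V)) (μ := -(c * z))
      (by simp [smul_smul, mul_comm]), smul_smul, ← Complex.exp_add]
  simp

end ExpApply

variable {A : Type*} [CStarAlgebra A]

/-- The inner derivation `x ↦ h x - x h`. -/
noncomputable def adL (h : A) : A →L[ℂ] A :=
  ContinuousLinearMap.mul ℂ A h - (ContinuousLinearMap.mul ℂ A).flip h

@[simp] theorem adL_apply (h x : A) : adL h x = h * x - x * h := rfl

theorem isHermitianDerivation_adL {h : A} (hh : IsSelfAdjoint h) :
    IsHermitianDerivation (adL h) where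
  leibniz x y := by simp only [adL_apply]; noncomm_ring
  map_star x := by simp [hh.star_eq]

theorem IsHermitianDerivation.sub {L K : A →L[ℂ] A} (hL : IsHermitianDerivation L)
    (hK : IsHermitianDerivation K) : IsHermitianDerivation (L - K) where
  leibniz x y := by simp only [sub_apply, hL.leibniz, hK.leibniz]; noncomm_ring
  map_star x := by simp only [sub_apply, hL.map_star, hK.map_star, star_sub]; abel

theorem commute_adL {L : A →L[ℂ] A} (hL : IsHermitianDerivation L) {h : A} (hh : L h = 0) :
    Commute L (adL h) := by
  ext x
  change L (adL h x) = adL h (L x)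
  simp [hL.leibniz, hh]

/-- The spectral increments of a decreasing sequence of projections. -/
theorem sub_mul_sub_of_decreasing {p : ℕ → A} (hp : ∀ i j, i ≤ j → p i * p j = p j)
    (hp' : ∀ i j, i ≤ j → p j * p i = p j) (i j : ℕ) :
    (p i - p (i + 1)) * (p j - p (j + 1)) = if i = j then p i - p (i + 1) else 0 := by
  rw [sub_mul, mul_sub, mul_sub]
  rcases lt_trichotomy i j with h | h | h
  · rw [hp i j h.le, hp i (j + 1) (by omega), hp (i + 1) j (by omega),
      hp (i + 1) (j + 1) (by omega), if_neg h.ne]; simp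
  · subst h
    rw [hp i i le_rfl, hp i (i + 1) (by omega), hp' i (i + 1) (by omega),
      hp (i + 1) (i + 1) le_rfl, if_pos rfl]; simp
  · rw [hp' j i h.le, hp' (j + 1) i (by omega), hp' j (i + 1) (by omega),
      hp' (j + 1) (i + 1) (by omega), if_neg h.ne']; simp

theorem exists_adL_approx (hB : IsBaerStar A) {L : A →L[ℂ] A} (hL : IsHermitianDerivation L) :
    ∃ h : A, IsSelfAdjoint h ∧ ‖h‖ ≤ 15 * ‖L‖ ∧ ‖L - adL h‖ ≤ 2⁻¹ * ‖L‖ := by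
  rcases eq_or_ne L 0 with rfl | hL0
  · exact ⟨0, by simp, by simp, by
      have : adL (0 : A) = 0 := by ext; simp
      simp [this]⟩
  have hLn : 0 < ‖L‖ := norm_pos_iff.2 hL0
  obtain ⟨P, hP, hP1, hP0, hPL, hPw, hPm⟩ := exists_spectral_projections hB hL
  obtain ⟨d, hd⟩ : ∃ d, d = ‖L‖ / 14 := ⟨_, rfl⟩
  have hd0 : 0 < d := by rw [hd]; positivity
  have hPm' : ∀ s t, s ≤ t → P s * P t = P s := by
    intro s t hst
    have := congrArg star (hPm s t hst)
    rwa [star_mul, (hP s).isSelfAdjoint.star_eq, (hP t).isSelfAdjoint.star_eq] at this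
  obtain ⟨p, hp⟩ : ∃ p : ℕ → A, ∀ i, p i = P (-(i * d)) := ⟨fun i => P (-(i * d)), fun _ => rfl⟩
  obtain ⟨Q, hQ⟩ : ∃ Q : ℕ → A, ∀ i, Q i = p i - p (i + 1) :=
      ⟨fun i => p i - p (i + 1), fun _ => rfl⟩
  have hmono : ∀ i j : ℕ, i ≤ j → -((j : ℝ) * d) ≤ -(i * d) := by
    intro i j hij
    have : (i : ℝ) ≤ j := by exact_mod_cast hij
    nlinarith
  have hQQ : ∀ i j, Q i * Q j = if i = j then Q i else 0 := by
    intro i j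
    rw [hQ, hQ]
    exact sub_mul_sub_of_decreasing (fun i j h => by rw [hp, hp]; exact hPm _ _ (hmono i j h))
      (fun i j h => by rw [hp, hp]; exact hPm' _ _ (hmono i j h)) i j
  have hQsum : ∑ i ∈ Finset.range 15, Q i = 1 := by
    simp only [hQ]
    rw [Finset.sum_range_sub', hp, hp, hP1 _ (by simp), hP0 _ (by rw [hd]; push_cast; linarith),
      sub_zero]
  have hQsa : ∀ i, IsSelfAdjoint (Q i) := by
    intro i; rw [hQ, hp, hp]; exact (hP _).isSelfAdjoint.sub (hP _).isSelfAdjoint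
  have hQn : ∀ i, ‖Q i‖ ≤ 2 := by
    intro i; rw [hQ, hp, hp]
    linarith [norm_sub_le (P (-(i * d))) (P (-((i + 1 : ℕ) * d))), (hP (-(i * d))).norm_le,
      (hP (-((i + 1 : ℕ) * d))).norm_le]
  obtain ⟨h, hh⟩ : ∃ h, h = ∑ i ∈ Finset.range 15, ((-(d * i) : ℝ) : ℂ) • Q i := ⟨_, rfl⟩
  have hsa : IsSelfAdjoint h := by
    rw [hh]
    refine isSelfAdjoint_sum _ fun i _ => ?_
    rw [isSelfAdjoint_iff, star_smul, (hQsa i).star_eq]; simp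
  have hLQ : ∀ i, L (Q i) = 0 := fun i => by rw [hQ, hp, hp, map_sub, hPL, hPL, sub_zero]
  have hLh : L h = 0 := by
    rw [hh, map_sum]
    exact Finset.sum_eq_zero fun i _ => by rw [map_smul, hLQ, smul_zero]
  have hQh : ∀ i ∈ Finset.range 15, Q i * h = ((-(d * i) : ℝ) : ℂ) • Q i := by
    intro i hi
    rw [hh, Finset.mul_sum]
    simp only [mul_smul_comm, hQQ, smul_ite, smul_zero]
    rw [Finset.sum_ite_eq, if_pos hi]
  have hhQ : ∀ i ∈ Finset.range 15, h * Q i = ((-(d * i) : ℝ) : ℂ) • Q i := by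
    intro i hi
    rw [hh, Finset.sum_mul]
    simp only [smul_mul_assoc, hQQ, smul_ite, smul_zero]
    rw [Finset.sum_ite_eq', if_pos hi]
  have hgrowth : ∀ s t : ℝ, 0 ≤ t → ∀ w ∈ growthSpace L s,
      ‖exp ((t : ℂ) • adL h) w‖ ≤ 900 * Real.exp (t * (s + d)) * ‖w‖ := by
    intro s t ht w hw
    have hblock : ∀ i ∈ Finset.range 15, ∀ j ∈ Finset.range 15,
        ‖exp ((t : ℂ) • adL h) (Q i * w * Q j)‖ ≤ 4 * Real.exp (t * (s + d)) * ‖w‖ := by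
      intro i hi j hj
      have he : ((t : ℂ) • adL h) (Q i * w * Q j) =
          ((t * (d * (j - i)) : ℝ) : ℂ) • (Q i * w * Q j) := by
        rw [smul_apply, adL_apply, ← mul_assoc,
            ← mul_assoc, hhQ i hi, mul_assoc _ (Q j) h, hQh j hj,
          smul_mul_assoc, smul_mul_assoc, mul_smul_comm, ← sub_smul, smul_smul]
        congr 1; push_cast; ring
      rw [exp_apply_of_eigenvector he, norm_smul, Complex.norm_exp, Complex.ofReal_re]
      rcases le_or_gt s ((j - i - 1) * d) with hc | hc
      · have h1 : w * Q j = P (s + -(j * d)) * w * Q j := by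
          have e : P (-(j * d)) * Q j = Q j := by
            rw [hQ, mul_sub, hp, hp, hPm _ _ le_rfl, hPm _ _ (hmono _ _ (by omega))]
          rw [← e, ← mul_assoc, ← mul_assoc, hPw s _ w hw]
        have h2 : Q i * P (s + -(j * d)) = 0 := by
          rw [hQ, hp, hp, sub_mul, hPm _ _ (by nlinarith), hPm _ _ (by push_cast; nlinarith),
            sub_self]
        have h3 : Q i * w * Q j = 0 := by
          rw [mul_assoc, h1, ← mul_assoc, ← mul_assoc, h2, zero_mul, zero_mul]
        rw [h3, norm_zero, mul_zero]
        positivity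
      · have h1 : ‖Q i * w * Q j‖ ≤ 2 * ‖w‖ * 2 :=
          norm_mul_le_of_le (norm_mul_le_of_le (hQn i) le_rfl) (hQn j)
        have h2 : t * (d * (j - i)) ≤ t * (s + d) := by
          refine mul_le_mul_of_nonneg_left ?_ ht; nlinarith
        calc _ ≤ Real.exp (t * (s + d)) * (2 * ‖w‖ * 2) := by gcongr
          _ = _ := by ring
    have hw' : w = ∑ i ∈ Finset.range 15, ∑ j ∈ Finset.range 15, Q i * w * Q j := by
      simp only [← Finset.mul_sum, ← Finset.sum_mul, hQsum, one_mul, mul_one]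
    conv_lhs => rw [hw', map_sum]
    simp only [map_sum]
    refine (norm_sum_le_of_le _ fun i hi => norm_sum_le_of_le _ fun j hj => hblock i hi j hj).trans
      (le_of_eq ?_)
    simp; ring
  have hA := isHermitianDerivation_adL hsa
  have hcomm := commute_adL hL hLh
  refine ⟨h, hsa, ?_, ?_⟩
  · rw [hh]
    refine (norm_sum_le_of_le (f := fun i : ℕ => ((-(d * i) : ℝ) : ℂ) • Q i) _
      (n := fun i : ℕ => d * i * 2) fun i _ => ?_).trans ?_
    · rw [norm_smul, Complex.norm_real, norm_neg, Real.norm_of_nonneg (by positivity)]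
      gcongr; exact hQn i
    · rw [← Finset.sum_mul, ← Finset.mul_sum, hd]
      have : ∑ i ∈ Finset.range 15, (i : ℝ) = 105 := by
        simp only [Finset.sum_range_succ, Finset.sum_range_zero]; norm_num
      rw [this]; linarith
  · refine (norm_sub_le_of_spectral_transfer (L := L) (A := adL h) hcomm hL.norm_exp_le
      hA.norm_exp_le (η := ‖L‖ / 112) (ρ := 4 * (‖L‖ / 112) + d) (r := ‖L‖ / 6) (by positivity)
      (by positivity) (by rw [hd]; linarith) ?_).trans (by linarith)
    rintro c F ⟨C, hC⟩
    obtain ⟨η, hη⟩ : ∃ η, η = ‖L‖ / 112 := ⟨_, rfl⟩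
    rw [← hη] at hC ⊢
    have hC0 : 0 ≤ C := by simpa using (norm_nonneg _).trans (hC 0)
    have hE : ∀ (t : ℝ) (x : A), ‖exp ((t : ℂ) • L) (F x)‖ ≤
        C * Real.exp (c * t + 2 * η * |t|) * ‖x‖ := by
      intro t x
      have h1 := (exp ((t : ℂ) • (L - (c : ℂ) • 1)) * F).le_of_opNorm_le (hC t) x
      have h2 : exp ((t : ℂ) • L) (F x) =
          (Real.exp (c * t) : ℂ) • (exp ((t : ℂ) • (L - (c : ℂ) • 1)) * F) x := by
        rw [exp_smul_apply_eq_smul L t c]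
        push_cast
        rfl
      rw [h2, norm_smul, Complex.norm_real, Real.norm_of_nonneg (Real.exp_pos _).le, Real.exp_add]
      calc _ ≤ Real.exp (c * t) * (C * Real.exp (2 * η * |t|) * ‖x‖) := by gcongr
        _ = _ := by ring
    have hmem1 : ∀ x, F x ∈ growthSpace L (c + 2 * η) := fun x =>
      ⟨C * ‖x‖, fun s hs => (hE s x).trans (le_of_eq (by rw [abs_of_nonneg hs]; ring_nf))⟩
    have hmem2 : ∀ x, star (F x) ∈ growthSpace L (-c + 2 * η) := fun x =>
      ⟨C * ‖x‖, fun s hs => by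
        have h1 := hE (-s) x
        rw [← norm_star, hL.star_exp] at h1
        simp only [Complex.conj_ofReal, Complex.ofReal_neg, map_neg, neg_neg] at h1
        exact h1.trans (le_of_eq (by rw [abs_neg, abs_of_nonneg hs]; ring_nf))⟩
    refine ⟨900 * C, fun t => ContinuousLinearMap.opNorm_le_bound _ (by positivity) fun x => ?_⟩
    have hsplit : (exp ((t : ℂ) • (L - adL h)) * F) x =
        exp ((-t : ℂ) • adL h) (exp ((t : ℂ) • L) (F x)) := exp_smul_sub_apply hcomm _ _
    rw [hsplit]
    set y := exp ((t : ℂ) • L) (F x) with hy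
    have hyn := hE t x
    rcases le_total 0 t with ht | ht
    · have hy2 : star y ∈ growthSpace L (-c + 2 * η) := by
        rw [hy, hL.star_exp]
        exact exp_apply_mem_growthSpace (hmem2 x) _
      have h1 := hgrowth _ t ht _ hy2
      have h2 : ‖exp ((-t : ℂ) • adL h) y‖ = ‖exp ((t : ℂ) • adL h) (star y)‖ := by
        rw [← norm_star, hA.star_exp]; simp
      rw [h2]
      rw [norm_star] at h1
      calc _ ≤ _ := h1
        _ ≤ 900 * Real.exp (t * (-c + 2 * η + d)) * (C * Real.exp (c * t + 2 * η * |t|) * ‖x‖) := by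
          gcongr
        _ = 900 * C * (Real.exp (t * (-c + 2 * η + d)) * Real.exp (c * t + 2 * η * |t|)) * ‖x‖ := by
          ring
        _ = _ := by rw [← Real.exp_add, abs_of_nonneg ht]; ring_nf
    · have hy1 : y ∈ growthSpace L (c + 2 * η) := exp_apply_mem_growthSpace (hmem1 x) _
      have h1 := hgrowth _ (-t) (by linarith) _ hy1
      rw [Complex.ofReal_neg] at h1
      calc _ ≤ _ := h1
        _ ≤ 900 * Real.exp (-t * (c + 2 * η + d)) * (C * Real.exp (c * t + 2 * η * |t|) * ‖x‖) := by
          gcongr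
        _ = 900 * C * (Real.exp (-t * (c + 2 * η + d)) * Real.exp (c * t + 2 * η * |t|)) * ‖x‖ := by
          ring
        _ = _ := by rw [← Real.exp_add, abs_of_nonpos ht]; ring_nf

end ExpDerivation

/-- Solving `f x = y` by iterating an approximate solution with error at most `‖y‖ / 2`. -/
theorem exists_eq_of_approx {E F : Type*} [NormedAddCommGroup E] [CompleteSpace E]
    [NormedAddCommGroup F] (f : E →+ F) (hf : Continuous f) (S : Set F) (T : AddSubgroup E)
    (hT : IsClosed (T : Set E)) {K : ℝ} (hK : 0 ≤ K)
    (h : ∀ y ∈ S, ∃ x ∈ T, ‖x‖ ≤ K * ‖y‖ ∧ ‖y - f x‖ ≤ 2⁻¹ * ‖y‖ ∧ y - f x ∈ S)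
    (y : F) (hy : y ∈ S) : ∃ x ∈ T, ‖x‖ ≤ 2 * K * ‖y‖ ∧ f x = y := by
  choose! g hgT hgn hge hgS using h
  obtain ⟨u, hu0, hu⟩ : ∃ u : ℕ → F, u 0 = y ∧ ∀ k, u (k + 1) = u k - f (g (u k)) :=
    ⟨fun k => Nat.rec y (fun _ v => v - f (g v)) k, rfl, fun _ => rfl⟩
  have huS : ∀ k, u k ∈ S := by
    intro k
    induction k with
    | zero => rwa [hu0]
    | succ k ih => rw [hu]; exact hgS _ ih
  have hun : ∀ k, ‖u k‖ ≤ ‖y‖ * (1 / 2) ^ k := by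
    intro k
    induction k with
    | zero => simp [hu0]
    | succ k ih =>
      rw [hu, pow_succ]
      linarith [hge _ (huS k)]
  have hb : ∀ k, ‖g (u k)‖ ≤ K * ‖y‖ * (1 / 2) ^ k := by
    intro k
    rw [mul_assoc]
    exact (hgn _ (huS k)).trans (mul_le_mul_of_nonneg_left (hun k) hK)
  have hgeo := hasSum_geometric_two.mul_left (K * ‖y‖)
  have hs : Summable fun k => g (u k) := Summable.of_norm_bounded hgeo.summable hb
  have hpart : ∀ n, ∑ k ∈ Finset.range n, f (g (u k)) = y - u n := by
    intro n
    induction n with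
    | zero => simp [hu0]
    | succ n ih => rw [Finset.sum_range_succ, ih, hu]; abel
  have hu_lim : Filter.Tendsto u Filter.atTop (nhds 0) := by
    refine squeeze_zero_norm hun ?_
    simpa using (tendsto_pow_atTop_nhds_zero_of_lt_one (r := (1 / 2 : ℝ)) (by norm_num)
      (by norm_num)).const_mul ‖y‖
  refine ⟨∑' k, g (u k), ?_, ?_, ?_⟩
  · exact hT.mem_of_tendsto hs.hasSum.tendsto_sum_nat
      (Filter.Eventually.of_forall fun n => T.sum_mem fun k _ => hgT _ (huS k))
  · have := tsum_of_norm_bounded hgeo hb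
    linarith
  · have h1 := (hs.hasSum.map f hf).tendsto_sum_nat
    refine tendsto_nhds_unique h1 ?_
    simp only [Function.comp_apply, hpart]
    simpa using hu_lim.const_sub y

theorem norm_adL_le {A : Type*} [CStarAlgebra A] (h : A) : ‖adL h‖ ≤ 2 * ‖h‖ :=
  ContinuousLinearMap.opNorm_le_bound _ (by positivity) fun x => by
    rw [adL_apply]
    calc _ ≤ ‖h * x‖ + ‖x * h‖ := norm_sub_le _ _
      _ ≤ ‖h‖ * ‖x‖ + ‖x‖ * ‖h‖ := add_le_add (norm_mul_le _ _) (norm_mul_le _ _)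
      _ = _ := by ring

/-- Every Hermitian derivation of an AW*-algebra is implemented by a self-adjoint element. -/
theorem IsHermitianDerivation.exists_eq_adL {A : Type*} [CStarAlgebra A] (hB : IsBaerStar A)
    {L : A →L[ℂ] A} (hL : IsHermitianDerivation L) : ∃ h : A, IsSelfAdjoint h ∧ L = adL h := by
  let f : A →+ (A →L[ℂ] A) := AddMonoidHom.mk' adL fun a b => by ext; simp; noncomm_ring
  have hf : Continuous f :=
    AddMonoidHomClass.continuous_of_bound f 2 norm_adL_le
  obtain ⟨x, hx, -, hxe⟩ := exists_eq_of_approx f hf {L | IsHermitianDerivation L}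
    (selfAdjoint A) (isClosed_eq continuous_star continuous_id) (K := 15) (by norm_num)
    (fun L hL => by
      obtain ⟨h, h1, h2, h3⟩ := exists_adL_approx hB hL
      exact ⟨h, h1, h2, h3, hL.sub (isHermitianDerivation_adL h1)⟩) L hL
  exact ⟨x, hx, hxe.symm⟩

section Order

variable {A : Type*} [CStarAlgebra A] [PartialOrder A] [StarOrderedRing A]

theorem norm_le_of_smul_projection_bounds {q b : A} (hq : IsStarProjection q) {r : ℝ} (hr : 0 ≤ r)
    (h1 : b ≤ r • q) (h2 : -(r • q) ≤ b) : ‖b‖ ≤ r := by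
  have h3 : r • q ≤ algebraMap ℝ A r := by
    rw [Algebra.algebraMap_eq_smul_one]
    exact smul_le_smul_of_nonneg_left hq.le_one hr
  have hsa : IsSelfAdjoint b := by
    have h4 : IsSelfAdjoint (b + r • q) := by
      refine IsSelfAdjoint.of_nonneg ?_
      rw [← sub_neg_eq_add]
      exact sub_nonneg.2 h2
    have h5 : IsSelfAdjoint (r • q) := (IsSelfAdjoint.all r).smul hq.isSelfAdjoint
    simpa using h4.sub h5
  rcases subsingleton_or_nontrivial A with hA | hA
  · simpa [Subsingleton.elim b 0] using hr
  rcases CStarAlgebra.norm_or_neg_norm_mem_spectrum hsa with h | h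
  · exact (le_algebraMap_iff_spectrum_le (R := ℝ) hsa).1 (h1.trans h3) _ h
  · have h6 := (algebraMap_le_iff_le_spectrum (R := ℝ) (r := -r) hsa).1
      (by rw [map_neg]; exact (neg_le_neg h3).trans h2) _ h
    linarith

theorem conjugate_le_norm_smul {p b : A} (hp : IsStarProjection p) (hb : IsSelfAdjoint b)
    (h : p * b = b) : b ≤ ‖b‖ • p := by
  have h1 := CStarAlgebra.star_left_conjugate_le_norm_smul (a := p) (b := b) hb
  have h2 : b * p = b := by
    have := congrArg star h
    rwa [star_mul, hb.star_eq, hp.isSelfAdjoint.star_eq] at this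
  rwa [hp.isSelfAdjoint.star_eq, h, h2, hp.isIdempotentElem.eq] at h1

theorem IsBaerStar.exists_projection (hB : IsBaerStar A) {q b : A} (hq : IsStarProjection q)
    (hb : IsSelfAdjoint b) (hqb : q * b = b) : ∃ p, IsStarProjection p ∧ q * p = p ∧
      b ≤ ‖b‖ • p ∧ -(‖b‖ • (q - p)) ≤ b := by
  obtain ⟨p, hp, hpy⟩ := hB {b⁺}
  have hpos : IsSelfAdjoint b⁺ := (CFC.posPart_nonneg b).isSelfAdjoint
  have hneg : IsSelfAdjoint b⁻ := (CFC.negPart_nonneg b).isSelfAdjoint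
  have hsub := CFC.posPart_sub_negPart b hb
  have key : ∀ c : A, IsSelfAdjoint c → (1 - q) * (c * c) = 0 → q * c = c := by
    intro c hc h
    have h1 : (1 - q) * c * star ((1 - q) * c) = 0 := by
      rw [star_mul, hc.star_eq, mul_assoc, ← mul_assoc c, ← mul_assoc, h, zero_mul]
    have h2 := CStarRing.mul_star_self_eq_zero_iff _ |>.1 h1
    rw [sub_mul, one_mul, sub_eq_zero] at h2
    exact h2.symm
  have hqb' : (1 - q) * b = 0 := by rw [sub_mul, hqb, one_mul, sub_self]
  have hq1 : q * b⁺ = b⁺ := key _ hpos (by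
    have : b⁺ * b⁺ = b * b⁺ := by
      conv_rhs => enter [1]; rw [← hsub]
      rw [sub_mul, CFC.negPart_mul_posPart, sub_zero]
    rw [this, ← mul_assoc, hqb', zero_mul])
  have hq2 : q * b⁻ = b⁻ := key _ hneg (by
    have : b⁻ * b⁻ = -(b * b⁻) := by
      conv_rhs => enter [1, 1]; rw [← hsub]
      rw [sub_mul, CFC.posPart_mul_negPart, zero_sub, neg_neg]
    rw [this, mul_neg, ← mul_assoc, hqb', zero_mul, neg_zero])
  have hp1 : p * b⁺ = b⁺ := by
    have := (hpy (1 - p)).1 hp.one_sub_mul_self b⁺ rfl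
    rw [sub_mul, one_mul, sub_eq_zero] at this
    exact this.symm
  have hp2 : b⁻ * p = 0 := (hpy _).2 (by rintro x rfl; exact CFC.negPart_mul_posPart b)
  have hp3 : p * b⁻ = 0 := by
    have := congrArg star hp2
    rwa [star_mul, hneg.star_eq, hp.isSelfAdjoint.star_eq, star_zero] at this
  have hqp : q * p = p := by
    have := (hpy (1 - q)).2 (by rintro x rfl; rw [sub_mul, hq1, one_mul, sub_self])
    rw [sub_mul, one_mul, sub_eq_zero] at this
    exact this.symm
  have hqpp : IsStarProjection (q - p) := hp.sub_of_mul_eq_right hq hqp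
  refine ⟨p, hp, hqp, ?_, ?_⟩
  · calc b ≤ b⁺ := CFC.le_posPart hb
      _ ≤ ‖b⁺‖ • p := conjugate_le_norm_smul hp hpos hp1
      _ ≤ ‖b‖ • p := smul_le_smul_of_nonneg_right (CStarAlgebra.norm_posPart_le b) hp.nonneg
  · calc -(‖b‖ • (q - p)) ≤ -(‖b⁻‖ • (q - p)) :=
          neg_le_neg (smul_le_smul_of_nonneg_right (CStarAlgebra.norm_negPart_le b) hqpp.nonneg)
      _ ≤ -b⁻ := neg_le_neg (conjugate_le_norm_smul hqpp hneg (by rw [sub_mul, hq2, hp3, sub_zero]))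
      _ ≤ b := CFC.neg_negPart_le hb

end Order

/-- A partial isometry: `v v* v = v`. -/
def IsPartialIsometry {A : Type*} [Mul A] [Star A] (v : A) : Prop := v * star v * v = v

section PartialIsometry

variable {A : Type*} [CStarAlgebra A]

theorem IsPartialIsometry.star {v : A} (hv : IsPartialIsometry v) : IsPartialIsometry (star v) := by
  have := congrArg Star.star hv
  simpa [IsPartialIsometry, mul_assoc] using this

theorem IsPartialIsometry.star_mul_self {v : A} (hv : IsPartialIsometry v) :
    IsStarProjection (Star.star v * v) where
  isIdempotentElem := by
    change Star.star v * v * (Star.star v * v) = _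
    rw [mul_assoc, ← mul_assoc v, hv]
  isSelfAdjoint := IsSelfAdjoint.star_mul_self v

theorem IsPartialIsometry.mul_star_self {v : A} (hv : IsPartialIsometry v) :
    IsStarProjection (v * Star.star v) := by simpa using hv.star.star_mul_self

theorem IsPartialIsometry.norm_le {v : A} (hv : IsPartialIsometry v) : ‖v‖ ≤ 1 := by
  have h1 := hv.star_mul_self.norm_le
  rw [CStarRing.norm_star_mul_self] at h1
  nlinarith [norm_nonneg v]

variable [PartialOrder A] [StarOrderedRing A]

theorem IsBaerStar.exists_isPartialIsometry (hB : IsBaerStar A) {x : A} (hx : x ≠ 0) :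
    ∃ v, v ≠ 0 ∧ IsPartialIsometry v ∧ (∀ y, y * x = 0 → y * v = 0) ∧
      ∀ y, x * y = 0 → v * y = 0 := by
  obtain ⟨h, hh⟩ : ∃ h, h = star x * x := ⟨_, rfl⟩
  have hpos : 0 ≤ h := hh ▸ star_mul_self_nonneg x
  have hsa : IsSelfAdjoint h := hpos.isSelfAdjoint
  have hne : h ≠ 0 := by rwa [hh, Ne, CStarRing.star_mul_self_eq_zero_iff]
  obtain ⟨ε, hε⟩ : ∃ ε, ε = ‖h‖ / 2 := ⟨_, rfl⟩
  have hε0 : 0 < ε := by have := norm_pos_iff.2 hne; rw [hε]; positivity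
  let f : ℝ → ℝ := fun t => max (t - ε) 0
  let g : ℝ → ℝ := fun t => (√(max t ε))⁻¹
  let k : ℝ → ℝ := fun t => f t / max t ε
  have hm : ∀ t, 0 < max t ε := fun t => lt_max_of_lt_right hε0
  have hf : Continuous f := by fun_prop
  have hg : Continuous g := by
    refine Continuous.inv₀ (by fun_prop) fun t => ?_
    exact (Real.sqrt_pos.2 (hm t)).ne'
  have hk : Continuous k := hf.div (by fun_prop) fun t => (hm t).ne'
  have hfg : ∀ t, g t * t * g t * f t = f t := by
    intro t
    rcases le_or_gt t ε with h1 | h1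
    · simp [f, h1]
    · have h2 : g t * g t = t⁻¹ := by
        simp only [g]
        rw [max_eq_left h1.le, ← mul_inv, Real.mul_self_sqrt (hε0.trans h1).le]
      have h3 : t ≠ 0 := (hε0.trans h1).ne'
      calc g t * t * g t * f t = (g t * g t) * t * f t := by ring
        _ = f t := by rw [h2]; field_simp
  have hfk : ∀ t, k t * t = f t := by
    intro t
    rcases le_or_gt t ε with h1 | h1
    · simp [k, f, h1]
    · simp only [k]
      rw [max_eq_left h1.le, div_mul_cancel₀ _ (hε0.trans h1).ne']
  have efg : cfc g h * h * cfc g h * cfc f h = cfc f h := by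
    conv_lhs => enter [1, 1, 2]; rw [← cfc_id' ℝ h]
    rw [← cfc_mul g _ h hg.continuousOn, ← cfc_mul _ g h (by fun_prop) hg.continuousOn,
      ← cfc_mul _ f h (by fun_prop) hf.continuousOn]
    simp only [hfg]
  have efk : cfc k h * h = cfc f h := by
    conv_lhs => enter [2]; rw [← cfc_id' ℝ h]
    rw [← cfc_mul k _ h hk.continuousOn]
    simp only [hfk]
  have hgsa : star (cfc g h) = cfc g h := (cfc_predicate g h : IsSelfAdjoint _).star_eq
  have hfsa : star (cfc f h) = cfc f h := (cfc_predicate f h : IsSelfAdjoint _).star_eq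
  have hf0 : cfc f h ≠ 0 := by
    intro h0
    have : Nontrivial A := ⟨x, 0, hx⟩
    have h1 := CStarAlgebra.norm_mem_spectrum_of_nonneg hpos
    have h2 : f ‖h‖ ∈ spectrum ℝ (cfc f h) := by
      rw [cfc_map_spectrum f h hsa hf.continuousOn]
      exact ⟨_, h1, rfl⟩
    rw [h0, spectrum.zero_eq] at h2
    have h3 : max (‖h‖ - ε) 0 = 0 := h2
    have h4 := le_max_left (‖h‖ - ε) 0
    linarith
  obtain ⟨P, hP, hPy⟩ := hB {cfc f h}
  have hP' : ∀ y, y * P = 0 ↔ y * cfc f h = 0 := fun y => by simpa using hPy y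
  have hP0 : P ≠ 0 := by
    rintro rfl
    exact hf0 (by simpa using (hP' 1).1 (by simp))
  have hgP : cfc g h * h * cfc g h * P = P := by
    have := (hP' (cfc g h * h * cfc g h - 1)).2 (by rw [sub_mul, efg, one_mul, sub_self])
    rwa [sub_mul, one_mul, sub_eq_zero] at this
  have hvv : star (x * cfc g h * P) * (x * cfc g h * P) = P := by
    rw [star_mul, star_mul, hP.isSelfAdjoint.star_eq, hgsa]
    calc _ = P * (cfc g h * (star x * x) * cfc g h * P) := by simp only [mul_assoc]
      _ = P := by rw [← hh, hgP, hP.isIdempotentElem.eq]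
  refine ⟨x * cfc g h * P, ?_, ?_, ?_, ?_⟩
  · intro h0
    rw [h0, mul_zero] at hvv
    exact hP0 hvv.symm
  · rw [IsPartialIsometry, mul_assoc, hvv, mul_assoc, hP.isIdempotentElem.eq]
  · intro y hy
    rw [← mul_assoc, ← mul_assoc, hy, zero_mul, zero_mul]
  · intro y hy
    have h1 : cfc f h * y = 0 := by rw [← efk, mul_assoc, hh, mul_assoc, hy, mul_zero, mul_zero]
    have h2 : star y * P = 0 := by
      rw [hP', ← hfsa, ← star_mul, h1, star_zero]
    have h3 : P * y = 0 := by
      have := congrArg star h2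
      rwa [star_mul, star_star, hP.isSelfAdjoint.star_eq, star_zero] at this
    rw [mul_assoc, h3, mul_zero]

end PartialIsometry

section OrthogonalSums

/-- `X` behaves like the strong sum of the family `x`. -/
structure IsOrthogonalSum {A : Type*} [Ring A] {ι : Type*} (x : ι → A) (X : A) : Prop where
  eq_of : ∀ a b i, (∀ j, j ≠ i → a * x j * b = 0) → a * X * b = a * x i * b
  eq_zero : ∀ a b, (∀ j, a * x j * b = 0) → a * X * b = 0

/-- Bounded families with orthogonal left and right supports can be summed. -/
def HasOrthogonalSums (A : Type u) [CStarAlgebra A] : Prop :=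
  ∀ (ι : Type u) (x : ι → A) (B : ℝ), 0 ≤ B → (∀ i, ‖x i‖ ≤ B) →
    (∀ i j, i ≠ j → star (x i) * x j = 0) → (∀ i j, i ≠ j → x i * star (x j) = 0) →
    ∃ X, ‖X‖ ≤ B ∧ IsOrthogonalSum x X

theorem HasOrthogonalSums.exists_nat {A : Type u} [CStarAlgebra A] (hG : HasOrthogonalSums A)
    (x : ℕ → A) {B : ℝ} (hB : 0 ≤ B) (hx : ∀ i, ‖x i‖ ≤ B)
    (h1 : ∀ i j, i ≠ j → star (x i) * x j = 0) (h2 : ∀ i j, i ≠ j → x i * star (x j) = 0) :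
    ∃ X, ‖X‖ ≤ B ∧ IsOrthogonalSum x X := by
  obtain ⟨X, hX, hs⟩ := hG (ULift.{u} ℕ) (fun i => x i.down) B hB (fun i => hx _)
    (fun i j hij => h1 _ _ fun h => hij (ULift.ext _ _ h))
    (fun i j hij => h2 _ _ fun h => hij (ULift.ext _ _ h))
  exact ⟨X, hX, fun a b i h => hs.eq_of a b ⟨i⟩ fun j hj => h _ fun hij => hj (ULift.ext _ _ hij),
    fun a b h => hs.eq_zero a b fun j => h _⟩

variable {A : Type u} [CStarAlgebra A]

namespace IsOrthogonalSum

variable {ι : Type*} {x : ι → A} {X : A}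

theorem mul_left_eq_zero (h : IsOrthogonalSum x X) {a : A} (ha : ∀ j, a * x j = 0) :
    a * X = 0 := by
  simpa using h.eq_zero a 1 (by simpa using ha)

theorem mul_right_eq_zero (h : IsOrthogonalSum x X) {b : A} (hb : ∀ j, x j * b = 0) :
    X * b = 0 := by
  simpa using h.eq_zero 1 b (by simpa using hb)

theorem mul_left_eq (h : IsOrthogonalSum x X) {a : A} (i : ι) (ha : ∀ j, j ≠ i → a * x j = 0) :
    a * X = a * x i := by
  simpa using h.eq_of a 1 i (by simpa using ha)

theorem mul_right_eq (h : IsOrthogonalSum x X) {b : A} (i : ι) (hb : ∀ j, j ≠ i → x j * b = 0) :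
    X * b = x i * b := by
  simpa using h.eq_of 1 b i (by simpa using hb)

end IsOrthogonalSum

variable [PartialOrder A] [StarOrderedRing A]

theorem exists_maximal_isPartialIsometry (hB : IsBaerStar A) (hG : HasOrthogonalSums A) (a b : A) :
    ∃ V : A, IsPartialIsometry V ∧ a * V = V ∧ V * b = V ∧ V * V = 0 ∧
      ∀ w, a * w = w → w * b = w → w * w = 0 → star w * V = 0 → w * star V = 0 → w * V = 0 →
        V * w = 0 → w = 0 := by
  obtain ⟨S, hS⟩ := zorn_subset {S : Set A |
      (∀ v ∈ S, IsPartialIsometry v ∧ a * v = v ∧ v * b = v) ∧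
      (∀ v ∈ S, ∀ w ∈ S, v * w = 0 ∧ (v ≠ w → star v * w = 0 ∧ v * star w = 0))} (by
    intro c hc hchain
    refine ⟨⋃₀ c, ⟨?_, ?_⟩, fun s hs => Set.subset_sUnion_of_mem hs⟩
    · rintro v ⟨s, hs, hv⟩
      exact (hc hs).1 v hv
    · rintro v ⟨s, hs, hv⟩ w ⟨t, ht, hw⟩
      rcases hchain.total hs ht with h | h
      · exact (hc ht).2 v (h hv) w hw
      · exact (hc hs).2 v hv w (h hw))
  obtain ⟨hS1, hS2⟩ := hS.prop
  obtain ⟨V, -, hV⟩ := hG S Subtype.val 1 zero_le_one (fun i => (hS1 _ i.2).1.norm_le)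
    (fun i j hij => ((hS2 _ i.2 _ j.2).2 fun h => hij (Subtype.ext h)).1)
    (fun i j hij => ((hS2 _ i.2 _ j.2).2 fun h => hij (Subtype.ext h)).2)
  have hV1 : ∀ i : S, star i.1 * V = star i.1 * i.1 := fun i =>
    hV.mul_left_eq i fun j hj => ((hS2 _ i.2 _ j.2).2 fun h => hj (Subtype.ext h.symm)).1
  have hV2 : ∀ i : S, V * star i.1 = i.1 * star i.1 := fun i =>
    hV.mul_right_eq i fun j hj => ((hS2 _ j.2 _ i.2).2 fun h => hj (Subtype.ext h)).2
  have hV3 : ∀ i : S, star V * i.1 = star i.1 * i.1 := fun i => by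
    simpa using congrArg star (hV1 i)
  have hVr : ∀ i : S, i.1 = V * (star i.1 * i.1) := fun i => by
    rw [← mul_assoc, hV2]; exact (hS1 _ i.2).1.symm
  have hVl : ∀ i : S, i.1 = (i.1 * star i.1) * V := fun i => by
    rw [mul_assoc, hV1, ← mul_assoc]; exact (hS1 _ i.2).1.symm
  refine ⟨V, ?_, ?_, ?_, ?_, ?_⟩
  · have : (V * star V - 1) * V = 0 := hV.mul_left_eq_zero fun j => by
      rw [sub_mul, mul_assoc, hV3, ← hVr, one_mul, sub_self]
    rwa [sub_mul, one_mul, sub_eq_zero] at this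
  · have : (a - 1) * V = 0 := hV.mul_left_eq_zero fun j => by
      rw [sub_mul, (hS1 _ j.2).2.1, one_mul, sub_self]
    rwa [sub_mul, one_mul, sub_eq_zero] at this
  · have : V * (b - 1) = 0 := hV.mul_right_eq_zero fun j => by
      rw [mul_sub, (hS1 _ j.2).2.2, mul_one, sub_self]
    rwa [mul_sub, mul_one, sub_eq_zero] at this
  · exact hV.mul_left_eq_zero fun j => hV.mul_right_eq_zero fun i => (hS2 _ i.2 _ j.2).1
  · intro w h1 h2 h3 h4 h5 h6 h7
    by_contra hw
    obtain ⟨v, hv0, hv, hvl, hvr⟩ := hB.exists_isPartialIsometry hw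
    have g1 : a * v = v := by
      have := hvl (a - 1) (by rw [sub_mul, h1, one_mul, sub_self])
      rwa [sub_mul, one_mul, sub_eq_zero] at this
    have g2 : v * b = v := by
      have := hvr (b - 1) (by rw [mul_sub, h2, mul_one, sub_self])
      rwa [mul_sub, mul_one, sub_eq_zero] at this
    have g3 : v * v = 0 := hvr _ (hvl _ h3)
    have g4 : star V * v = 0 := hvl _ (by simpa using congrArg star h4)
    have g5 : v * star V = 0 := hvr _ h5
    have g6 : v * V = 0 := hvr _ h6
    have g7 : V * v = 0 := hvl _ h7
    have k1 : ∀ i : S, star i.1 * v = 0 := fun i => by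
      conv_lhs => rw [hVr i]
      rw [star_mul, mul_assoc, g4, mul_zero]
    have k2 : ∀ i : S, v * star i.1 = 0 := fun i => by
      conv_lhs => rw [hVl i]
      rw [star_mul, ← mul_assoc, g5, zero_mul]
    have k3 : ∀ i : S, v * i.1 = 0 := fun i => by
      conv_lhs => rw [hVr i]
      rw [← mul_assoc, g6, zero_mul]
    have k4 : ∀ i : S, i.1 * v = 0 := fun i => by
      conv_lhs => rw [hVl i]
      rw [mul_assoc, g7, mul_zero]
    have hins := hS.eq_of_subset (t := insert v S) ⟨?_, ?_⟩ (Set.subset_insert v S)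
    · have hvS : v ∈ S := by rw [hins]; exact Set.mem_insert v S
      have := k1 ⟨v, hvS⟩
      exact hv0 (CStarRing.star_mul_self_eq_zero_iff v |>.1 this)
    · rintro w (rfl | hw)
      · exact ⟨hv, g1, g2⟩
      · exact hS1 w hw
    · rintro x (rfl | hx) y (rfl | hy)
      · exact ⟨g3, fun h => (h rfl).elim⟩
      · exact ⟨k3 ⟨y, hy⟩, fun _ => ⟨by simpa using congrArg star (k1 ⟨y, hy⟩), k2 ⟨y, hy⟩⟩⟩
      · exact ⟨k4 ⟨x, hx⟩, fun _ => ⟨k1 ⟨x, hx⟩, by simpa using congrArg star (k2 ⟨x, hx⟩)⟩⟩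
      · exact hS2 x hx y hy

end OrthogonalSums

section PolarDecomposition

variable {A : Type u} [CStarAlgebra A]

theorem isClosed_center_toAddSubgroup :
    IsClosed ((Subalgebra.center ℝ A).toSubring.toAddSubgroup : Set A) := by
  have : ((Subalgebra.center ℝ A).toSubring.toAddSubgroup : Set A) =
      ⋂ x : A, {z | x * z = z * x} := by
    ext z
    simp only [Set.mem_iInter, Set.mem_ofPred_eq]
    exact Subalgebra.mem_center_iff (R := ℝ)
  rw [this]
  exact isClosed_iInter fun x => isClosed_eq (by fun_prop) (by fun_prop)

theorem IsBaerStar.exists_centralSupport (hB : IsBaerStar A) (n : A) :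
    ∃ C, IsStarProjection C ∧ C ∈ Subalgebra.center ℝ A ∧ C * n = n ∧
      ∀ y, (∀ x, y * x * n = 0) → y * C = 0 := by
  obtain ⟨C, hC, hCy⟩ := hB (Set.range fun x => x * n)
  have hy : ∀ y, y * C = 0 ↔ ∀ x, y * x * n = 0 := by
    intro y
    rw [hCy]
    simp [mul_assoc]
  have h0 := (hy (1 - C)).1 hC.one_sub_mul_self
  have h1 : ∀ u, C * u * C = u * C := by
    intro u
    have := (hy ((1 - C) * u)).2 fun x => by
      have := h0 (u * x)
      simpa [mul_assoc] using this
    rw [sub_mul, one_mul, sub_mul, sub_eq_zero] at this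
    exact this.symm
  refine ⟨C, hC, ?_, ?_, fun y => (hy y).2⟩
  · rw [Subalgebra.mem_center_iff]
    intro u
    have h2 := congrArg star (h1 (star u))
    simp only [star_mul, star_star, hC.isSelfAdjoint.star_eq] at h2
    rw [← h1 u, mul_assoc, h2]
  · have := h0 1
    rw [mul_one, sub_mul, one_mul, sub_eq_zero] at this
    exact this.symm

/-- A projection `E` with `p A (E - p) = 0` for every subprojection `p`. -/
structure IsAbelianProjection (E : A) : Prop where
  isStarProjection : IsStarProjection E
  mul_mul_sub : ∀ p, IsStarProjection p → E * p = p → ∀ x, p * x * (E - p) = 0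

theorem IsStarProjection.mul_eq_of_mul_eq {p q : A} (hp : IsStarProjection p)
    (hq : IsStarProjection q) (h : q * p = p) : p * q = p := by
  have := congrArg star h
  rwa [star_mul, hp.isSelfAdjoint.star_eq, hq.isSelfAdjoint.star_eq] at this

theorem IsAbelianProjection.exists_central (hB : IsBaerStar A) {E : A}
    (hE : IsAbelianProjection E) {p : A} (hp : IsStarProjection p) (hEp : E * p = p) :
    ∃ g, IsStarProjection g ∧ g ∈ Subalgebra.center ℝ A ∧ g * E = p ∧ g * p = p ∧
      ∀ y, (∀ x, y * x * p = 0) → y * g = 0 := by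
  obtain ⟨g, hg, hgc, hgp, hgy⟩ := hB.exists_centralSupport p
  refine ⟨g, hg, hgc, ?_, hgp, hgy⟩
  have h1 : (E - p) * g = 0 := hgy _ fun x => by
    have := congrArg star (hE.mul_mul_sub p hp hEp (star x))
    simpa [hE.isStarProjection.isSelfAdjoint.star_eq, hp.isSelfAdjoint.star_eq, mul_assoc]
      using this
  rw [sub_mul, sub_eq_zero] at h1
  rw [← Subalgebra.mem_center_iff.1 hgc, h1, Subalgebra.mem_center_iff.1 hgc, hgp]

theorem norm_two_mul_sub_one_le {g : A} (hg : IsStarProjection g) :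
    ‖g + g - 1‖ ≤ 3 := by
  have h1 := norm_sub_le (g + g) 1
  have h2 := norm_add_le g g
  have h3 := hg.norm_le
  have h4 := (IsStarProjection.one (R := A)).norm_le
  linarith

variable [PartialOrder A] [StarOrderedRing A]

theorem IsAbelianProjection.exists_mul_eq (hB : IsBaerStar A) {E : A}
    (hE : IsAbelianProjection E) {b : A} (hb : IsSelfAdjoint b) (hEb : E * b = b) :
    ∃ z ∈ Subalgebra.center ℝ A, ‖z‖ ≤ 3 * ‖b‖ ∧ z * E = b := by
  have hstep : ∀ y ∈ {b | IsSelfAdjoint b ∧ E * b = b},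
      ∃ x ∈ (Subalgebra.center ℝ A).toSubring.toAddSubgroup, ‖x‖ ≤ 3 / 2 * ‖y‖ ∧
        ‖y - AddMonoidHom.mulRight E x‖ ≤ 2⁻¹ * ‖y‖ ∧
        y - AddMonoidHom.mulRight E x ∈ {b | IsSelfAdjoint b ∧ E * b = b} := by
    rintro y ⟨hy, hEy⟩
    obtain ⟨p, hp, hEp, h1, h2⟩ := hB.exists_projection hE.isStarProjection hy hEy
    obtain ⟨g, hg, hgc, hgE, -⟩ := hE.exists_central hB hp hEp
    have hx : AddMonoidHom.mulRight E ((‖y‖ / 2) • (g + g - 1)) = (‖y‖ / 2) • (p + p - E) := by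
      simp [sub_mul, add_mul, hgE]
    refine ⟨(‖y‖ / 2) • (g + g - 1), ?_, ?_, ?_, ?_, ?_⟩
    · exact (Subalgebra.center ℝ A).smul_mem (sub_mem (add_mem hgc hgc) (one_mem _)) _
    · rw [norm_smul, Real.norm_of_nonneg (by positivity)]
      have := mul_le_mul_of_nonneg_left (norm_two_mul_sub_one_le hg) (norm_nonneg y)
      linarith
    · rw [hx]
      refine norm_le_of_smul_projection_bounds hE.isStarProjection (by positivity) ?_ ?_
      · rw [sub_le_iff_le_add]
        refine h1.trans (le_of_eq ?_)
        module
      · rw [le_sub_iff_add_le]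
        refine (le_of_eq ?_).trans h2
        module
    · rw [hx]
      exact hy.sub ((IsSelfAdjoint.all _).smul ((hp.isSelfAdjoint.add hp.isSelfAdjoint).sub
        hE.isStarProjection.isSelfAdjoint))
    · rw [hx, mul_sub, hEy, mul_smul_comm, mul_sub, mul_add, hEp,
        hE.isStarProjection.isIdempotentElem.eq]
  obtain ⟨z, hz, hzn, hzb⟩ := exists_eq_of_approx (AddMonoidHom.mulRight E)
    (continuous_mul_const E) _ _ isClosed_center_toAddSubgroup (by norm_num) hstep b ⟨hb, hEb⟩
  exact ⟨z, hz, by linarith, hzb⟩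

/-- Comparison of two orthogonal projections. -/
theorem exists_comparison (hB : IsBaerStar A) (hG : HasOrthogonalSums A) {p n : A}
    (hp : IsStarProjection p) (hn : IsStarProjection n) (hpn : p * n = 0) :
    ∃ V, IsPartialIsometry V ∧ p * V = V ∧ V * n = V ∧
      ∀ x, (p - V * star V) * x * (n - star V * V) = 0 := by
  have hnp : n * p = 0 := by
    have := congrArg star hpn
    rwa [star_mul, hp.isSelfAdjoint.star_eq, hn.isSelfAdjoint.star_eq, star_zero] at this
  obtain ⟨V, hV, hpV, hVn, hVV, hmax⟩ := exists_maximal_isPartialIsometry hB hG p n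
  have hnV : n * star V = star V := by simpa [hn.isSelfAdjoint.star_eq] using congrArg star hVn
  have hs : star V * V * star V = star V := by simpa [IsPartialIsometry] using hV.star
  have h0 : (p - V * star V) * V = 0 := by rw [sub_mul, hpV, hV, sub_self]
  have h2 : (n - star V * V) * star V = 0 := by rw [sub_mul, hnV, hs, sub_self]
  have h3 : (n - star V * V) * p = 0 := by
    have : V * p = 0 := by rw [← hVn, mul_assoc, hnp, mul_zero]
    rw [sub_mul, hnp, mul_assoc, this, mul_zero, sub_self]
  have h4 : p * (p - V * star V) = p - V * star V := by
    rw [mul_sub, hp.isIdempotentElem.eq, ← mul_assoc, hpV]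
  have h5 : (n - star V * V) * n = n - star V * V := by
    rw [sub_mul, hn.isIdempotentElem.eq, mul_assoc, hVn]
  have h6 : (n - star V * V) * V = 0 := by
    have := congrArg (· * V) h3
    simpa only [mul_assoc, hpV, zero_mul] using this
  have h7 : V * (p - V * star V) = 0 := by
    rw [mul_sub, ← mul_assoc, hVV, zero_mul, sub_zero, ← hVn, mul_assoc, hnp, mul_zero]
  have h8 : (n - star V * V) * (p - V * star V) = 0 := by rw [← h4, ← mul_assoc, h3, zero_mul]
  refine ⟨V, hV, hpV, hVn, fun x => hmax _ ?_ ?_ ?_ ?_ ?_ ?_ ?_⟩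
  · rw [← mul_assoc, ← mul_assoc, h4]
  · rw [mul_assoc, h5]
  · rw [mul_assoc, ← mul_assoc (n - star V * V), ← mul_assoc (n - star V * V), h8]
    simp
  · simp only [star_mul, star_sub, star_star, hp.isSelfAdjoint.star_eq, mul_assoc, h0, mul_zero]
  · rw [mul_assoc, h2, mul_zero]
  · rw [mul_assoc, h6, mul_zero]
  · rw [← mul_assoc, ← mul_assoc, h7, zero_mul, zero_mul]

end PolarDecomposition

section Comparison

variable {A : Type u} [CStarAlgebra A] [PartialOrder A] [StarOrderedRing A]

theorem IsStarProjection.mul_nonneg_of_mem_center {g x : A} (hg : IsStarProjection g)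
    (hgc : g ∈ Subalgebra.center ℝ A) (hx : 0 ≤ x) : 0 ≤ g * x := by
  have h := star_left_conjugate_nonneg hx g
  rwa [hg.isSelfAdjoint.star_eq, ← Subalgebra.mem_center_iff.1 hgc x, mul_assoc,
    hg.isIdempotentElem.eq, Subalgebra.mem_center_iff.1 hgc x] at h

/-- One step of Dixmier averaging. -/
theorem exists_dixmier_step (hB : IsBaerStar A) (hG : HasOrthogonalSums A) {q a : A}
    (hq : IsStarProjection q) (ha : IsSelfAdjoint a) (hqa : q * a = a) :
    ∃ z a' u y, z ∈ Subalgebra.center ℝ A ∧ IsSelfAdjoint z ∧ ‖z‖ ≤ ‖a‖ ∧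
      IsSelfAdjoint a' ∧ q * a' = a' ∧ ‖a'‖ ≤ 3 / 4 * ‖a‖ ∧ q * u = u ∧ u * q = u ∧ ‖u‖ ≤ 1 ∧
      q * y = y ∧ y * q = y ∧ ‖y‖ ≤ ‖a‖ ∧ a = z * q + a' + (u * y - y * u) := by
  obtain ⟨p, hp, hqp, hap, han⟩ := hB.exists_projection hq ha hqa
  have hpq := hp.mul_eq_of_mul_eq hq hqp
  set n := q - p with hn_def
  have hn : IsStarProjection n := hp.sub_of_mul_eq_right hq hqp
  have hpn : p * n = 0 := by rw [hn_def, mul_sub, hpq, hp.isIdempotentElem.eq, sub_self]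
  have hnp : n * p = 0 := by rw [hn_def, sub_mul, hqp, hp.isIdempotentElem.eq, sub_self]
  obtain ⟨V, hV, hpV, hVn, hcmp⟩ := exists_comparison hB hG hp hn hpn
  have hVs : star V * V * star V = star V := by simpa [IsPartialIsometry] using hV.star
  have hnV : n * star V = star V := by simpa [hn.isSelfAdjoint.star_eq] using congrArg star hVn
  have hVp : star V * p = star V := by simpa [hp.isSelfAdjoint.star_eq] using congrArg star hpV
  have hVp0 : V * p = 0 := by rw [← hVn, mul_assoc, hnp, mul_zero]
  have hnV0 : n * V = 0 := by rw [← hpV, ← mul_assoc, hnp, zero_mul]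
  have hpV0 : p * star V = 0 := by rw [← hnV, ← mul_assoc, hpn, zero_mul]
  have hVn0 : star V * n = 0 := by rw [← hVp, mul_assoc, hpn, mul_zero]
  have hVV : V * V = 0 := by
    have := congrArg (V * ·) hpV
    rwa [← mul_assoc, hVp0, zero_mul, eq_comm] at this
  have hVV' : star V * star V = 0 := by rw [← star_mul, hVV, star_zero]
  set e := V * star V with he_def
  set f := star V * V with hf_def
  have he : IsStarProjection e := hV.mul_star_self
  have hf : IsStarProjection f := hV.star_mul_self
  have hpe : p * e = e := by rw [he_def, ← mul_assoc, hpV]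
  have hnf : n * f = f := by rw [hf_def, ← mul_assoc, hnV]
  have hp0 : IsStarProjection (p - e) := he.sub_of_mul_eq_right hp hpe
  have hn0 : IsStarProjection (n - f) := hf.sub_of_mul_eq_right hn hnf
  obtain ⟨g, hg, hgc, hgn, hgy⟩ := hB.exists_centralSupport (n - f)
  have hgp : (p - e) * g = 0 := hgy _ hcmp
  have hgcomm := fun x => Subalgebra.mem_center_iff.1 hgc x
  have hpe' : e * p = e := by rw [he_def, mul_assoc, hVp]
  have hnf' : f * n = f := by rw [hf_def, mul_assoc, hVn]
  have hpf : p * f = 0 := by rw [hf_def, ← mul_assoc, hpV0, zero_mul]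
  have hen : e * n = 0 := by rw [he_def, mul_assoc, hVn0, mul_zero]
  have hef : e * f = 0 := by rw [← hpe', mul_assoc, hpf, mul_zero]
  have hfe : f * e = 0 := by rw [he_def, hf_def, mul_assoc, ← mul_assoc V, hVV]; simp
  have hfp : f * p = 0 := by rw [hf_def, mul_assoc, hVp0, mul_zero]
  have hne : n * e = 0 := by rw [he_def, ← mul_assoc, hnV0, zero_mul]
  have heV : e * V = V := hV
  have hVf : V * f = V := by rw [hf_def, ← mul_assoc]; exact hV
  have hfV : f * star V = star V := hVs
  have hVe : star V * e = star V := by rw [he_def, ← mul_assoc]; exact hVs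
  have hVe0 : V * e = 0 := by rw [he_def, ← mul_assoc, hVV, zero_mul]
  have hVf0 : star V * f = 0 := by rw [hf_def, ← mul_assoc, hVV', zero_mul]
  have hfV0 : f * V = 0 := by rw [hf_def, mul_assoc, hVV, mul_zero]
  have heV0 : e * star V = 0 := by rw [he_def, mul_assoc, hVV', mul_zero]
  set u := V + star V + (p - e) + (n - f) with hu_def
  have hus : star u = u := by
    simp only [hu_def, star_add, star_star, hp0.isSelfAdjoint.star_eq, hn0.isSelfAdjoint.star_eq]
    abel
  have hup : u * p = star V + (p - e) := by
    simp only [hu_def, add_mul, sub_mul, hVp0, hVp, hp.isIdempotentElem.eq, hpe', hnp, hfp]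
    abel
  have hupu : u * p * u = f + (p - e) := by
    rw [hup]
    simp only [hu_def, add_mul, sub_mul, mul_add, mul_sub, hpV, hpV0, hVV', heV0, ← hf_def,
      hp.isIdempotentElem.eq, hpe', hpn, heV, hVf0, hVn0, hpf, hen, hef, hpe, hVp, hVe,
      he.isIdempotentElem.eq]
    abel
  have huu : u * u = q := by
    simp only [hu_def, add_mul, sub_mul, mul_add, mul_sub, hpV, hpV0, hVV', heV0, ← hf_def,
      hp.isIdempotentElem.eq, hpe', hpn, heV, hVf0, hVn0, hpf, hen, hef, hpe, hVp, hVe,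
      he.isIdempotentElem.eq, hVV, ← he_def, hVp0, hVe0, hVn, hVf, hnV, hnV0, hnp, hfV, hfV0, hfp,
      hfe, hne, hnf, hnf', hn.isIdempotentElem.eq, hf.isIdempotentElem.eq]
    rw [hn_def]
    abel
  have hqu : q * u = u := by
    have hq' : q = p + n := by rw [hn_def]; abel
    simp only [hq', hu_def, add_mul, mul_add, mul_sub, hpV, hpV0, hp.isIdempotentElem.eq, hpn, hpf,
      hpe, hnV, hnV0, hnp, hne, hnf, hn.isIdempotentElem.eq]
    abel
  have huq : u * q = u := by
    simpa [hus, hq.isSelfAdjoint.star_eq] using congrArg star hqu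
  have haq : a * q = a := by
    simpa [ha.star_eq, hq.isSelfAdjoint.star_eq] using congrArg star hqa
  have hunu : u * n * u = q - (f + (p - e)) := by
    rw [hn_def, mul_sub, sub_mul, hupu, huq, huu]
  have hun : ‖u‖ ≤ 1 := by
    have h1 := CStarRing.norm_star_mul_self (x := u)
    rw [hus, huu] at h1
    have := hq.norm_le
    nlinarith [norm_nonneg u]
  set N := ‖a‖ with hN
  have hN0 : 0 ≤ N := norm_nonneg a
  have hgq : g * q = g * (e + f) + (n - f) := by
    have : q = (e + f) + (p - e) + (n - f) := by rw [hn_def]; abel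
    conv_lhs => rw [this]
    rw [mul_add, mul_add _ _ (p - e), ← hgcomm (p - e), hgp, hgn, add_zero]
  set b := u * a * u with hb_def
  have hbs : IsSelfAdjoint b := by
    simp only [IsSelfAdjoint, hb_def, star_mul, hus, ha.star_eq, mul_assoc]
  have hb1 : b ≤ N • (f + (p - e)) := by
    have := star_left_conjugate_le_conjugate hap u
    rwa [hus, mul_smul_comm, smul_mul_assoc, hupu] at this
  have hb2 : -(N • (q - (f + (p - e)))) ≤ b := by
    have := star_left_conjugate_le_conjugate han u
    rwa [hus, mul_neg, neg_mul, mul_smul_comm, smul_mul_assoc, hunu] at this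
  have hef0 : 0 ≤ e + f := add_nonneg he.nonneg hf.nonneg
  have hG1 : 0 ≤ g * (e + f) := hg.mul_nonneg_of_mem_center hgc hef0
  have hG2 : 0 ≤ (e + f) - g * (e + f) := by
    have := hg.one_sub.mul_nonneg_of_mem_center (sub_mem (one_mem _) hgc) hef0
    rwa [sub_mul, one_mul] at this
  have hzc : (N / 4) • (1 - (g + g)) ∈ Subalgebra.center ℝ A :=
    (Subalgebra.center ℝ A).smul_mem (sub_mem (one_mem _) (add_mem hgc hgc)) _
  have hzs : IsSelfAdjoint ((N / 4) • (1 - (g + g))) :=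
    (IsSelfAdjoint.all _).smul ((IsSelfAdjoint.one A).sub (hg.isSelfAdjoint.add hg.isSelfAdjoint))
  have hzq : (N / 4) • (1 - (g + g)) * q =
      (N / 4) • (q - (g * (e + f) + (n - f) + (g * (e + f) + (n - f)))) := by
    rw [smul_mul_assoc, sub_mul, add_mul, hgq, one_mul]
  refine ⟨(N / 4) • (1 - (g + g)), (1 / 2 : ℝ) • (a + b) - (N / 4) • (1 - (g + g)) * q, u,
    -((1 / 2 : ℝ) • (a * u)), hzc, hzs, ?_, ?_, ?_, ?_, hqu, huq, hun, ?_, ?_, ?_, ?_⟩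
  · rw [norm_smul, Real.norm_of_nonneg (by positivity), norm_sub_rev]
    have := mul_le_mul_of_nonneg_left (norm_two_mul_sub_one_le hg) hN0
    linarith
  · refine ((IsSelfAdjoint.all _).smul (ha.add hbs)).sub ?_
    exact (IsSelfAdjoint.commute_iff hzs hq.isSelfAdjoint).1
      (Subalgebra.mem_center_iff.1 hzc q).symm
  · rw [mul_sub, mul_smul_comm, mul_add, hqa, hb_def, ← mul_assoc, ← mul_assoc, hqu, ← mul_assoc,
      Subalgebra.mem_center_iff.1 hzc q, mul_assoc _ q q, hq.isIdempotentElem.eq]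
  · refine norm_le_of_smul_projection_bounds hq (by positivity) ?_ ?_
    · rw [← sub_nonneg, hzq]
      have : (3 / 4 * N) • q - ((1 / 2 : ℝ) • (a + b) -
            (N / 4) • (q - (g * (e + f) + (n - f) + (g * (e + f) + (n - f))))) =
          (N / 2) • ((e + f) - g * (e + f)) + (N / 2) • (n - f) + (1 / 2 : ℝ) • (N • p - a) +
            (1 / 2 : ℝ) • (N • (f + (p - e)) - b) := by
        rw [hn_def]
        module
      rw [this]
      exact add_nonneg (add_nonneg (add_nonneg (smul_nonneg (by positivity) hG2)
        (smul_nonneg (by positivity) hn0.nonneg)) (smul_nonneg (by positivity) (sub_nonneg.2 hap)))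
        (smul_nonneg (by positivity) (sub_nonneg.2 hb1))
    · rw [← sub_nonneg, hzq]
      have : ((1 / 2 : ℝ) • (a + b) -
            (N / 4) • (q - (g * (e + f) + (n - f) + (g * (e + f) + (n - f))))) -
            -((3 / 4 * N) • q) =
          (N / 2) • (g * (e + f)) + (N / 2) • (p - e) + (1 / 2 : ℝ) • (a - -(N • n)) +
            (1 / 2 : ℝ) • (b - -(N • (q - (f + (p - e))))) := by
        rw [hn_def]
        module
      rw [this]
      exact add_nonneg (add_nonneg (add_nonneg (smul_nonneg (by positivity) hG1)
        (smul_nonneg (by positivity) hp0.nonneg)) (smul_nonneg (by positivity) (sub_nonneg.2 han)))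
        (smul_nonneg (by positivity) (sub_nonneg.2 hb2))
  · rw [mul_neg, mul_smul_comm, ← mul_assoc, hqa]
  · rw [neg_mul, smul_mul_assoc, mul_assoc, huq]
  · rw [norm_neg, norm_smul]
    have h1 := norm_mul_le a u
    have h2 : N * ‖u‖ ≤ N * 1 := mul_le_mul_of_nonneg_left hun hN0
    norm_num
    linarith
  · rw [mul_neg, neg_mul, mul_smul_comm, smul_mul_assoc, ← mul_assoc, ← hb_def, smul_mul_assoc,
      mul_assoc a u u, huu, haq]
    module

end Comparison

section CommutatorSums

variable {A : Type u} [CStarAlgebra A]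

/-- Sums of `n` commutators `x * y - y * x` with `x`, `y` in the corner `s A s`, `‖x‖ ≤ 1` and
`‖y‖ ≤ K`. -/
def CommSum (s : A) (K : ℝ) : ℕ → Set A
  | 0 => {0}
  | n + 1 => {c | ∃ c' ∈ CommSum s K n, ∃ x y, s * x = x ∧ x * s = x ∧ s * y = y ∧ y * s = y ∧
      ‖x‖ ≤ 1 ∧ ‖y‖ ≤ K ∧ c = c' + (x * y - y * x)}

namespace CommSum

variable {s s' : A} {K K' : ℝ} {m n : ℕ} {c d : A}

theorem add (hc : c ∈ CommSum s K m) (hd : d ∈ CommSum s K n) : c + d ∈ CommSum s K (m + n) := by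
  induction n generalizing d with
  | zero => obtain rfl : d = 0 := hd; simpa using hc
  | succ n ih =>
    obtain ⟨d', hd', x, y, h1, h2, h3, h4, h5, h6, rfl⟩ := hd
    exact ⟨c + d', ih hd', x, y, h1, h2, h3, h4, h5, h6, by abel⟩

theorem commutator {x y : A} (h1 : s * x = x) (h2 : x * s = x) (h3 : s * y = y) (h4 : y * s = y)
    (h5 : ‖x‖ ≤ 1) (h6 : ‖y‖ ≤ K) : x * y - y * x ∈ CommSum s K 1 :=
  ⟨0, rfl, x, y, h1, h2, h3, h4, h5, h6, by abel⟩

theorem mono (h1 : s' * s = s) (h2 : s * s' = s) (hK : K ≤ K') (hc : c ∈ CommSum s K n) :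
    c ∈ CommSum s' K' n := by
  induction n generalizing c with
  | zero => exact hc
  | succ n ih =>
    obtain ⟨c', hc', x, y, hx1, hx2, hy1, hy2, hx, hy, rfl⟩ := hc
    refine ⟨c', ih hc', x, y, ?_, ?_, ?_, ?_, hx, hy.trans hK, rfl⟩
    · rw [← hx1, ← mul_assoc, h1]
    · rw [← hx2, mul_assoc, h2]
    · rw [← hy1, ← mul_assoc, h1]
    · rw [← hy2, mul_assoc, h2]

theorem mono_right (hK : K ≤ K') (hc : c ∈ CommSum s K n) : c ∈ CommSum s K' n := by
  induction n generalizing c with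
  | zero => exact hc
  | succ n ih =>
    obtain ⟨c', hc', x, y, hx1, hx2, hy1, hy2, hx, hy, rfl⟩ := hc
    exact ⟨c', ih hc', x, y, hx1, hx2, hy1, hy2, hx, hy.trans hK, rfl⟩

theorem central_mul {z : A} (hz : z ∈ Subalgebra.center ℝ A) (hc : c ∈ CommSum s K n) :
    z * c ∈ CommSum s (‖z‖ * K) n := by
  induction n generalizing c with
  | zero => obtain rfl : c = 0 := hc; exact mul_zero z
  | succ n ih =>
    obtain ⟨c', hc', x, y, hx1, hx2, hy1, hy2, hx, hy, rfl⟩ := hc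
    have hzc := fun x => Subalgebra.mem_center_iff.1 hz x
    refine ⟨z * c', ih hc', x, z * y, hx1, hx2, ?_, ?_, hx, ?_, ?_⟩
    · rw [← mul_assoc, hzc, mul_assoc, hy1]
    · rw [mul_assoc, hy2]
    · exact (norm_mul_le _ _).trans (mul_le_mul_of_nonneg_left hy (norm_nonneg z))
    · rw [mul_add, mul_sub, mul_assoc z y x, ← mul_assoc x, hzc x, mul_assoc z x y]

theorem mem_closure (hc : c ∈ CommSum s K n) :
    c ∈ AddSubgroup.closure {c : A | ∃ x y, c = x * y - y * x} := by
  induction n generalizing c with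
  | zero => obtain rfl : c = 0 := hc; exact zero_mem _
  | succ n ih =>
    obtain ⟨c', hc', x, y, -, -, -, -, -, -, rfl⟩ := hc
    exact add_mem (ih hc') (AddSubgroup.subset_closure ⟨x, y, rfl⟩)

end CommSum

theorem HasSum.mul_of_orthogonal {x y : ℕ → A} {X Y : A} (hx : HasSum x X) (hy : HasSum y Y)
    (h : ∀ i j, i ≠ j → x i * y j = 0) : HasSum (fun k => x k * y k) (X * Y) := by
  have h1 : ∀ k, x k * Y = x k * y k := fun k =>
    (hy.mul_left (x k)).unique (hasSum_single k fun j hj => h _ _ hj.symm)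
  simpa only [h1] using hx.mul_right Y

/-- Sums of commutators in orthogonal corners can be folded together. -/
theorem CommSum.exists_hasSum {s : ℕ → A} (hs : ∀ i j, i ≠ j → s i * s j = 0) {K : ℝ} {n : ℕ}
    {c : ℕ → A} (hc : ∀ k, c k ∈ CommSum (s k) (K * (1 / 4) ^ k) n) :
    ∃ t ∈ AddSubgroup.closure {c : A | ∃ x y, c = x * y - y * x}, HasSum c t := by
  induction n generalizing c with
  | zero =>
    have : c = fun _ => 0 := funext fun k => hc k
    exact ⟨0, zero_mem _, this ▸ hasSum_zero⟩
  | succ n ih =>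
    choose c' hc' x y hx1 hx2 hy1 hy2 hx hy h using hc
    obtain ⟨t, ht, hct⟩ := ih hc'
    have hX : Summable fun k => ((1 / 2 : ℝ) ^ k) • x k := by
      refine Summable.of_norm_bounded summable_geometric_two fun k => ?_
      rw [norm_smul, Real.norm_of_nonneg (by positivity)]
      exact mul_le_of_le_one_right (by positivity) (hx k)
    have hY : Summable fun k => ((2 : ℝ) ^ k) • y k := by
      refine Summable.of_norm_bounded (summable_geometric_two.mul_left K) fun k => ?_
      rw [norm_smul, Real.norm_of_nonneg (by positivity)]
      refine (mul_le_mul_of_nonneg_left (hy k) (by positivity)).trans (le_of_eq ?_)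
      rw [mul_left_comm, ← mul_pow]
      norm_num
    have hxy : ∀ k, (((1 / 2 : ℝ) ^ k) • x k) * (((2 : ℝ) ^ k) • y k) = x k * y k := fun k => by
      rw [smul_mul_smul_comm, ← mul_pow]; norm_num
    have hyx : ∀ k, (((2 : ℝ) ^ k) • y k) * (((1 / 2 : ℝ) ^ k) • x k) = y k * x k := fun k => by
      rw [smul_mul_smul_comm, ← mul_pow]; norm_num
    have h1 := hX.hasSum.mul_of_orthogonal hY.hasSum fun i j hij => by
      rw [← hx2 i, ← hy1 j, smul_mul_smul_comm, mul_assoc, ← mul_assoc (s i), hs i j hij]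
      simp
    have h2 := hY.hasSum.mul_of_orthogonal hX.hasSum fun i j hij => by
      rw [← hx1 j, ← hy2 i, smul_mul_smul_comm, mul_assoc, ← mul_assoc (s i), hs i j hij]
      simp
    simp only [hxy, hyx] at h1 h2
    have h3 := hct.add (h1.sub h2)
    simp only [← h] at h3
    exact ⟨_, add_mem ht (AddSubgroup.subset_closure ⟨_, _, rfl⟩), h3⟩

theorem exists_central_recurrence {w ν : ℕ → A} {K : ℝ} (hw : ∀ k, w k ∈ Subalgebra.center ℝ A)
    (hν : ∀ k, ν k ∈ Subalgebra.center ℝ A) (hwn : ∀ k, ‖w k‖ ≤ K * (1 / 4) ^ k)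
    (hνn : ∀ k, ‖ν k‖ ≤ 2) :
    ∃ t : ℕ → A, (∀ k, t k ∈ Subalgebra.center ℝ A) ∧ (∀ k, ‖t k‖ ≤ 2 * K * (1 / 4) ^ k) ∧
      ∀ k, t k = w k + ν k * t (k + 1) := by
  let P : ℕ → ℕ → A := fun l => Nat.rec (fun k => w k) (fun _ f k => ν k * f (k + 1)) l
  have hP0 : ∀ k, P 0 k = w k := fun _ => rfl
  have hPs : ∀ l k, P (l + 1) k = ν k * P l (k + 1) := fun _ _ => rfl
  have hPc : ∀ l k, P l k ∈ Subalgebra.center ℝ A := by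
    intro l
    induction l with
    | zero => exact hw
    | succ l ih => exact fun k => mul_mem (hν k) (ih _)
  have hPn : ∀ l k, ‖P l k‖ ≤ K * (1 / 4) ^ k * (1 / 2) ^ l := by
    intro l
    induction l with
    | zero => exact fun k => by simpa only [hP0, pow_zero, mul_one] using hwn k
    | succ l ih =>
      intro k
      have h1 : ‖P l (k + 1)‖ ≤ _ := ih (k + 1)
      have h2 : ‖ν k * P l (k + 1)‖ ≤ 2 * ‖P l (k + 1)‖ :=
        (norm_mul_le _ _).trans (mul_le_mul_of_nonneg_right (hνn k) (norm_nonneg _))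
      rw [hPs]
      rw [pow_succ] at h1 ⊢
      linarith
  have hsum : ∀ k, Summable fun l => P l k := fun k =>
    Summable.of_norm_bounded (summable_geometric_two.mul_left _) fun l => hPn l k
  refine ⟨fun k => ∑' l, P l k, fun k => ?_, fun k => ?_, fun k => ?_⟩
  · have : (∑' l, P l k) ∈ (Subalgebra.center ℝ A).toSubring.toAddSubgroup :=
      isClosed_center_toAddSubgroup.mem_of_tendsto (hsum k).hasSum.tendsto_sum_nat
        (Filter.Eventually.of_forall fun n => sum_mem fun l _ => hPc l k)
    exact this
  · refine (tsum_of_norm_bounded (hasSum_geometric_two.mul_left (K * (1 / 4) ^ k))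
      fun l => hPn l k).trans (le_of_eq (by ring))
  · simp only
    rw [(hsum k).tsum_eq_zero_add, hP0, ← (hsum (k + 1)).tsum_mul_left]

end CommutatorSums

section Halving

variable {A : Type u} [CStarAlgebra A]

/-- Abelian projections are invariant under equivalence of projections. -/
theorem IsAbelianProjection.of_isPartialIsometry {f V : A} (hf : IsAbelianProjection f)
    (hV : IsPartialIsometry V) (hVf : V * f = V) : IsAbelianProjection (V * star V) := by
  have he := hV.mul_star_self
  have hfV : f * star V = star V := by
    simpa [hf.isStarProjection.isSelfAdjoint.star_eq] using congrArg star hVf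
  refine ⟨he, fun p hp' hep x => ?_⟩
  have hpe := hp'.mul_eq_of_mul_eq he hep
  have h1 : IsStarProjection (star V * p * V) := by
    constructor
    · calc star V * p * V * (star V * p * V) = star V * (p * (V * star V * p)) * V := by
            simp only [mul_assoc]
        _ = _ := by rw [hep, hp'.isIdempotentElem.eq]
    · simp only [IsSelfAdjoint, star_mul, star_star, hp'.isSelfAdjoint.star_eq, mul_assoc]
  have h2 : f * (star V * p * V) = star V * p * V := by
    rw [← mul_assoc, ← mul_assoc, hfV]
  have h3 := hf.mul_mul_sub _ h1 h2 (star V * x * V)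
  have h4 : V * (star V * p * V * (star V * x * V) * (f - star V * p * V)) * star V =
      (V * star V * p) * (V * star V) * x *
          (V * (f * star V) - V * star V * (p * (V * star V))) := by
    simp only [mul_assoc, mul_sub, sub_mul]
  rw [h3, hfV, hpe, hep, hpe] at h4
  simpa using h4.symm

/-- State of the construction of a maximal chain of equivalent abelian projections below `q`. -/
structure ChainState (q : A) where
  s : A
  f : A
  C : A
  hs : IsStarProjection s
  hqs : q * s = s
  hf : IsAbelianProjection f
  hsf : s * f = f
  hC : IsStarProjection C
  hCc : C ∈ Subalgebra.center ℝ A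
  hCf : C * f = f
  hCy : ∀ y, (∀ x, y * x * f = 0) → y * C = 0

variable [PartialOrder A] [StarOrderedRing A]

theorem ChainState.exists_next (hB : IsBaerStar A) (hG : HasOrthogonalSums A) {q : A}
    (hq : IsStarProjection q) (t : ChainState q) :
    ∃ (t' : ChainState q) (v : A), t'.s = t.s + t'.f ∧ v * star v = t'.f ∧
      star v * v = t'.C * t.f ∧ t.C * t'.C = t'.C ∧ (q - t.s) * (t.C - t'.C) = 0 ∧
      t.s * t'.f = 0 ∧ t'.f * v = v ∧ v * t.f = v := by
  obtain ⟨s, f, C, hs, hqs, hf, hsf, hC, hCc, hCf, hCy⟩ := t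
  have hp : IsStarProjection (q - s) := hs.sub_of_mul_eq_right hq hqs
  have hfp := hf.isStarProjection
  have hfs := hfp.mul_eq_of_mul_eq hs hsf
  have hsq := hs.mul_eq_of_mul_eq hq hqs
  have hpf : (q - s) * f = 0 := by
    rw [← hsf, ← mul_assoc, sub_mul, hqs, hs.isIdempotentElem.eq, sub_self, zero_mul]
  obtain ⟨V, hV, hpV, hVf, hcmp⟩ := exists_comparison hB hG hp hfp hpf
  have hfV : f * star V = star V := by simpa [hfp.isSelfAdjoint.star_eq] using congrArg star hVf
  have hff : f * (star V * V) = star V * V := by rw [← mul_assoc, hfV]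
  obtain ⟨g, hg, hgc, hgf, hgp, hgy⟩ := hf.exists_central hB hV.star_mul_self hff
  have hgV : g * V = V := by
    have h1 : V * f * g = V := by
      rw [mul_assoc, Subalgebra.mem_center_iff.1 hgc, hgf, ← mul_assoc, hV]
    rwa [hVf, Subalgebra.mem_center_iff.1 hgc] at h1
  have hsV : s * V = 0 := by
    rw [← hpV, ← mul_assoc, mul_sub, hsq, hs.isIdempotentElem.eq, sub_self, zero_mul]
  have hqV : q * V = V := by
    conv_lhs => rw [← hpV]
    rw [← mul_assoc, mul_sub, hq.isIdempotentElem.eq, hqs, hpV]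
  have hVs : star V * s = 0 := by
    simpa [hs.isSelfAdjoint.star_eq] using congrArg star hsV
  have he := hV.mul_star_self
  have hse : s * (V * star V) = 0 := by rw [← mul_assoc, hsV, zero_mul]
  have hes : V * star V * s = 0 := by rw [mul_assoc, hVs, mul_zero]
  have hCg : C * g = g := by
    have := hgy (1 - C) fun x => by
      rw [← Subalgebra.mem_center_iff.1 (sub_mem (one_mem _) hCc) x, mul_assoc, ← hff,
        ← mul_assoc (1 - C), sub_mul, hCf]
      simp
    rw [sub_mul, one_mul, sub_eq_zero] at this
    exact this.symm
  have hfy : ∀ y, (∀ x, y * x * (V * star V) = 0) → y * g = 0 := fun y hy => hgy y fun x => by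
    have h1 := hy (x * star V)
    have h2 := congrArg (· * V) h1
    have h3 : V * star V * V = V := hV
    simpa only [mul_assoc, zero_mul, h3, ← mul_assoc (V) (star V) V] using h2
  have hgcomm := fun x => Subalgebra.mem_center_iff.1 hgc x
  have hCcomm := fun x => Subalgebra.mem_center_iff.1 hCc x
  refine ⟨⟨s + V * star V, V * star V, g, ?_, ?_, ?_, ?_, hg, hgc, ?_, hfy⟩, V, rfl, rfl, hgf.symm,
    hCg, ?_, hse, hV, hVf⟩
  · refine ⟨?_, hs.isSelfAdjoint.add he.isSelfAdjoint⟩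
    simp only [IsIdempotentElem, add_mul, mul_add, hs.isIdempotentElem.eq, he.isIdempotentElem.eq,
      hse, hes]
    abel
  · rw [mul_add, hqs, ← mul_assoc, hqV]
  · exact hf.of_isPartialIsometry hV hVf
  · rw [add_mul, hse, zero_add, he.isIdempotentElem.eq]
  · rw [← mul_assoc, hgV]
  · have h1 : (q - s - V * star V) * (1 - g) * C = 0 := hCy _ fun x => by
      rw [mul_assoc, mul_assoc]
      have := hcmp x
      have h2 : (1 - g) * (x * f) = x * (f - star V * V) := by
        rw [← hgf, sub_mul, one_mul, mul_sub, ← mul_assoc x, hgcomm x, mul_assoc]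
      rwa [h2, ← mul_assoc]
    have h2 : V * star V * (1 - g) = 0 := by
      rw [mul_sub, mul_one, hgcomm, ← mul_assoc, hgV, sub_self]
    rw [sub_mul (q - s), h2, sub_zero, mul_assoc, sub_mul 1 g,
      one_mul, hCcomm g, hCg] at h1
    exact h1

end Halving

section Coupling

variable {A : Type u} [CStarAlgebra A]

theorem hasSum_inv_mul_inv (i : ℕ) :
    HasSum (fun j : ℕ => ((i + j + 1 : ℝ) * (i + j + 2))⁻¹) ((i + 1 : ℝ)⁻¹) := by
  have h : ∀ j : ℕ, ((i + j + 1 : ℝ) * (i + j + 2))⁻¹ =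
      ((i + j : ℕ) + 1 : ℝ)⁻¹ - ((i + (j + 1) : ℕ) + 1 : ℝ)⁻¹ := fun j => by
    push_cast
    have h1 : (i + j + 1 : ℝ) ≠ 0 := by positivity
    have h2 : (i + j + 2 : ℝ) ≠ 0 := by positivity
    have h3 : (i + (j + 1) + 1 : ℝ) ≠ 0 := by positivity
    field_simp
    ring
  rw [hasSum_iff_tendsto_nat_of_nonneg fun j => by positivity]
  simp_rw [h, Finset.sum_range_sub' (fun j : ℕ => ((i + j : ℕ) + 1 : ℝ)⁻¹)]
  have h2 : Filter.Tendsto (fun n : ℕ => ((i + n : ℕ) + 1 : ℝ)⁻¹) Filter.atTop (nhds 0) := by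
    have := tendsto_one_div_add_atTop_nhds_zero_nat (𝕜 := ℝ)
    simp only [one_div] at this
    exact this.comp (Filter.tendsto_atTop_mono (fun n => Nat.le_add_left n i) Filter.tendsto_id)
  simpa using tendsto_const_nhds.sub h2

theorem exists_chain_weights {C : ℕ → A} (hC : ∀ i, IsStarProjection (C i))
    (hCc : ∀ i, C i ∈ Subalgebra.center ℝ A) (hCC : ∀ i, C i * C (i + 1) = C (i + 1)) :
    ∃ T : ℕ → A, (∀ i, T i ∈ Subalgebra.center ℝ A) ∧ (∀ i, ‖T i‖ ≤ (i + 1 : ℝ)⁻¹) ∧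
      (∀ i, C (i + 1) * T i = T i) ∧
      ∀ i, T i = ((i + 1 : ℝ) * (i + 2))⁻¹ • C (i + 1) + T (i + 1) := by
  have hmono : ∀ i j, C i * C (i + j) = C (i + j) := by
    intro i j
    induction j with
    | zero => exact (hC i).isIdempotentElem.eq
    | succ j ih => rw [← add_assoc, ← hCC (i + j), ← mul_assoc, ih]
  have hb : ∀ i j : ℕ, ‖((i + j + 1 : ℝ) * (i + j + 2))⁻¹ • C (i + j + 1)‖ ≤
      ((i + j + 1 : ℝ) * (i + j + 2))⁻¹ := fun i j => by
    rw [norm_smul, Real.norm_of_nonneg (by positivity)]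
    exact mul_le_of_le_one_right (by positivity) (hC _).norm_le
  have hsum : ∀ i : ℕ, Summable fun j : ℕ => ((i + j + 1 : ℝ) * (i + j + 2))⁻¹ • C (i + j + 1) :=
    fun i => Summable.of_norm_bounded (hasSum_inv_mul_inv i).summable (hb i)
  refine ⟨fun i => ∑' j : ℕ, ((i + j + 1 : ℝ) * (i + j + 2))⁻¹ • C (i + j + 1), fun i => ?_,
    fun i => ?_, fun i => ?_, fun i => ?_⟩
  · have : (∑' j : ℕ, ((i + j + 1 : ℝ) * (i + j + 2))⁻¹ • C (i + j + 1)) ∈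
        (Subalgebra.center ℝ A).toSubring.toAddSubgroup :=
      isClosed_center_toAddSubgroup.mem_of_tendsto (hsum i).hasSum.tendsto_sum_nat
        (Filter.Eventually.of_forall fun n =>
          sum_mem fun l _ => (Subalgebra.center ℝ A).smul_mem (hCc _) _)
    exact this
  · exact tsum_of_norm_bounded (hasSum_inv_mul_inv i) (hb i)
  · rw [← (hsum i).tsum_mul_left]
    refine tsum_congr fun j => ?_
    rw [mul_smul_comm, add_right_comm i j 1, hmono]
  · simp only
    rw [(hsum i).tsum_eq_zero_add]
    congr 1
    · simp
    · refine tsum_congr fun j => ?_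
      rw [← add_assoc, add_right_comm i j 1]
      congr 3 <;> push_cast <;> ring

theorem star_mul_eq_zero_of_mul_eq {p r a b : A} (hp : star p = p) (ha : p * a = a)
    (hb : r * b = b) (h : p * r = 0) : star a * b = 0 := by
  rw [← ha, ← hb, star_mul, hp, mul_assoc, ← mul_assoc p, h, zero_mul, mul_zero]

theorem mul_star_eq_zero_of_mul_eq {p r a b : A} (hr : star r = r) (ha : a * p = a)
    (hb : b * r = b) (h : p * r = 0) : a * star b = 0 := by
  rw [← ha, ← hb, star_mul, hr, mul_assoc, ← mul_assoc p, h, zero_mul, mul_zero]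

variable [PartialOrder A] [StarOrderedRing A]

/-- A maximal chain of equivalent abelian projections `f n` below `q`, starting at `f 0`, with
central supports `C n`. -/
structure IsAbelianChain (q : A) (f C v : ℕ → A) : Prop where
  isStarProjection : ∀ n, IsStarProjection (f n)
  orthogonal : ∀ i j, i ≠ j → f i * f j = 0
  mul_left : ∀ n, q * f n = f n
  central_isStarProjection : ∀ n, IsStarProjection (C n)
  central_mem : ∀ n, C n ∈ Subalgebra.center ℝ A
  central_mul : ∀ n, C n * f n = f n
  central_mul_succ : ∀ n, C n * C (n + 1) = C (n + 1)
  mul_star : ∀ n, v n * star (v n) = f (n + 1)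
  star_mul : ∀ n, star (v n) * v n = C (n + 1) * f n
  mul_left_eq : ∀ n, f (n + 1) * v n = v n
  mul_right_eq : ∀ n, v n * f n = v n
  maximal : ∀ n, (q - ∑ i ∈ Finset.range (n + 1), f i) * (C n - C (n + 1)) = 0

theorem IsAbelianProjection.exists_chain (hB : IsBaerStar A)
    (hG : HasOrthogonalSums A) {E q : A} (hE : IsAbelianProjection E) (hq : IsStarProjection q)
    (hqE : q * E = E) : ∃ f C v, IsAbelianChain q f C v ∧ f 0 = E := by
  obtain ⟨C₀, hC₀, hC₀c, hC₀E, hC₀y⟩ := hB.exists_centralSupport E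
  have hEp := hE.isStarProjection
  let t₀ : ChainState q := ⟨E, E, C₀, hEp, hqE, hE, hEp.isIdempotentElem.eq, hC₀, hC₀c, hC₀E, hC₀y⟩
  choose next w hw using ChainState.exists_next hB hG hq
  let t : ℕ → ChainState q := fun n => next^[n] t₀
  have ht : ∀ n, t (n + 1) = next (t n) := fun n => Function.iterate_succ_apply' _ _ _
  have hstep : ∀ n, (t (n + 1)).s = (t n).s + (t (n + 1)).f ∧
      w (t n) * star (w (t n)) = (t (n + 1)).f ∧
      star (w (t n)) * w (t n) = (t (n + 1)).C * (t n).f ∧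
      (t n).C * (t (n + 1)).C = (t (n + 1)).C ∧
      (q - (t n).s) * ((t n).C - (t (n + 1)).C) = 0 ∧ (t n).s * (t (n + 1)).f = 0 ∧
      (t (n + 1)).f * w (t n) = w (t n) ∧ w (t n) * (t n).f = w (t n) := by
    intro n
    rw [ht]
    exact hw (t n)
  choose hs1 hvv hvv' hCC hqC hsf hfv hvf using hstep
  have hs : ∀ n, (t n).s = ∑ i ∈ Finset.range (n + 1), (t i).f := by
    intro n
    induction n with
    | zero => simp [t, t₀]
    | succ n ih => rw [hs1, ih, Finset.sum_range_succ _ (n + 1)]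
  have hsf' : ∀ i j, (t (i + j)).s * (t i).f = (t i).f := by
    intro i j
    induction j with
    | zero => exact (t i).hsf
    | succ j ih =>
      have h1 : (t (i + j + 1)).s * (t (i + j)).s = (t (i + j)).s := by
        have h2 := congrArg star (hsf (i + j))
        rw [star_mul, (t (i + j)).hs.isSelfAdjoint.star_eq,
          (t (i + j + 1)).hf.isStarProjection.isSelfAdjoint.star_eq, star_zero] at h2
        rw [hs1, add_mul, (t (i + j)).hs.isIdempotentElem.eq, h2, add_zero]
      rw [← add_assoc, ← ih, ← mul_assoc, h1]
  have hlt : ∀ i j, (t i).f * (t (i + j + 1)).f = 0 := by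
    intro i j
    have h2 := congrArg star (hsf' i j)
    rw [star_mul, (t (i + j)).hs.isSelfAdjoint.star_eq,
      (t i).hf.isStarProjection.isSelfAdjoint.star_eq] at h2
    rw [← h2, mul_assoc, hsf, mul_zero]
  refine ⟨fun n => (t n).f, fun n => (t n).C, fun n => w (t n),
    ⟨fun n => (t n).hf.isStarProjection, fun i j hij => ?_, fun n => ?_, fun n => (t n).hC,
      fun n => (t n).hCc, fun n => (t n).hCf, hCC, hvv, hvv', hfv, hvf, fun n => ?_⟩, rfl⟩
  · rcases lt_or_gt_of_ne hij with h | h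
    · obtain ⟨k, rfl⟩ := Nat.exists_eq_add_of_lt h
      exact hlt i k
    · obtain ⟨k, rfl⟩ := Nat.exists_eq_add_of_lt h
      have h2 := congrArg star (hlt j k)
      rwa [star_mul, (t j).hf.isStarProjection.isSelfAdjoint.star_eq,
        (t (j + k + 1)).hf.isStarProjection.isSelfAdjoint.star_eq, star_zero] at h2
  · have h := (t n).hsf
    have h' := (t n).hqs
    calc q * (t n).f = q * ((t n).s * (t n).f) := by rw [h]
      _ = _ := by rw [← mul_assoc, h', h]
  · rw [← hs]
    exact hqC n

/-- An abelian projection is a central multiple of a larger projection, up to a commutator. -/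
theorem IsAbelianProjection.exists_eq_mul_add_commutator (hB : IsBaerStar A)
    (hG : HasOrthogonalSums A) {E q : A} (hE : IsAbelianProjection E) (hq : IsStarProjection q)
    (hqE : q * E = E) :
    ∃ μ X Y, μ ∈ Subalgebra.center ℝ A ∧ ‖μ‖ ≤ 2 ∧ q * X = X ∧ X * q = X ∧ q * Y = Y ∧ Y * q = Y ∧
      ‖X‖ ≤ 1 ∧ ‖Y‖ ≤ 1 ∧ E = μ * q + (X * Y - Y * X) := by
  obtain ⟨f, C, v, hch, rfl⟩ := hE.exists_chain hB hG hq hqE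
  have hfp := hch.isStarProjection
  have hff := hch.orthogonal
  have hqf := hch.mul_left
  have hfq : ∀ n, f n * q = f n := fun n => (hfp n).mul_eq_of_mul_eq hq (hqf n)
  have hCp := hch.central_isStarProjection
  have hCc := hch.central_mem
  have hfv := hch.mul_left_eq
  have hvf := hch.mul_right_eq
  have hfs : ∀ n, star (f n) = f n := fun n => (hfp n).isSelfAdjoint.star_eq
  have hfv' : ∀ n, f n * star (v n) = star (v n) := fun n => by
    simpa [hfs] using congrArg star (hvf n)
  have hvf' : ∀ n, star (v n) * f (n + 1) = star (v n) := fun n => by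
    simpa [hfs] using congrArg star (hfv n)
  obtain ⟨T, hTc, hTn, hCT, hTs⟩ := exists_chain_weights hCp hCc hch.central_mul_succ
  have hTcomm := fun n x => Subalgebra.mem_center_iff.1 (hTc n) x
  have hCcomm := fun n x => Subalgebra.mem_center_iff.1 (hCc n) x
  have hvn : ∀ n, ‖v n‖ ≤ 1 := fun n => by
    have h1 := CStarRing.norm_self_mul_star (x := v n)
    rw [hch.mul_star] at h1
    have := (hfp (n + 1)).norm_le
    nlinarith [norm_nonneg (v n)]
  have hne : ∀ i j : ℕ, i ≠ j → i + 1 ≠ j + 1 := fun i j h h' => h (by omega)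
  have hvs : ∀ i j, i ≠ j → star (v i) * v j = 0 := fun i j hij =>
    star_mul_eq_zero_of_mul_eq (hfs _) (hfv i) (hfv j) (hff _ _ (hne _ _ hij))
  have hvs' : ∀ i j, i ≠ j → v i * star (v j) = 0 := fun i j hij =>
    mul_star_eq_zero_of_mul_eq (hfs _) (hvf i) (hvf j) (hff _ _ hij)
  obtain ⟨Y, hYn, hY⟩ := hG.exists_nat v zero_le_one hvn hvs hvs'
  set α : ℕ → A := fun i => (i + 1 : ℝ) • T i with hα_def
  have hαc : ∀ i, α i ∈ Subalgebra.center ℝ A := fun i =>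
    (Subalgebra.center ℝ A).smul_mem (hTc i) _
  have hαcomm := fun n x => Subalgebra.mem_center_iff.1 (hαc n) x
  have hαn : ∀ i, ‖α i‖ ≤ 1 := fun i => by
    rw [hα_def, norm_smul, Real.norm_of_nonneg (by positivity)]
    calc _ ≤ (i + 1 : ℝ) * (i + 1 : ℝ)⁻¹ := by gcongr; exact hTn i
      _ = 1 := mul_inv_cancel₀ (by positivity)
  set x : ℕ → A := fun i => star (v i) * α i with hx_def
  have hfx : ∀ i, f i * x i = x i := fun i => by rw [hx_def, ← mul_assoc, hfv']
  have hxf : ∀ i, x i * f (i + 1) = x i := fun i => by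
    simp only [hx_def]
    rw [hαcomm, mul_assoc, hvf']
  obtain ⟨X, hXn, hX⟩ := hG.exists_nat x zero_le_one
    (fun i => (norm_mul_le _ _).trans (by
      rw [norm_star]; exact mul_le_one₀ (hvn i) (norm_nonneg _) (hαn i)))
    (fun i j hij => star_mul_eq_zero_of_mul_eq (hfs _) (hfx i) (hfx j) (hff _ _ hij))
    (fun i j hij => mul_star_eq_zero_of_mul_eq (hfs _) (hxf i) (hxf j) (hff _ _ (hne _ _ hij)))
  have hYf : ∀ i, Y * f i = v i := fun i => by
    rw [hY.mul_right_eq i fun j hj => by rw [← hvf, mul_assoc, hff _ _ hj, mul_zero], hvf]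
  have hXf : ∀ i, X * f (i + 1) = x i := fun i => by
    rw [hX.mul_right_eq i fun j hj => by rw [← hxf, mul_assoc, hff _ _ (hne _ _ hj), mul_zero], hxf]
  have hXf0 : X * f 0 = 0 := hX.mul_right_eq_zero fun j => by
    rw [← hxf, mul_assoc, hff _ _ (Nat.succ_ne_zero j), mul_zero]
  have hXY : ∀ i, X * Y * f i = α i * f i := fun i => by
    have h1 : α i * C (i + 1) = α i := by
      rw [hCcomm, hα_def]
      simp only
      rw [mul_smul_comm, hCT]
    rw [mul_assoc, hYf, ← hfv, ← mul_assoc, hXf]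
    simp only [hx_def]
    rw [hαcomm, mul_assoc, hch.star_mul, ← mul_assoc, h1]
  have hYX : ∀ i, Y * X * f (i + 1) = α i * f (i + 1) := fun i => by
    rw [mul_assoc, hXf, ← hfx, ← mul_assoc, hYf]
    simp only [hx_def]
    rw [← mul_assoc, hch.mul_star, hαcomm]
  have hCT' : ∀ i, C i * T i = T i := fun i => by
    rw [← hCT, ← mul_assoc, hch.central_mul_succ]
  have hμC : ∀ i, (C 0 - T 0) * C i = (i + 1 : ℝ)⁻¹ • C i - T i := by
    intro i
    induction i with
    | zero => simp [hCcomm, mul_sub, (hCp 0).isIdempotentElem.eq, hCT']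
    | succ i ih =>
      rw [← hch.central_mul_succ i, ← mul_assoc, ih, sub_mul, smul_mul_assoc,
        hch.central_mul_succ, hCcomm (i + 1) (T i), hCT, hTs i]
      have h2 : (i + 1 : ℝ) ≠ 0 := by positivity
      have h3 : (i + 2 : ℝ) ≠ 0 := by positivity
      have h4 : ((i + 1 : ℕ) + 1 : ℝ)⁻¹ = (i + 1 : ℝ)⁻¹ - ((i + 1 : ℝ) * (i + 2))⁻¹ := by
        push_cast
        have h5 : (i + 1 + 1 : ℝ) ≠ 0 := by positivity
        field_simp
        ring
      rw [h4]
      module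
  set μ := C 0 - T 0 with hμ_def
  have hμc : μ ∈ Subalgebra.center ℝ A := sub_mem (hCc 0) (hTc 0)
  have hμcomm := fun x => Subalgebra.mem_center_iff.1 hμc x
  have hμf : ∀ i, μ * f i = (i + 1 : ℝ)⁻¹ • f i - T i * f i := fun i => by
    conv_lhs => rw [← hch.central_mul i]
    rw [← mul_assoc, hμC, sub_mul, smul_mul_assoc, hch.central_mul]
  set y := X * Y - Y * X - f 0 + μ * q with hy_def
  have hyf : ∀ i, y * f i = 0 := by
    rintro (_ | i)
    · rw [hy_def, add_mul, sub_mul, sub_mul, hXY, mul_assoc Y, hXf0, mul_assoc μ, hqf, hμf,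
        (hfp 0).isIdempotentElem.eq, hα_def]
      simp
    · rw [hy_def, add_mul, sub_mul, sub_mul, hXY, hYX, mul_assoc μ, hqf, hμf,
        hff 0 _ (Nat.succ_ne_zero i).symm, hα_def]
      have h1 : T i * f (i + 1) =
          ((i + 1 : ℝ) * (i + 2))⁻¹ • f (i + 1) + T (i + 1) * f (i + 1) := by
        rw [hTs i, add_mul, smul_mul_assoc, hch.central_mul]
      simp only [smul_mul_assoc, h1]
      have h2 : (i + 1 : ℝ) ≠ 0 := by positivity
      have h3 : (i + 2 : ℝ) ≠ 0 := by positivity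
      have h4 : ((i + 1 : ℕ) + 1 : ℝ)⁻¹ = (i + 1 : ℝ) * ((i + 1 : ℝ) * (i + 2))⁻¹ := by
        push_cast
        have h5 : (i + 1 + 1 : ℝ) ≠ 0 := by positivity
        field_simp
        ring
      rw [h4]
      push_cast
      module
  obtain ⟨F, hF, hFy⟩ := hB (Set.range f)
  have hyF : y * F = 0 := (hFy y).2 (by rintro _ ⟨i, rfl⟩; exact hyf i)
  have hfF : ∀ i, f i * (1 - F) = 0 := fun i => by
    have := congrArg star ((hFy _).1 hF.one_sub_mul_self (f i) ⟨i, rfl⟩)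
    rwa [star_mul, star_zero, hfs, hF.one_sub.isSelfAdjoint.star_eq] at this
  have hYF : Y * (1 - F) = 0 := hY.mul_right_eq_zero fun j => by
    rw [← hvf, mul_assoc, hfF, mul_zero]
  have hXF : X * (1 - F) = 0 := hX.mul_right_eq_zero fun j => by
    rw [← hxf, mul_assoc, hfF, mul_zero]
  have hym : y = μ * (q * (1 - F)) := by
    have h1 : y = y * F + y * (1 - F) := by rw [← mul_add]; simp
    rw [hyF, zero_add] at h1
    rw [h1, hy_def, add_mul, sub_mul, sub_mul, mul_assoc X, hYF, mul_assoc Y, hXF, hfF, mul_assoc μ]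
    simp
  set m := q * (1 - F) with hm_def
  have hCm : ∀ j, C j * m = C (j + 1) * m := fun j => by
    have h1 := hch.maximal j
    rw [sub_mul, sub_eq_zero] at h1
    have h2 : (C j - C (j + 1)) * m = 0 := by
      rw [hm_def, ← mul_assoc, ← Subalgebra.mem_center_iff.1 (sub_mem (hCc j) (hCc _)), h1,
        Subalgebra.mem_center_iff.1 (sub_mem (hCc j) (hCc _)), mul_assoc, Finset.sum_mul,
        Finset.sum_eq_zero fun i _ => hfF i, mul_zero]
    rwa [sub_mul, sub_eq_zero] at h2
  have hCm' : ∀ j, μ * m = μ * C j * m := by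
    intro j
    induction j with
    | zero =>
      congr 1
      rw [hμ_def, sub_mul, (hCp 0).isIdempotentElem.eq, hCcomm, hCT']
    | succ j ih => rw [ih, mul_assoc, hCm, mul_assoc]
  have hmn : ∀ j : ℕ, ‖μ * m‖ ≤ 2 * ‖m‖ * (1 / (j + 1 : ℝ)) := fun j => by
    rw [hCm' j, hμC]
    have h1 : ‖(j + 1 : ℝ)⁻¹ • C j - T j‖ ≤ (j + 1 : ℝ)⁻¹ + (j + 1 : ℝ)⁻¹ := by
      refine (norm_sub_le _ _).trans (add_le_add ?_ (hTn j))
      rw [norm_smul, Real.norm_of_nonneg (by positivity)]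
      exact mul_le_of_le_one_right (by positivity) (hCp j).norm_le
    refine (norm_mul_le _ _).trans ((mul_le_mul_of_nonneg_right h1 (norm_nonneg m)).trans
      (le_of_eq (by ring)))
  have hm0 : μ * m = 0 := by
    have h1 := (tendsto_one_div_add_atTop_nhds_zero_nat (𝕜 := ℝ)).const_mul (2 * ‖m‖)
    rw [mul_zero] at h1
    exact norm_le_zero_iff.1 (ge_of_tendsto' h1 hmn)
  rw [hm0] at hym
  have hXq : X * q = X := by
    have h1 : X * (1 - q) = 0 := hX.mul_right_eq_zero fun j => by
      rw [← hxf, mul_assoc, mul_sub, mul_one, hfq, sub_self, mul_zero]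
    rw [mul_sub, mul_one, sub_eq_zero] at h1
    exact h1.symm
  have hqX : q * X = X := by
    have h1 : (1 - q) * X = 0 := hX.mul_left_eq_zero fun j => by
      rw [← hfx, ← mul_assoc, sub_mul, one_mul, hqf, sub_self, zero_mul]
    rw [sub_mul, one_mul, sub_eq_zero] at h1
    exact h1.symm
  have hYq : Y * q = Y := by
    have h1 : Y * (1 - q) = 0 := hY.mul_right_eq_zero fun j => by
      rw [← hvf, mul_assoc, mul_sub, mul_one, hfq, sub_self, mul_zero]
    rw [mul_sub, mul_one, sub_eq_zero] at h1
    exact h1.symm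
  have hqY : q * Y = Y := by
    have h1 : (1 - q) * Y = 0 := hY.mul_left_eq_zero fun j => by
      rw [← hfv, ← mul_assoc, sub_mul, one_mul, hqf, sub_self, zero_mul]
    rw [sub_mul, one_mul, sub_eq_zero] at h1
    exact h1.symm
  refine ⟨μ, X, Y, hμc, ?_, hqX, hXq, hqY, hYq, hXn, hYn, ?_⟩
  · have h1 := norm_sub_le (C 0) (T 0)
    have h2 := (hCp 0).norm_le
    have h3 := hTn 0
    norm_num at h3
    linarith
  · have h1 : f 0 = μ * q + (X * Y - Y * X) - y := by rw [hy_def]; abel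
    rw [hym, sub_zero] at h1
    exact h1

end Coupling

section Links

variable {A : Type u} [CStarAlgebra A]

/-- Self-adjoint elements below `q` are moved below `q'` with smaller norm, modulo central
multiples of `q` and commutators; moreover `q'` itself is a central multiple of `q` up to
commutators. -/
structure IsLink (q q' s : A) (K : ℝ) (n : ℕ) : Prop where
  exists_eq : ∀ b, IsSelfAdjoint b → q * b = b → ∃ w b' c, w ∈ Subalgebra.center ℝ A ∧
    ‖w‖ ≤ K * ‖b‖ ∧ IsSelfAdjoint b' ∧ q' * b' = b' ∧ ‖b'‖ ≤ 1 / 4 * ‖b‖ ∧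
    c ∈ CommSum s (K * ‖b‖) n ∧ b = w * q + b' + c
  exists_eq_mul : ∃ ν c, ν ∈ Subalgebra.center ℝ A ∧ ‖ν‖ ≤ 2 ∧ c ∈ CommSum s K n ∧ q' = ν * q + c

theorem CommSum.smul {s c : A} {K t : ℝ} {n : ℕ} (ht : |t| ≤ 1) (hc : c ∈ CommSum s K n) :
    t • c ∈ CommSum s K n := by
  induction n generalizing c with
  | zero => obtain rfl : c = 0 := hc; exact smul_zero t
  | succ n ih =>
    obtain ⟨c', hc', x, y, hx1, hx2, hy1, hy2, hx, hy, rfl⟩ := hc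
    refine ⟨t • c', ih hc', t • x, y, ?_, ?_, hy1, hy2, ?_, hy, ?_⟩
    · rw [mul_smul_comm, hx1]
    · rw [smul_mul_assoc, hx2]
    · rw [norm_smul, Real.norm_eq_abs]
      exact mul_le_one₀ ht (norm_nonneg x) hx
    · rw [smul_add, smul_sub, smul_mul_assoc, mul_smul_comm]

theorem CommSum.mono_left {s c : A} {K : ℝ} {m n : ℕ} (hK : 0 ≤ K) (hmn : m ≤ n)
    (hc : c ∈ CommSum s K m) : c ∈ CommSum s K n := by
  induction n, hmn using Nat.le_induction with
  | base => exact hc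
  | succ n _ ih => exact ⟨c, ih, 0, 0, by simp [hK]⟩

theorem eq_add_double_commutator {r : A} (hr : r * r = r) (a : A) :
    a = r * a * r + (1 - r) * a * (1 - r) + (r * (r * a - a * r) - (r * a - a * r) * r) := by
  have h1 : r * (r * a) = r * a := by rw [← mul_assoc, hr]
  have h2 : a * r * r = a * r := by rw [mul_assoc, hr]
  simp only [mul_sub, sub_mul, mul_one, one_mul, h1, h2, ← mul_assoc]
  abel

theorem norm_commutator_le {r : A} (hr : IsStarProjection r) (a : A) :
    ‖r * a - a * r‖ ≤ 2 * ‖a‖ := by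
  have h1 := norm_mul_le r a
  have h2 := norm_mul_le a r
  have h3 := norm_sub_le (r * a) (a * r)
  have h4 := hr.norm_le
  nlinarith [norm_nonneg a]

variable [PartialOrder A] [StarOrderedRing A]

theorem exists_dixmier_iterate (hB : IsBaerStar A) (hG : HasOrthogonalSums A) {q b : A}
    (hq : IsStarProjection q) (hb : IsSelfAdjoint b) (hqb : q * b = b) (n : ℕ) :
    ∃ z b' c, z ∈ Subalgebra.center ℝ A ∧ ‖z‖ ≤ n * ‖b‖ ∧ IsSelfAdjoint b' ∧ q * b' = b' ∧
      ‖b'‖ ≤ (3 / 4) ^ n * ‖b‖ ∧ c ∈ CommSum q ‖b‖ n ∧ b = z * q + b' + c := by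
  induction n with
  | zero => exact ⟨0, b, 0, zero_mem _, by simp, hb, hqb, by simp, rfl, by simp⟩
  | succ n ih =>
    obtain ⟨z, a, c, hz, hzn, ha, hqa, han, hc, h⟩ := ih
    obtain ⟨z', a', u, y, hz', -, hzn', ha', hqa', han', hu1, hu2, hun, hy1, hy2, hyn, h'⟩ :=
      exists_dixmier_step hB hG hq ha hqa
    have hab : ‖a‖ ≤ ‖b‖ :=
      han.trans (mul_le_of_le_one_left (norm_nonneg b) (pow_le_one₀ (by norm_num) (by norm_num)))
    refine ⟨z + z', a', c + (u * y - y * u), add_mem hz hz', ?_, ha', hqa', ?_,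
      CommSum.add hc (CommSum.commutator hu1 hu2 hy1 hy2 hun (hyn.trans hab)), ?_⟩
    · push_cast
      have := norm_add_le z z'
      linarith
    · rw [pow_succ]
      linarith
    · rw [h, h', add_mul]
      abel

/-- Half of a projection, up to an abelian projection. -/
theorem exists_halving (hB : IsBaerStar A) (hG : HasOrthogonalSums A) {N : A}
    (hN : IsStarProjection N) : ∃ V, IsPartialIsometry V ∧ N * V = V ∧ V * N = V ∧ V * V = 0 ∧
      IsAbelianProjection (N - V * star V - star V * V) := by
  obtain ⟨V, hV, hNV, hVN, hVV, hmax⟩ := exists_maximal_isPartialIsometry hB hG N N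
  have hVV' : star V * star V = 0 := by rw [← star_mul, hVV, star_zero]
  have hNV' : N * star V = star V := by simpa [hN.isSelfAdjoint.star_eq] using congrArg star hVN
  have hVN' : star V * N = star V := by simpa [hN.isSelfAdjoint.star_eq] using congrArg star hNV
  have hVs : star V * V * star V = star V := by simpa [IsPartialIsometry] using hV.star
  have hV' : V * star V * V = V := hV
  set E := N - V * star V - star V * V with hE_def
  have h1 : E * V = 0 := by rw [hE_def, sub_mul, sub_mul, hNV, hV', mul_assoc, hVV]; simp
  have h2 : E * star V = 0 := by rw [hE_def, sub_mul, sub_mul, hNV', hVs, mul_assoc, hVV']; simp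
  have h3 : V * E = 0 := by
    rw [hE_def, mul_sub, mul_sub, hVN, ← mul_assoc, hVV, ← mul_assoc, hV']; simp
  have h4 : star V * E = 0 := by
    rw [hE_def, mul_sub, mul_sub, hVN', ← mul_assoc, hVs, ← mul_assoc, hVV']; simp
  have hEN : E * N = E := by
    rw [hE_def, sub_mul, sub_mul, hN.isIdempotentElem.eq, mul_assoc, hVN', mul_assoc, hVN]
  have hE : IsStarProjection E := by
    constructor
    · have : E * E = E * N - E * V * star V - E * star V * V := by
        conv_lhs => rw [hE_def]
        simp only [mul_sub, ← mul_assoc]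
        rw [← hE_def]
      rw [IsIdempotentElem, this, h1, h2, hEN]
      simp
    · exact (hN.isSelfAdjoint.sub hV.mul_star_self.isSelfAdjoint).sub hV.star_mul_self.isSelfAdjoint
  have hNE : N * E = E := by
    simpa [hE.isSelfAdjoint.star_eq, hN.isSelfAdjoint.star_eq] using congrArg star hEN
  refine ⟨V, hV, hNV, hVN, hVV, hE, fun p hp hEp x => ?_⟩
  have hpE := hp.mul_eq_of_mul_eq hE hEp
  have hpp : (E - p) * p = 0 := by rw [sub_mul, hEp, hp.isIdempotentElem.eq, sub_self]
  have hEp' : (E - p) * E = E - p := by rw [sub_mul, hE.isIdempotentElem.eq, hpE]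
  have hEpN : (E - p) * N = E - p := by rw [← hEp', mul_assoc, hEN]
  have hz : ∀ u, E * u = 0 → (E - p) * u = 0 := fun u hu => by rw [← hEp', mul_assoc, hu, mul_zero]
  have hz' : ∀ u, u * E = 0 → u * p = 0 := fun u hu => by rw [← hEp, ← mul_assoc, hu, zero_mul]
  have hEps : star (E - p) = E - p := (hE.isSelfAdjoint.sub hp.isSelfAdjoint).star_eq
  refine hmax _ ?_ ?_ ?_ ?_ ?_ ?_ ?_
  · rw [← mul_assoc, ← mul_assoc, ← hEp, ← mul_assoc N, hNE]
  · rw [mul_assoc, hEpN]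
  · rw [mul_assoc, ← mul_assoc (E - p), ← mul_assoc (E - p), hpp]; simp
  · rw [star_mul, star_mul, hp.isSelfAdjoint.star_eq, mul_assoc, mul_assoc, ← hpE, mul_assoc p, h1]
    simp
  · rw [mul_assoc, hz _ h2, mul_zero]
  · rw [mul_assoc, hz _ h1, mul_zero]
  · rw [← mul_assoc, ← mul_assoc, hz' _ h3]; simp

theorem isLink_of_isPartialIsometry (hB : IsBaerStar A) (hG : HasOrthogonalSums A)
    {q q' s v₁ v₂ e : A} (hq : IsStarProjection q) (hs : IsStarProjection s) (hsq : s * q = q)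
    (hsq' : s * q' = q') (h₁ : IsPartialIsometry v₁) (h₂ : IsPartialIsometry v₂)
    (he : IsAbelianProjection e) (h₁' : star v₁ * v₁ = q') (h₂' : star v₂ * v₂ = q')
    (h₁₂ : star v₁ * v₂ = 0) (he₁ : e * v₁ = 0) (he₂ : e * v₂ = 0)
    (hsum : q = v₁ * star v₁ + v₂ * star v₂ + e) : IsLink q q' s 10 13 := by
  have hep := he.isStarProjection
  set r := v₁ * star v₁ with hr_def
  set r' := v₂ * star v₂ with hr'_def
  have hr : IsStarProjection r := h₁.mul_star_self
  have hr' : IsStarProjection r' := h₂.mul_star_self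
  have hq' : IsStarProjection q' := h₁' ▸ h₁.star_mul_self
  have hrr' : r * r' = 0 := by
    rw [hr_def, hr'_def, mul_assoc, ← mul_assoc (star v₁), h₁₂]; simp
  have hr'r : r' * r = 0 := by
    simpa [hr.isSelfAdjoint.star_eq, hr'.isSelfAdjoint.star_eq] using congrArg star hrr'
  have her : e * r = 0 := by rw [hr_def, ← mul_assoc, he₁, zero_mul]
  have her' : e * r' = 0 := by rw [hr'_def, ← mul_assoc, he₂, zero_mul]
  have hre : r * e = 0 := by
    simpa [hr.isSelfAdjoint.star_eq, hep.isSelfAdjoint.star_eq] using congrArg star her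
  have hr'e : r' * e = 0 := by
    simpa [hr'.isSelfAdjoint.star_eq, hep.isSelfAdjoint.star_eq] using congrArg star her'
  have hqr : q * r = r := by
    rw [hsum, add_mul, add_mul, hr.isIdempotentElem.eq, hr'r, her, add_zero, add_zero]
  have hqr' : q * r' = r' := by
    rw [hsum, add_mul, add_mul, hr'.isIdempotentElem.eq, hrr', her', add_zero, zero_add]
  have hqe : q * e = e := by
    rw [hsum, add_mul, add_mul, hep.isIdempotentElem.eq, hre, hr'e, add_zero, zero_add]
  have hrq := hr.mul_eq_of_mul_eq hq hqr
  have hr'q := hr'.mul_eq_of_mul_eq hq hqr'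
  have hqs := hq.mul_eq_of_mul_eq hs hsq
  have hq's := hq'.mul_eq_of_mul_eq hs hsq'
  have hrv : r * v₁ = v₁ := h₁
  have hrv' : r' * v₂ = v₂ := h₂
  have hqv : q * v₁ = v₁ := by rw [← hrv, ← mul_assoc, hqr]
  have hqv' : q * v₂ = v₂ := by rw [← hrv', ← mul_assoc, hqr']
  have hvq : v₁ * q' = v₁ := by rw [← h₁', ← mul_assoc]; exact h₁
  have hvq' : v₂ * q' = v₂ := by rw [← h₂', ← mul_assoc]; exact h₂
  obtain ⟨μ, X, Y, hμ, hμn, hqX, hXq, hqY, hYq, hXn, hYn, heq⟩ :=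
    he.exists_eq_mul_add_commutator hB hG hq hqe
  have key : ∀ {v b : A}, IsPartialIsometry v → star v * v = q' → q * v = v → v * q' = v →
      v * star v * b * (v * star v) - star v * b * v ∈ CommSum s ‖b‖ 1 := by
    intro v b hv hvv hqv hvq
    have hsv : s * v = v := by rw [← hqv, ← mul_assoc, hsq]
    have hvs : v * s = v := by rw [← hvq, mul_assoc, hq's]
    have hvs' : star v * s = star v := by
      simpa [hs.isSelfAdjoint.star_eq] using congrArg star hsv
    have hsv' : s * star v = star v := by
      simpa [hs.isSelfAdjoint.star_eq] using congrArg star hvs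
    have h : v * star v * b * (v * star v) - star v * b * v =
        v * (star v * b * v * star v) - (star v * b * v * star v) * v := by
      have h1 : star v * b * v * star v * v = star v * b * (v * star v * v) := by
        simp only [mul_assoc]
      have h2 : v * star v * v = v := hv
      rw [h1, h2]
      simp only [mul_assoc]
    rw [h]
    refine CommSum.commutator hsv hvs ?_ ?_ hv.norm_le ?_
    · rw [← mul_assoc, ← mul_assoc, ← mul_assoc, hsv']
    · rw [mul_assoc, hvs']
    · have h1 : ‖star v‖ ≤ 1 := by rw [norm_star]; exact hv.norm_le
      have h3 : ‖star v * b‖ ≤ ‖b‖ := (norm_mul_le _ _).trans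
        (mul_le_of_le_one_left (norm_nonneg _) h1)
      have h4 : ‖star v * b * v‖ ≤ ‖star v * b‖ := (norm_mul_le _ _).trans
        (mul_le_of_le_one_right (norm_nonneg _) hv.norm_le)
      have h5 : ‖star v * b * v * star v‖ ≤ ‖star v * b * v‖ := (norm_mul_le _ _).trans
        (mul_le_of_le_one_right (norm_nonneg _) h1)
      exact h5.trans (h4.trans h3)
  have hXY : X * Y - Y * X ∈ CommSum s 1 1 :=
    CommSum.mono hsq hqs le_rfl (CommSum.commutator hqX hXq hqY hYq hXn hYn)
  have haq : ∀ {a}, IsSelfAdjoint a → q * a = a → a * q = a := fun ha hqa => by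
    simpa [hq.isSelfAdjoint.star_eq, ha.star_eq] using congrArg star hqa
  have hpq : ∀ {p a : A}, IsStarProjection p → q * p = p → IsSelfAdjoint a → q * a = a →
      p * (p * a - a * p) - (p * a - a * p) * p ∈ CommSum s (2 * ‖a‖) 1 := by
    intro p a hp hqp ha hqa
    have hpq := hp.mul_eq_of_mul_eq hq hqp
    have hsp : s * p = p := by rw [← hqp, ← mul_assoc, hsq]
    have hps : p * s = p := by rw [← hpq, mul_assoc, hqs]
    have hsa : s * a = a := by rw [← hqa, ← mul_assoc, hsq]
    have has : a * s = a := by rw [← haq ha hqa, mul_assoc, hqs]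
    refine CommSum.commutator hsp hps ?_ ?_ hp.norm_le (norm_commutator_le hp a)
    · rw [mul_sub, ← mul_assoc, hsp, ← mul_assoc, hsa]
    · rw [sub_mul, mul_assoc, has, mul_assoc, hps]
  constructor
  · intro b hb hqb
    obtain ⟨z, a, c, hz, hzn, ha, hqa, han, hc, h⟩ := exists_dixmier_iterate hB hG hq hb hqb 8
    have hab : ‖a‖ ≤ 1 / 8 * ‖b‖ := han.trans
      (mul_le_mul_of_nonneg_right (by norm_num) (norm_nonneg b))
    have haq' := haq ha hqa
    set a₁ := (1 - r) * a * (1 - r) with ha₁_def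
    have hsa₁ : IsSelfAdjoint a₁ := by
      have h1 := hr.one_sub.isSelfAdjoint.star_eq
      rw [IsSelfAdjoint, ha₁_def, star_mul, star_mul, h1, ha.star_eq, mul_assoc]
    have hqa₁ : q * a₁ = a₁ := by
      have h1 : q * (1 - r) = (1 - r) * q := by rw [mul_sub, sub_mul, hqr, hrq, mul_one, one_mul]
      rw [ha₁_def, ← mul_assoc, ← mul_assoc, h1, mul_assoc (1 - r), hqa]
    have ha₁n : ‖a₁‖ ≤ ‖a‖ := by
      have h1 : ‖(1 - r) * a‖ ≤ ‖a‖ := (norm_mul_le _ _).trans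
        (mul_le_of_le_one_left (norm_nonneg _) hr.one_sub.norm_le)
      exact ((norm_mul_le _ _).trans
        (mul_le_of_le_one_right (norm_nonneg _) hr.one_sub.norm_le)).trans h1
    have hr'1 : r' * a₁ * r' = r' * a * r' := by
      have h1 : r' * (1 - r) = r' := by rw [mul_sub, hr'r, mul_one, sub_zero]
      have h2 : (1 - r) * r' = r' := by rw [sub_mul, hrr', one_mul, sub_zero]
      have h3 : r' * a₁ * r' = r' * (1 - r) * a * ((1 - r) * r') := by
        rw [ha₁_def]
        simp only [mul_assoc]
      rw [h3, h1, h2]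
    have he1 : (1 - r') * a₁ * (1 - r') = e * a * e := by
      have h1 : (1 - r') * (1 - r) * q = e := by
        rw [mul_assoc, sub_mul 1 r q, one_mul, hrq, sub_mul, one_mul, mul_sub, hr'q, hr'r, hsum]
        abel
      have h2 : q * ((1 - r) * (1 - r')) = e := by
        rw [← mul_assoc, mul_sub q, mul_one, hqr, mul_sub, mul_one, sub_mul, hqr', hrr', hsum]
        abel
      have h3 : (1 - r') * a₁ * (1 - r') =
          (1 - r') * (1 - r) * (q * a * q) * ((1 - r) * (1 - r')) := by
        rw [hqa, haq', ha₁_def]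
        simp only [mul_assoc]
      have h4 : (1 - r') * (1 - r) * (q * a * q) * ((1 - r) * (1 - r')) =
        ((1 - r') * (1 - r) * q) * a * (q * ((1 - r) * (1 - r'))) := by simp only [mul_assoc]
      rw [h3, h4, h1, h2]
    have hsa₂ : IsSelfAdjoint (e * a * e) := by
      have h1 := hep.isSelfAdjoint.star_eq
      rw [IsSelfAdjoint, star_mul, star_mul, h1, ha.star_eq, mul_assoc]
    have haen : ‖e * a * e‖ ≤ ‖a‖ := by
      have h1 : ‖e * a‖ ≤ ‖a‖ := (norm_mul_le _ _).trans
        (mul_le_of_le_one_left (norm_nonneg _) hep.norm_le)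
      exact ((norm_mul_le _ _).trans (mul_le_of_le_one_right (norm_nonneg _) hep.norm_le)).trans h1
    obtain ⟨ζ, hζ, hζn, hζe⟩ := he.exists_mul_eq hB hsa₂
      (by rw [← mul_assoc, ← mul_assoc, hep.isIdempotentElem.eq])
    have hsv : ∀ v : A, IsSelfAdjoint (star v * a * v) := fun v => by
      rw [IsSelfAdjoint, star_mul, star_mul, star_star, ha.star_eq, mul_assoc]
    have hvn : ∀ {v : A}, IsPartialIsometry v → ‖star v * a * v‖ ≤ ‖a‖ := fun {v} hv => by
      have h1 : ‖star v * a‖ ≤ ‖a‖ := (norm_mul_le _ _).trans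
        (mul_le_of_le_one_left (norm_nonneg _) (by rw [norm_star]; exact hv.norm_le))
      exact ((norm_mul_le _ _).trans (mul_le_of_le_one_right (norm_nonneg _) hv.norm_le)).trans h1
    have hqv₁ : q' * star v₁ = star v₁ := by
      simpa [hq'.isSelfAdjoint.star_eq] using congrArg star hvq
    have hqv₂ : q' * star v₂ = star v₂ := by
      simpa [hq'.isSelfAdjoint.star_eq] using congrArg star hvq'
    have hd1 := eq_add_double_commutator hr.isIdempotentElem.eq a
    have hd2 := eq_add_double_commutator hr'.isIdempotentElem.eq a₁
    rw [← ha₁_def] at hd1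
    rw [hr'1, he1] at hd2
    have hb0 := norm_nonneg b
    have hk1 := CommSum.mono_right (K' := 10 * ‖b‖) (by linarith) (key (b := a) h₁ h₁' hqv hvq)
    have hk2 := CommSum.mono_right (K' := 10 * ‖b‖) (by linarith) (key (b := a) h₂ h₂' hqv' hvq')
    have hk3 := CommSum.mono_right (K' := 10 * ‖b‖) (by linarith) (hpq hr hqr ha hqa)
    have hk4 := CommSum.mono_right (K' := 10 * ‖b‖) (by linarith) (hpq hr' hqr' hsa₁ hqa₁)
    have hk5 := CommSum.mono_right (K' := 10 * ‖b‖) (by linarith) (CommSum.central_mul hζ hXY)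
    have hk6 := CommSum.mono hsq hqs (K' := 10 * ‖b‖) (by linarith) hc
    refine ⟨z + ζ * μ, star v₁ * a * v₁ + star v₂ * a * v₂, _, add_mem hz (mul_mem hζ hμ), ?_,
      (hsv v₁).add (hsv v₂), ?_, ?_,
      CommSum.add (CommSum.add (CommSum.add (CommSum.add (CommSum.add hk6 hk1) hk2) hk3) hk4) hk5,
      ?_⟩
    · have h1 := norm_add_le z (ζ * μ)
      have h2 := norm_mul_le ζ μ
      have h3 : ‖ζ‖ * ‖μ‖ ≤ (3 * ‖a‖) * 2 :=
        mul_le_mul (hζn.trans (by linarith)) hμn (norm_nonneg _) (by positivity)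
      norm_num at hzn
      linarith
    · rw [mul_add, ← mul_assoc, ← mul_assoc, ← mul_assoc, ← mul_assoc, hqv₁, hqv₂]
    · have h1 := norm_add_le (star v₁ * a * v₁) (star v₂ * a * v₂)
      have h2 := hvn h₁
      have h3 := hvn h₂
      linarith
    · have h1 : ζ * μ * q + ζ * (X * Y - Y * X) = e * a * e := by
        rw [← hζe, mul_assoc, ← mul_add, ← heq]
      have h2 : a = r * a * r + (r' * a * r' + e * a * e +
          (r' * (r' * a₁ - a₁ * r') - (r' * a₁ - a₁ * r') * r')) +
          (r * (r * a - a * r) - (r * a - a * r) * r) := by rw [← hd2]; exact hd1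
      rw [add_mul, h]
      conv_lhs => rw [h2, ← h1]
      abel
  · have hv : ∀ {v : A}, IsPartialIsometry v → star v * v = q' → q * v = v → v * q' = v →
        v * star v - q' ∈ CommSum s 1 1 := by
      intro v hv hvv hqv hvq
      have hsv : s * v = v := by rw [← hqv, ← mul_assoc, hsq]
      have hvs : v * s = v := by rw [← hvq, mul_assoc, hq's]
      have hvs' : star v * s = star v := by
        simpa [hs.isSelfAdjoint.star_eq] using congrArg star hsv
      have hsv' : s * star v = star v := by
        simpa [hs.isSelfAdjoint.star_eq] using congrArg star hvs
      rw [← hvv]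
      exact CommSum.commutator hsv hvs hsv' hvs' hv.norm_le (by rw [norm_star]; exact hv.norm_le)
    have h1 := CommSum.smul (t := -(1 / 2)) (by norm_num [abs_div])
      (CommSum.add (CommSum.add (hv h₁ h₁' hqv hvq) (hv h₂ h₂' hqv' hvq')) hXY)
    refine ⟨(1 / 2 : ℝ) • (1 - μ), _, Subalgebra.smul_mem _ (sub_mem (one_mem _) hμ) _, ?_,
      CommSum.mono_left (by norm_num) (by norm_num) (CommSum.mono_right (by norm_num) h1), ?_⟩
    · have h2 := norm_sub_le 1 μ
      have h3 : ‖(1 : A)‖ ≤ 1 := (IsStarProjection.one A).norm_le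
      rw [norm_smul]
      norm_num
      linarith
    · rw [smul_mul_assoc, sub_mul, one_mul]
      have h2 : X * Y - Y * X = q - r - r' - μ * q := by
        have h3 : q = r + r' + (μ * q + (X * Y - Y * X)) := by rw [← heq]; exact hsum
        rw [← sub_eq_zero] at h3 ⊢
        rw [← neg_eq_zero, ← h3]
        abel
      rw [h2]
      module

end Links

section CentralApproximation

variable {A : Type u} [CStarAlgebra A]

theorem IsLink.exists_sub_mem_closure {q : ℕ → A} (hq : ∀ k, IsStarProjection (q k))
    (hqq : ∀ i j, i ≠ j → q i * q j = 0) {K : ℝ} {n : ℕ} (hK : 0 ≤ K)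
    (hl : ∀ k, IsLink (q k) (q (k + 1)) (q k + q (k + 1)) K n) {b : A} (hb : IsSelfAdjoint b)
    (hqb : q 0 * b = b) : ∃ t ∈ Subalgebra.center ℝ A,
      b - t * q 0 ∈ AddSubgroup.closure {c : A | ∃ x y, c = x * y - y * x} := by
  have hex : ∀ k b, ∃ w b' c, IsSelfAdjoint b → q k * b = b → w ∈ Subalgebra.center ℝ A ∧
      ‖w‖ ≤ K * ‖b‖ ∧ IsSelfAdjoint b' ∧ q (k + 1) * b' = b' ∧ ‖b'‖ ≤ 1 / 4 * ‖b‖ ∧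
      c ∈ CommSum (q k + q (k + 1)) (K * ‖b‖) n ∧ b = w * q k + b' + c := by
    intro k b
    by_cases h : IsSelfAdjoint b ∧ q k * b = b
    · obtain ⟨w, b', c, h'⟩ := (hl k).exists_eq b h.1 h.2
      exact ⟨w, b', c, fun _ _ => h'⟩
    · exact ⟨0, 0, 0, fun h1 h2 => absurd ⟨h1, h2⟩ h⟩
  choose W B C hWBC using hex
  choose ν c' hν hνn hc' hqν using fun k => (hl k).exists_eq_mul
  let β : ℕ → A := fun k => Nat.rec b (fun k x => B k x) k
  have hβs : ∀ k, β (k + 1) = B k (β k) := fun _ => rfl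
  have hβ : ∀ k, IsSelfAdjoint (β k) ∧ q k * β k = β k ∧ ‖β k‖ ≤ ‖b‖ * (1 / 4) ^ k := by
    intro k
    induction k with
    | zero => exact ⟨hb, hqb, by simp [β]⟩
    | succ k ih =>
      obtain ⟨-, -, h1, h2, h3, -, -⟩ := hWBC k (β k) ih.1 ih.2.1
      refine ⟨h1, h2, h3.trans ?_⟩
      rw [pow_succ]
      linarith [ih.2.2]
  have hall := fun k => hWBC k (β k) (hβ k).1 (hβ k).2.1
  obtain ⟨t, htc, htn, ht⟩ := exists_central_recurrence (w := fun k => W k (β k)) (ν := ν)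
    (K := K * ‖b‖) (fun k => (hall k).1) hν (fun k => (hall k).2.1.trans
      (by rw [mul_assoc]; exact mul_le_mul_of_nonneg_left (hβ k).2.2 hK)) hνn
  set d : ℕ → A := fun k => β k - t k * q k with hd_def
  set K' := K * ‖b‖ + 2 * (K * ‖b‖) * K with hK'
  have hb0 := norm_nonneg b
  have hKb : 0 ≤ K * ‖b‖ := mul_nonneg hK hb0
  have hK0 : 0 ≤ K' := by positivity
  have hd : ∀ k, d k - d (k + 1) ∈ CommSum (q k + q (k + 1)) (K' * (1 / 4) ^ k) (n + n) := by
    intro k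
    have h1 : d k - d (k + 1) = C k (β k) + t (k + 1) * c' k := by
      have h2 := (hall k).2.2.2.2.2.2
      rw [← hβs] at h2
      have h2' : β k = C k (β k) + (W k (β k) * q k + β (k + 1)) := h2.trans (add_comm _ _)
      have h3 : t k * q k = W k (β k) * q k + t (k + 1) * (ν k * q k) := by
        rw [ht k, add_mul, Subalgebra.mem_center_iff.1 (htc (k + 1)) (ν k), mul_assoc]
      have h4 : t (k + 1) * q (k + 1) = t (k + 1) * (ν k * q k) + t (k + 1) * c' k := by
        rw [← mul_add, ← hqν k]
      simp only [hd_def]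
      rw [h3, h4]
      generalize W k (β k) = x, C k (β k) = y at h2'
      rw [h2']
      abel
    have hp : (0 : ℝ) ≤ (1 / 4) ^ k := by positivity
    rw [h1]
    refine CommSum.add (CommSum.mono_right ?_ (hall k).2.2.2.2.2.1)
      (CommSum.mono_right ?_ (CommSum.central_mul (htc (k + 1)) (hc' k)))
    · have := mul_le_mul_of_nonneg_left (hβ k).2.2 hK
      have h5 : 0 ≤ 2 * (K * ‖b‖) * K * (1 / 4) ^ k := by positivity
      rw [hK', add_mul]
      linarith
    · have h5 := mul_le_mul_of_nonneg_right (htn (k + 1)) hK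
      have h6 : 0 ≤ 2 * (K * ‖b‖) * K * (1 / 4) ^ k := by positivity
      have h7 : 0 ≤ K * ‖b‖ * (1 / 4) ^ k := by positivity
      rw [pow_succ] at h5
      rw [hK', add_mul]
      linarith
  have hs : ∀ i j, i + 1 < j → (q i + q (i + 1)) * (q j + q (j + 1)) = 0 ∧
      (q j + q (j + 1)) * (q i + q (i + 1)) = 0 := by
    intro i j hij
    simp only [add_mul, mul_add]
    constructor <;>
    · rw [hqq _ _ (by omega), hqq _ _ (by omega), hqq _ _ (by omega), hqq _ _ (by omega)]
      simp
  have hs' : ∀ r i j, i ≠ j → (q (2 * i + r) + q (2 * i + r + 1)) *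
      (q (2 * j + r) + q (2 * j + r + 1)) = 0 := by
    intro r i j hij
    rcases lt_or_gt_of_ne hij with h | h
    · exact (hs _ _ (by omega)).1
    · exact (hs _ _ (by omega)).2
  have hfold : ∀ r, ∃ S ∈ AddSubgroup.closure {c : A | ∃ x y, c = x * y - y * x},
      HasSum (fun k => d (2 * k + r) - d (2 * k + r + 1)) S := fun r =>
    CommSum.exists_hasSum (hs' r) (K := K') (n := n + n) fun k =>
      CommSum.mono_right (mul_le_mul_of_nonneg_left
        (pow_le_pow_of_le_one (by norm_num) (by norm_num) (by omega)) hK0) (hd (2 * k + r))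
  obtain ⟨S₀, hS₀, h₀⟩ := hfold 0
  obtain ⟨S₁, hS₁, h₁⟩ := hfold 1
  have hsum : HasSum (fun k => d k - d (k + 1)) (S₀ + S₁) := HasSum.even_add_odd h₀ h₁
  have hlim : Filter.Tendsto d Filter.atTop (nhds 0) := by
    refine squeeze_zero_norm (a := fun k => (‖b‖ + 2 * (K * ‖b‖)) * (1 / 4) ^ k) (fun k => ?_) ?_
    · have h1 := norm_sub_le (β k) (t k * q k)
      have h2 : ‖t k * q k‖ ≤ ‖t k‖ := (norm_mul_le _ _).trans
        (mul_le_of_le_one_right (norm_nonneg _) (hq k).norm_le)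
      have := (hβ k).2.2
      have := htn k
      simp only [hd_def]
      linarith
    · simpa using (tendsto_pow_atTop_nhds_zero_of_lt_one (r := (1 / 4 : ℝ)) (by norm_num)
        (by norm_num)).const_mul (‖b‖ + 2 * (K * ‖b‖))
  have hlim' := hsum.tendsto_sum_nat
  simp only [Finset.sum_range_sub'] at hlim'
  have heq := tendsto_nhds_unique hlim' (hlim.const_sub (d 0))
  rw [sub_zero] at heq
  exact ⟨t 0, htc 0, by rw [show b - t 0 * q 0 = d 0 from rfl, ← heq]; exact add_mem hS₀ hS₁⟩

variable [PartialOrder A] [StarOrderedRing A]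

theorem isLink_of_halving (hB : IsBaerStar A) (hG : HasOrthogonalSums A) {U V s : A}
    (hU : IsPartialIsometry U) (hV : IsPartialIsometry V) (hUV : U * star U * V = V)
    (hVU : V * (U * star U) = V) (hVV : V * V = 0)
    (hE : IsAbelianProjection (U * star U - V * star V - star V * V)) (hs : IsStarProjection s)
    (hsU : s * (star U * U) = star U * U) (hsV : s * (star V * V) = star V * V) :
    IsLink (star U * U) (star V * V) s 10 13 := by
  have hU' : U * star U * U = U := hU
  have hV' : V * star V * V = V := hV
  have hUs : star U * U * star U = star U := by simpa [IsPartialIsometry] using hU.star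
  have hVs : star V * V * star V = star V := by simpa [IsPartialIsometry] using hV.star
  have hVV' : star V * star V = 0 := by rw [← star_mul, hVV, star_zero]
  have hSU : star V * (U * star U) = star V := by
    simpa [mul_assoc] using congrArg star hUV
  have hUS : U * star U * star V = star V := by
    simpa [mul_assoc] using congrArg star hVU
  set E := U * star U - V * star V - star V * V with hE_def
  have hEN : E * (U * star U) = E := by
    have h1 : U * star U * (U * star U) = U * star U := by rw [← mul_assoc, hU']
    rw [hE_def, sub_mul, sub_mul, h1, mul_assoc V, hSU, mul_assoc (star V), hVU]
  have hEV : E * V = 0 := by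
    rw [hE_def, sub_mul, sub_mul, hUV, hV', mul_assoc, hVV]; simp
  have hEVs : E * star V = 0 := by
    rw [hE_def, sub_mul, sub_mul, hUS, hVs, mul_assoc, hVV']; simp
  have hEs := hE.isStarProjection.isSelfAdjoint.star_eq
  have hEE := hE.isStarProjection.isIdempotentElem.eq
  have he : IsAbelianProjection (star U * E * U) := by
    have hW : IsPartialIsometry (star U * E) := by
      have : star U * E * star (star U * E) * (star U * E) =
          star U * (E * E * (U * star U)) * E := by
        rw [star_mul, star_star, hEs]
        simp only [mul_assoc]
      rw [IsPartialIsometry, this, hEE, hEN, mul_assoc, hEE]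
    have h1 := hE.of_isPartialIsometry hW (by rw [mul_assoc, hEE])
    rwa [star_mul, star_star, hEs, mul_assoc, ← mul_assoc E E, hEE, ← mul_assoc] at h1
  have h1 : star (star U * (star V * V)) * (star U * (star V * V)) = star V * V := by
    have : star (star U * (star V * V)) * (star U * (star V * V)) =
        star V * V * (U * star U * star V) * V := by
      simp only [star_mul, star_star, mul_assoc]
    rw [this, hUS, hVs]
  have h2 : star (star U * V) * (star U * V) = star V * V := by
    rw [star_mul, star_star, mul_assoc, ← mul_assoc U, hUV]
  refine isLink_of_isPartialIsometry hB hG (v₁ := star U * (star V * V)) (v₂ := star U * V)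
    hU.star_mul_self hs hsU hsV ?_ ?_ he h1 h2 ?_ ?_ ?_ ?_
  · rw [IsPartialIsometry, mul_assoc, h1, mul_assoc, ← mul_assoc _ (star V), hVs]
  · rw [IsPartialIsometry, mul_assoc, h2, mul_assoc, ← mul_assoc V, hV']
  · rw [star_mul, star_star, mul_assoc, ← mul_assoc U, hUV, star_mul, star_star, mul_assoc, hVV,
      mul_zero]
  · rw [mul_assoc, ← mul_assoc U, ← mul_assoc (U * star U), hUS, mul_assoc, ← mul_assoc E, hEVs]
    simp
  · rw [mul_assoc, ← mul_assoc U, hUV, mul_assoc, hEV, mul_zero]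
  · have h3 : star U * (star V * V) * star (star U * (star V * V)) =
        star U * (star V * V * star V * V) * U := by simp only [star_mul, star_star, mul_assoc]
    have h4 : star U * V * star (star U * V) = star U * (V * star V) * U := by
      simp only [star_mul, star_star, mul_assoc]
    rw [h3, hVs, h4, ← add_mul, ← add_mul, ← mul_add, ← mul_add, hE_def]
    have h5 : star V * V + V * star V + (U * star U - V * star V - star V * V) = U * star U := by
      abel
    rw [h5, ← mul_assoc, hUs]

/-- Modulo finite sums of commutators, self-adjoint elements are central. -/
theorem IsBaerStar.exists_center_sub_mem_closure (hB : IsBaerStar A) (hG : HasOrthogonalSums A)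
    {a : A} (ha : IsSelfAdjoint a) : ∃ z ∈ Subalgebra.center ℝ A,
      a - z ∈ AddSubgroup.closure {c : A | ∃ x y, c = x * y - y * x} := by
  have hex : ∀ N : A, ∃ V, IsStarProjection N → IsPartialIsometry V ∧ N * V = V ∧ V * N = V ∧
      V * V = 0 ∧ IsAbelianProjection (N - V * star V - star V * V) := by
    intro N
    by_cases h : IsStarProjection N
    · obtain ⟨V, hV⟩ := exists_halving hB hG h
      exact ⟨V, fun _ => hV⟩
    · exact ⟨0, fun h' => absurd h' h⟩
  choose V hV using hex
  let U : ℕ → A := fun k => Nat.rec 1 (fun _ x => V (x * star x)) k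
  have hUs : ∀ k, U (k + 1) = V (U k * star (U k)) := fun _ => rfl
  have hU0 : U 0 = 1 := rfl
  have hU : ∀ k, IsPartialIsometry (U k) := by
    intro k
    induction k with
    | zero => simp [IsPartialIsometry, hU0]
    | succ k ih => exact (hV _ ih.mul_star_self).1
  have hVU := fun k => (hV _ (hU k).mul_star_self).2
  simp only [← hUs] at hVU
  set N : ℕ → A := fun k => U k * star (U k) with hN_def
  set q : ℕ → A := fun k => star (U k) * U k with hq_def
  have hN : ∀ k, IsStarProjection (N k) := fun k => (hU k).mul_star_self
  have hq : ∀ k, IsStarProjection (q k) := fun k => (hU k).star_mul_self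
  have hNN : ∀ j k, j ≤ k → N j * N k = N k := by
    intro j k hjk
    induction k, hjk using Nat.le_induction with
    | base => exact (hN j).isIdempotentElem.eq
    | succ k _ ih =>
      have h1 : N k * N (k + 1) = N (k + 1) := by
        change N k * (U (k + 1) * star (U (k + 1))) = _
        rw [← mul_assoc, (hVU k).1]
      rw [← h1, ← mul_assoc, ih]
  have hNq : ∀ k, q (k + 1) * N k = q (k + 1) := fun k => by
    change star (U (k + 1)) * U (k + 1) * N k = _
    rw [mul_assoc, (hVU k).2.1]
  have hqN : ∀ k, q (k + 1) * N (k + 1) = 0 := fun k => by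
    change star (U (k + 1)) * U (k + 1) * (U (k + 1) * star (U (k + 1))) = 0
    rw [mul_assoc, ← mul_assoc (U (k + 1)), (hVU k).2.2.1]
    simp
  have hNq' := fun k => (hq (k + 1)).mul_eq_of_mul_eq (hN k)
  have hlt : ∀ i j, i < j → q (j + 1) * q (i + 1) = 0 ∧ q (i + 1) * q (j + 1) = 0 := by
    intro i j hij
    have h1 : N j * q (j + 1) = q (j + 1) := by
      simpa [(hq (j + 1)).isSelfAdjoint.star_eq, (hN j).isSelfAdjoint.star_eq] using
        congrArg star (hNq j)
    have h2 : q (i + 1) * q (j + 1) = 0 := by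
      have h3 : q (i + 1) * (N (i + 1) * (N j * q (j + 1))) = 0 := by
        rw [← mul_assoc, hqN, zero_mul]
      rwa [← mul_assoc (N (i + 1)), hNN (i + 1) j hij, h1] at h3
    refine ⟨?_, h2⟩
    simpa [(hq _).isSelfAdjoint.star_eq] using congrArg star h2
  have horth : ∀ i j, i ≠ j → q (i + 1) * q (j + 1) = 0 := fun i j hij => by
    rcases lt_or_gt_of_ne hij with h | h
    · exact (hlt _ _ h).2
    · exact (hlt _ _ h).1
  have hlink : ∀ k s, IsStarProjection s → s * q k = q k → s * q (k + 1) = q (k + 1) →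
      IsLink (q k) (q (k + 1)) s 10 13 := fun k s hs h1 h2 =>
    isLink_of_halving hB hG (hU k) (hU (k + 1)) (hVU k).1 (hVU k).2.1 (hVU k).2.2.1
      (hVU k).2.2.2 hs h1 h2
  have hq0 : q 0 = 1 := by simp [hq_def, hU0]
  have hl0 := hlink 0 1 (IsStarProjection.one A) (one_mul _) (one_mul _)
  obtain ⟨w, b, c, hw, -, hb, hqb, -, hc, h⟩ := hl0.exists_eq a ha (by rw [hq0, one_mul])
  obtain ⟨ν, c', hν, -, hc', h'⟩ := hl0.exists_eq_mul
  obtain ⟨t, ht, htb⟩ := IsLink.exists_sub_mem_closure (q := fun k => q (k + 1))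
    (fun k => hq (k + 1)) horth (K := 10) (n := 13) (by norm_num) (fun k => hlink (k + 1) _
      ((hq (k + 1)).add (hq (k + 2)) (horth k (k + 1) (by omega)))
      (by rw [add_mul, (hq (k + 1)).isIdempotentElem.eq, horth (k + 1) k (by omega), add_zero])
      (by rw [add_mul, (hq (k + 2)).isIdempotentElem.eq, horth k (k + 1) (by omega), zero_add]))
    hb hqb
  refine ⟨w + t * ν, add_mem hw (mul_mem ht hν), ?_⟩
  have h1 : a - (w + t * ν) = (b - t * q (0 + 1)) + t * c' + c := by
    rw [h, h', hq0]
    simp only [mul_one, mul_add]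
    abel
  rw [h1]
  exact add_mem (add_mem htb (CommSum.mem_closure (CommSum.central_mul ht hc')))
    (CommSum.mem_closure hc)

end CentralApproximation

section Orthogonal

variable {ι : Type*} {H : Type u} [NormedAddCommGroup H] [InnerProductSpace ℂ H]

theorem orthogonalFamily_span_singleton {f : ι → H} (hf : ∀ i j, i ≠ j → inner ℂ (f i) (f j) = 0) :
    OrthogonalFamily ℂ (fun i => Submodule.span ℂ {f i})
      fun i => (Submodule.span ℂ {f i}).subtypeₗᵢ := by
  refine OrthogonalFamily.of_pairwise fun i j hij => ?_
  simpa [Function.onFun, Submodule.isOrtho_span] using hf i j hij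

theorem norm_sq_sum_of_inner_eq_zero {f : ι → H} (hf : ∀ i j, i ≠ j → inner ℂ (f i) (f j) = 0)
    (s : Finset ι) : ‖∑ i ∈ s, f i‖ ^ 2 = ∑ i ∈ s, ‖f i‖ ^ 2 :=
  (orthogonalFamily_span_singleton hf).norm_sum
    (fun i => ⟨f i, Submodule.mem_span_singleton_self _⟩) s

variable [CompleteSpace H]

theorem summable_of_inner_eq_zero {f : ι → H} (hf : ∀ i j, i ≠ j → inner ℂ (f i) (f j) = 0)
    (h : Summable fun i => ‖f i‖ ^ 2) : Summable f :=
  ((orthogonalFamily_span_singleton hf).summable_iff_norm_sq_summable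
    (fun i => ⟨f i, Submodule.mem_span_singleton_self _⟩)).2 h

theorem inner_apply_eq_zero_of_star_mul {a b : H →L[ℂ] H} (h : star a * b = 0) (v w : H) :
    inner ℂ (a v) (b w) = 0 := by
  rw [← ContinuousLinearMap.adjoint_inner_right]
  have := congrArg (fun T : H →L[ℂ] H => T w) h
  rw [ContinuousLinearMap.star_eq_adjoint] at this
  simp at this
  rw [this, inner_zero_right]

theorem sum_norm_sq_le_of_isStarProjection {P : ι → H →L[ℂ] H} (hP : ∀ i, IsStarProjection (P i))
    (hPP : ∀ i j, i ≠ j → P i * P j = 0) (s : Finset ι) (v : H) :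
    ∑ i ∈ s, ‖P i v‖ ^ 2 ≤ ‖v‖ ^ 2 := by
  have hQ : IsStarProjection (∑ i ∈ s, P i) := by
    classical
    induction s using Finset.induction_on with
    | empty => simp
    | insert i s hi ih =>
      rw [Finset.sum_insert hi]
      refine (hP i).add ih ?_
      rw [Finset.mul_sum]
      exact Finset.sum_eq_zero fun j hj => hPP _ _ fun h => hi (h ▸ hj)
  have h1 := norm_sq_sum_of_inner_eq_zero (f := fun i => P i v) (fun i j hij =>
    inner_apply_eq_zero_of_star_mul (by rw [(hP i).isSelfAdjoint.star_eq, hPP i j hij]) v v) s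
  rw [← h1, ← sum_apply]
  have h2 := (∑ i ∈ s, P i).le_of_opNorm_le hQ.norm_le v
  rw [one_mul] at h2
  exact pow_le_pow_left₀ (norm_nonneg _) h2 2

end Orthogonal

namespace VonNeumannAlgebra

variable {H : Type u} [NormedAddCommGroup H] [InnerProductSpace ℂ H] [CompleteSpace H]
  (M : VonNeumannAlgebra H)

theorem isClosed : IsClosed (M.toStarSubalgebra : Set (H →L[ℂ] H)) := by
  rw [coe_toStarSubalgebra, ← centralizer_centralizer]
  exact Set.isClosed_centralizer _

/-- A von Neumann algebra as an abstract C*-algebra. -/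
noncomputable abbrev cstarAlgebra : CStarAlgebra M.toStarSubalgebra :=
  StarSubalgebra.cstarAlgebra M.toStarSubalgebra (h_closed := M.isClosed)

attribute [local instance] cstarAlgebra

variable {M}

theorem mem_toStarSubalgebra_of_commute {x : H →L[ℂ] H}
    (h : ∀ y ∈ M.commutant, ∀ v, x (y v) = y (x v)) : x ∈ M.toStarSubalgebra := by
  change x ∈ M
  rw [← M.commutant_commutant, mem_commutant_iff]
  intro y hy
  ext v
  exact (h y hy v).symm

theorem isBaerStar : IsBaerStar M.toStarSubalgebra := by
  intro X
  set N : Submodule ℂ H := ⨅ x : X, (star (x.1 : H →L[ℂ] H)).ker with hN_def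
  have hN : ∀ v, v ∈ N ↔ ∀ x ∈ X, star (x : H →L[ℂ] H) v = 0 := by
    intro v
    simp [hN_def]
  have hNc : IsClosed (N : Set H) := by
    rw [hN_def, Submodule.coe_iInf]
    exact isClosed_iInter fun x => (star (x.1 : H →L[ℂ] H)).isClosed_ker
  have : CompleteSpace N := hNc.completeSpace_coe
  have hQ := isStarProjection_starProjection (U := N)
  have hQM : N.starProjection ∈ M.toStarSubalgebra := by
    refine (IsStarProjection.mem_iff hQ M).2 fun y hy => ?_
    rw [Submodule.range_starProjection, Module.End.mem_invtSubmodule]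
    intro v hv
    refine (hN _).2 fun x hx => ?_
    have h1 := mem_commutant_iff.1 hy _ (star_mem x.2)
    have h2 := congrArg (fun T : H →L[ℂ] H => T v) h1
    have h3 := (hN v).1 hv x hx
    simp [mul_apply_eq_comp] at h2
    simpa [h3] using h2
  have hQM' : IsStarProjection (⟨N.starProjection, hQM⟩ : M.toStarSubalgebra) :=
    ⟨Subtype.ext hQ.isIdempotentElem, Subtype.ext hQ.isSelfAdjoint⟩
  refine ⟨1 - ⟨N.starProjection, hQM⟩, hQM'.one_sub, fun y => ⟨fun hy x hx => ?_, fun hy => ?_⟩⟩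
  · have hQx : N.starProjection * (x : H →L[ℂ] H) = 0 := by
      ext v
      refine (Submodule.starProjection_apply_eq_zero_iff N).2 ?_
      refine (Submodule.mem_orthogonal _ _).2 fun w hw => ?_
      have h5 : inner ℂ (star (x : H →L[ℂ] H) w) v = inner ℂ w ((x : H →L[ℂ] H) v) :=
        ContinuousLinearMap.adjoint_inner_left _ _ _
      change inner ℂ w ((x : H →L[ℂ] H) v) = 0
      rw [← h5, (hN w).1 hw x hx, inner_zero_left]
    have hQx' : (⟨N.starProjection, hQM⟩ : M.toStarSubalgebra) * x = 0 := Subtype.ext hQx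
    calc y * x = y * (1 - ⟨N.starProjection, hQM⟩) * x := by
          rw [mul_assoc, sub_mul, hQx', one_mul, sub_zero]
      _ = 0 := by rw [hy, zero_mul]
  · have hQy : N.starProjection * star (y : H →L[ℂ] H) = star (y : H →L[ℂ] H) := by
      ext v
      refine Submodule.starProjection_eq_self_iff.2 ((hN _).2 fun x hx => ?_)
      have h1 : star (x : H →L[ℂ] H) * star (y : H →L[ℂ] H) = 0 := by
        rw [← star_mul]
        have h2 : (y : H →L[ℂ] H) * x = 0 := congrArg Subtype.val (hy x hx)
        rw [h2, star_zero]
      exact congrArg (fun T : H →L[ℂ] H => T v) h1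
    have hQy' : y * (⟨N.starProjection, hQM⟩ : M.toStarSubalgebra) = y := by
      refine Subtype.ext ?_
      have h1 := congrArg star hQy
      rwa [star_mul, star_star, hQ.isSelfAdjoint.star_eq] at h1
    rw [mul_sub, mul_one, hQy', sub_self]

theorem hasOrthogonalSums : HasOrthogonalSums M.toStarSubalgebra := by
  intro ι x B hB hx h1 h2
  choose P hP hxP using fun i => M.isBaerStar {star (x i)}
  simp only [Set.mem_singleton_iff, forall_eq] at hxP
  have hxP' : ∀ i, x i * P i = x i := fun i => by
    have h3 := (hxP i (1 - P i)).1 (hP i).one_sub_mul_self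
    have h4 := congrArg star h3
    rw [star_mul, star_star, (hP i).one_sub.isSelfAdjoint.star_eq, mul_sub, mul_one, star_zero,
      sub_eq_zero] at h4
    exact h4.symm
  have hPP : ∀ i j, i ≠ j → P i * P j = 0 := fun i j hij => by
    have h3 := congrArg star ((hxP j (x i)).2 (h2 i j hij))
    rw [star_mul, (hP j).isSelfAdjoint.star_eq, star_zero] at h3
    have h4 := congrArg star ((hxP i (P j)).2 h3)
    rwa [star_mul, (hP j).isSelfAdjoint.star_eq, (hP i).isSelfAdjoint.star_eq, star_zero] at h4
  have hPc : ∀ i, IsStarProjection (P i : H →L[ℂ] H) := fun i =>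
    ⟨congrArg Subtype.val (hP i).isIdempotentElem.eq,
      congrArg Subtype.val (hP i).isSelfAdjoint.star_eq⟩
  have horth : ∀ v i j, i ≠ j →
      inner ℂ ((x i : H →L[ℂ] H) v) ((x j : H →L[ℂ] H) v) = 0 := fun v i j hij =>
    inner_apply_eq_zero_of_star_mul (congrArg Subtype.val (h1 i j hij)) v v
  have hxn : ∀ v i, ‖(x i : H →L[ℂ] H) v‖ ^ 2 ≤ B ^ 2 * ‖(P i : H →L[ℂ] H) v‖ ^ 2 := by
    intro v i
    have h3 : (x i : H →L[ℂ] H) v = (x i : H →L[ℂ] H) ((P i : H →L[ℂ] H) v) :=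
      (congrArg (fun T : M.toStarSubalgebra => (T : H →L[ℂ] H) v) (hxP' i)).symm
    rw [h3, ← mul_pow]
    exact pow_le_pow_left₀ (norm_nonneg _) ((x i : H →L[ℂ] H).le_of_opNorm_le (hx i) _) 2
  have hsum : ∀ v (s : Finset ι), ∑ i ∈ s, ‖(x i : H →L[ℂ] H) v‖ ^ 2 ≤ (B * ‖v‖) ^ 2 := by
    intro v s
    refine (Finset.sum_le_sum fun i _ => hxn v i).trans ?_
    rw [← Finset.mul_sum, mul_pow]
    exact mul_le_mul_of_nonneg_left (sum_norm_sq_le_of_isStarProjection hPc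
      (fun i j hij => congrArg Subtype.val (hPP i j hij)) s v) (sq_nonneg B)
  have hS : ∀ v, Summable fun i => (x i : H →L[ℂ] H) v := fun v =>
    summable_of_inner_eq_zero (horth v)
      (summable_of_sum_le (fun i => sq_nonneg _) (hsum v))
  have hle : ∀ v, ‖∑' i, (x i : H →L[ℂ] H) v‖ ≤ B * ‖v‖ := fun v => by
    refine le_of_tendsto (hS v).hasSum.norm (Filter.Eventually.of_forall fun s => ?_)
    refine (sq_le_sq₀ (norm_nonneg _) (mul_nonneg hB (norm_nonneg v))).1 ?_
    rw [norm_sq_sum_of_inner_eq_zero (horth v)]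
    exact hsum v s
  let X : H →L[ℂ] H := LinearMap.mkContinuous
    { toFun := fun v => ∑' i, (x i : H →L[ℂ] H) v
      map_add' := fun v w => by simp only [map_add, (hS v).tsum_add (hS w)]
      map_smul' := fun c v => by
          simp only [map_smul, (hS v).tsum_const_smul, RingHom.id_apply] } B hle
  have hX : ∀ v, X v = ∑' i, (x i : H →L[ℂ] H) v := fun _ => rfl
  have hXM : X ∈ M.toStarSubalgebra := mem_toStarSubalgebra_of_commute fun y hy v => by
    rw [hX, hX, y.map_tsum (hS v)]
    refine tsum_congr fun i => ?_
    exact congrArg (fun T : H →L[ℂ] H => T v) (mem_commutant_iff.1 hy _ (x i).2)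
  have hab : ∀ (a b : M.toStarSubalgebra) v, ((a * ⟨X, hXM⟩ * b : M.toStarSubalgebra) : H →L[ℂ] H) v
      = ∑' i, ((a * x i * b : M.toStarSubalgebra) : H →L[ℂ] H) v := fun a b v =>
    (a : H →L[ℂ] H).map_tsum (hS ((b : H →L[ℂ] H) v))
  have hz : ∀ {T : M.toStarSubalgebra} (v), T = 0 → (T : H →L[ℂ] H) v = 0 := by
    rintro _ v rfl
    rfl
  refine ⟨⟨X, hXM⟩, LinearMap.mkContinuous_norm_le _ hB hle, fun a b i h => ?_, fun a b h => ?_⟩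
  · ext v
    rw [hab, tsum_eq_single i fun j hj => hz v (h j hj)]
  · ext v
    rw [hab, tsum_congr fun j => hz v (h j), tsum_zero]
    rfl

end VonNeumannAlgebra

/-- Finite sums of the maps `x ↦ {a b x} - {b a x}`. -/
def IsInnerTriple {A : Type*} [NonUnitalRing A] [Module ℂ A] [Star A] (f : A → A) : Prop :=
  ∃ (n : ℕ) (a b : Fin n → A),
    ∀ x, f x = ∑ i, (tripleProd (a i) (b i) x - tripleProd (b i) (a i) x)

section InnerTriple

variable {A : Type*} [CStarAlgebra A]

namespace IsInnerTriple

theorem add {f g : A → A} (hf : IsInnerTriple f) (hg : IsInnerTriple g) :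
    IsInnerTriple fun x => f x + g x := by
  obtain ⟨m, a, b, hf⟩ := hf
  obtain ⟨n, a', b', hg⟩ := hg
  refine ⟨m + n, Fin.append a a', Fin.append b b', fun x => ?_⟩
  change f x + g x = _
  rw [Fin.sum_univ_add, hf, hg]
  simp

theorem zero : IsInnerTriple fun _ : A => (0 : A) :=
  ⟨0, Fin.elim0, Fin.elim0, fun x => by simp⟩

theorem single (a b : A) : IsInnerTriple fun x => tripleProd a b x - tripleProd b a x :=
  ⟨1, fun _ => a, fun _ => b, fun x => by simp⟩

theorem neg {f : A → A} (hf : IsInnerTriple f) : IsInnerTriple fun x => -f x := by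
  obtain ⟨m, a, b, hf⟩ := hf
  refine ⟨m, b, a, fun x => ?_⟩
  change -f x = _
  rw [hf, ← Finset.sum_neg_distrib]
  simp

theorem anticommutator {s : A} (hs : star s = -s) : IsInnerTriple fun x => s * x + x * s := by
  have h := single s 1
  convert h using 2 with x
  simp only [tripleProd, hs, star_one, mul_one, one_mul, neg_mul, mul_neg]
  module

theorem commutator_of_commutator (y z : A) : IsInnerTriple fun x =>
    (y * z - z * y - star (y * z - z * y)) * x - x * (y * z - z * y - star (y * z - z * y)) := by
  have hs : star (-(y * z + z * y - star (y * z + z * y))) =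
      -(-(y * z + z * y - star (y * z + z * y))) := by
    rw [star_neg, star_sub, star_star]
    abel
  have h := (single ((4 : ℂ) • y) (star z)).add (anticommutator hs)
  convert h using 2 with x
  simp only [tripleProd, star_smul, star_sub, star_add, star_mul, star_star, mul_add, add_mul,
    mul_sub, sub_mul, smul_mul_assoc, mul_smul_comm, mul_assoc, neg_mul, mul_neg, Complex.star_def]
  have : (starRingEnd ℂ) 4 = 4 := Complex.conj_ofNat 4
  rw [this]
  module

theorem commutator_of_mem_closure (μ : ℂ) {c : A}
    (hc : c ∈ AddSubgroup.closure {c : A | ∃ x y, c = x * y - y * x}) :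
    IsInnerTriple fun x => (μ • c - star (μ • c)) * x - x * (μ • c - star (μ • c)) := by
  induction hc using AddSubgroup.closure_induction with
  | mem c hc =>
    obtain ⟨y, z, rfl⟩ := hc
    have h := commutator_of_commutator (μ • y) z
    rwa [smul_mul_assoc, mul_smul_comm, ← smul_sub] at h
  | zero => simpa using zero
  | add c d _ _ hc hd =>
    convert hc.add hd using 2 with x
    simp only [smul_add, star_add, mul_add, add_mul, mul_sub, sub_mul]
    abel
  | neg c _ hc =>
    convert hc.neg using 2 with x
    simp only [smul_neg, star_neg, mul_sub, sub_mul, mul_neg, neg_mul]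
    abel

end IsInnerTriple

end InnerTriple

/-- Triple derivations of an AW*-algebra with strong orthogonal sums are inner. -/
theorem isInnerTriple_of_tripleDerivation {A : Type u} [CStarAlgebra A] (hB : IsBaerStar A)
    (hG : HasOrthogonalSums A) (δ : A →L[ℂ] A)
    (hder : ∀ a b c : A, δ (tripleProd a b c) =
      tripleProd (δ a) b c + tripleProd a (δ b) c + tripleProd a b (δ c)) : IsInnerTriple δ := by
  let _ : PartialOrder A := CStarAlgebra.spectralOrder A
  have : StarOrderedRing A := CStarAlgebra.spectralOrderedRing A
  set d := δ 1 with hd_def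
  have h1x1 : ∀ x : A, tripleProd 1 x 1 = star x := fun x => by
    simp only [tripleProd, one_mul, mul_one]
    module
  have hx1y : ∀ x y : A, tripleProd x 1 y = (2⁻¹ : ℂ) • (x * y + y * x) := fun x y => by
    simp only [tripleProd, star_one, mul_one]
  have hxx : ∀ x : A, tripleProd x 1 x = x * x := fun x => by
    rw [hx1y]
    module
  have hd : star d = -d := by
    have h := hder 1 1 1
    rw [hx1y d, hx1y 1 d, h1x1, ← hd_def, h1x1, star_one, ← hd_def] at h
    simp only [mul_one, one_mul] at h
    have h2 : d = (2⁻¹ : ℂ) • (d + d) := by module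
    rw [← h2] at h
    have h3 : star d = d + star d + d - d - d := by abel
    rw [← h] at h3
    rw [h3]
    abel
  let δ₀ : A →L[ℂ] A := δ - (2⁻¹ : ℂ) • (ContinuousLinearMap.mul ℂ A d +
    (ContinuousLinearMap.mul ℂ A).flip d)
  have hδ₀ : ∀ x, δ₀ x = δ x - (2⁻¹ : ℂ) • (d * x + x * d) := fun x => by simp [δ₀]
  have hsq : ∀ x, δ₀ (x * x) = δ₀ x * x + x * δ₀ x := fun x => by
    have h := hder x 1 x
    rw [hxx, hx1y, hx1y, ← hd_def] at h
    simp only [tripleProd, hd, mul_neg, neg_mul] at h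
    simp only [hδ₀, h, sub_mul, mul_sub, smul_mul_assoc, mul_smul_comm, add_mul, mul_add, mul_assoc]
    module
  have hstar : ∀ x, δ₀ (star x) = star (δ₀ x) := fun x => by
    have h := hder 1 x 1
    rw [h1x1, h1x1, ← hd_def] at h
    simp only [tripleProd, mul_one, one_mul] at h
    have h2 : (starRingEnd ℂ) 2⁻¹ = 2⁻¹ := by rw [map_inv₀, Complex.conj_ofNat]
    simp only [hδ₀, h, star_sub, star_smul, star_add, star_mul, hd, mul_neg, neg_mul,
      Complex.star_def, h2]
    module
  have hleib : ∀ x y, δ₀ (x * y) = δ₀ x * y + x * δ₀ y := by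
    refine jordan_derivation_leibniz (fun a ha => ?_) (fun a ha => ?_)
      (δ₀ : A →ₗ[ℂ] A).toAddMonoidHom hsq
    · have h : a = (2⁻¹ : ℂ) • (a + a) := by module
      rw [h, ha, smul_zero]
    · have h2 : star a * a = 0 := by
        rw [← CStarRing.star_mul_self_eq_zero_iff]
        rw [star_mul, star_star, mul_assoc, ← mul_assoc a, ha, mul_zero]
      exact CStarRing.star_mul_self_eq_zero_iff a |>.1 h2
  have hL : IsHermitianDerivation (Complex.I • δ₀) := by
    refine ⟨fun x y => ?_, fun x => ?_⟩
    · simp only [smul_apply, hleib, smul_add, smul_mul_assoc, mul_smul_comm]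
    · simp [smul_apply, hstar]
  obtain ⟨h, hh, hLh⟩ := hL.exists_eq_adL hB
  obtain ⟨z, hz, hc⟩ := hB.exists_center_sub_mem_closure hG hh
  have hz1 : ∀ x, x * z = z * x := Subalgebra.mem_center_iff.1 hz
  have hz2 : ∀ x, x * star z = star z * x := fun x => by
    simpa using (congrArg star (hz1 (star x))).symm
  have hs : star ((2⁻¹ : ℂ) • d) = -((2⁻¹ : ℂ) • d) := by
    simp [hd]
  convert (IsInnerTriple.commutator_of_mem_closure (-(Complex.I * 2⁻¹)) hc).add
    (IsInnerTriple.anticommutator hs) using 1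
  funext x
  have h1 : Complex.I • δ₀ x = h * x - x * h := by
    rw [← adL_apply, ← hLh, smul_apply]
  have h2 : δ₀ x = -Complex.I • (h * x - x * h) := by
    rw [← h1, smul_smul]
    simp
  have h3 : δ x = δ₀ x + (2⁻¹ : ℂ) • (d * x + x * d) := by rw [hδ₀]; abel
  rw [h3, h2]
  simp only [star_smul, star_sub, hh.star_eq, smul_sub, mul_sub, sub_mul, smul_mul_assoc,
    mul_smul_comm, hz1, hz2, Complex.star_def]
  have h4 : (starRingEnd ℂ) (-(Complex.I * 2⁻¹)) = Complex.I * 2⁻¹ := by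
    simp [Complex.conj_ofNat]
  rw [h4]
  module

/-- Every triple derivation on a von Neumann algebra `M ⊆ B(H)` is an inner triple
derivation: `δ x = Σᵢ ({aᵢ bᵢ x} - {bᵢ aᵢ x})` for finitely many `aᵢ, bᵢ ∈ M`. -/
theorem stmt_15 {H : Type*}
    [NormedAddCommGroup H] [InnerProductSpace ℂ H] [CompleteSpace H]
    (M : VonNeumannAlgebra H)
    (δ : M.toStarSubalgebra →L[ℂ] M.toStarSubalgebra)
    (hder : ∀ a b c : M.toStarSubalgebra,
      δ (tripleProd a b c) =
        tripleProd (δ a) b c + tripleProd a (δ b) c + tripleProd a b (δ c)) :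
    ∃ (n : ℕ) (a b : Fin n → M.toStarSubalgebra),
      ∀ x : M.toStarSubalgebra,
        δ x = ∑ i, (tripleProd (a i) (b i) x - tripleProd (b i) (a i) x) := by
  let _ := M.cstarAlgebra
  exact isInnerTriple_of_tripleDerivation VonNeumannAlgebra.isBaerStar
    VonNeumannAlgebra.hasOrthogonalSums δ hder
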